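/- Assume [H1] and [H2], and let ψ be the maximal L^p-solution on (0,T_max) of the nonlocal Fokker–Planck equation. If ψ₀ ∈ D^{σ_opt,p}(𝕋ⁿ) with σ_opt := (1/5)(8 + 2n/p), then for every ρ ∈ (0, (1/5)(1 − n/p)), ψ ∈ C^ρ([0,T_max), C^{1+ρ}(𝕋ⁿ)). In the case ψ₀ ∈ D^{8/5,∞}(𝕋ⁿ), then for every ρ ∈ (0, 1/5), ψ ∈ C^ρ([0,T_max), C^{1+ρ}(𝕋ⁿ)). -/

import Mathlib

open MeasureTheory ENNReal Set Filter

noncomputable section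

/-- Ambient space `ℝ × ℝ^m`: the universal cover of the torus `𝕋^{m+1}` (so `n = m + 1`). -/
abbrev Spc (m : ℕ) : Type := ℝ × (Fin m → ℝ)

/-- Unit cube in the last `m` coordinates: a fundamental domain for `𝕋^m`. -/
def cube1 (m : ℕ) : Set (Fin m → ℝ) := Set.pi Set.univ fun _ => Set.Ico (0 : ℝ) 1

/-- A fundamental domain for the torus `𝕋^{m+1}`. -/
def cube (m : ℕ) : Set (Spc m) := Set.Ico (0 : ℝ) 1 ×ˢ cube1 m

/-- The measure of the torus: Lebesgue measure restricted to a fundamental domain. -/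
def μT (m : ℕ) : Measure (Spc m) := volume.restrict (cube m)

/-- `ℤ^{m+1}`-periodicity: `f` is a function on the torus `𝕋^{m+1}`. -/
def IsPeriodic {m : ℕ} (f : Spc m → ℝ) : Prop :=
  ∀ (x : Spc m) (k : ℤ) (j : Fin m → ℤ), f (x.1 + k, fun i => x.2 i + j i) = f x

/-- The first coordinate direction. -/
def e1 (m : ℕ) : Spc m := (1, 0)

/-- The remaining coordinate directions. -/
def eC (m : ℕ) (i : Fin m) : Spc m := (0, Pi.single i 1)

/-- Partial derivative in the direction `v`. -/
def pd {m : ℕ} (v : Spc m) (f : Spc m → ℝ) (x : Spc m) : ℝ := fderiv ℝ f x v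

/-- `∇f ⋅ ∇g`. -/
def gradDot {m : ℕ} (f g : Spc m → ℝ) (x : Spc m) : ℝ :=
  pd (e1 m) f x * pd (e1 m) g x + ∑ i, pd (eC m i) f x * pd (eC m i) g x

/-- The Laplacian. -/
def lap {m : ℕ} (f : Spc m → ℝ) (x : Spc m) : ℝ :=
  pd (e1 m) (pd (e1 m) f) x + ∑ i, pd (eC m i) (pd (eC m i) f) x

/-- The marginal `ψ̄(x₁) = ∫_{𝕋^m} ψ(x₁, ⋅)`. -/
def marg {m : ℕ} (ψ : Spc m → ℝ) (x1 : ℝ) : ℝ := ∫ y in cube1 m, ψ (x1, y)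

/-- The nonlocal coefficient `φ_ψ = (∫ ∂_{x₁}V ψ dx₂…dxₙ) / ψ̄`. -/
def phiF {m : ℕ} (V ψ : Spc m → ℝ) (x1 : ℝ) : ℝ :=
  (∫ y in cube1 m, pd (e1 m) V (x1, y) * ψ (x1, y)) / marg ψ x1

/-- `F(ψ) = ∇V⋅∇ψ + ΔV ψ − ∂_{x₁}(φ_ψ ψ)`. -/
def Fop {m : ℕ} (V ψ : Spc m → ℝ) (x : Spc m) : ℝ :=
  gradDot V ψ x + lap V x * ψ x - pd (e1 m) (fun z => phiF V ψ z.1 * ψ z) x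

/-- `L^p`-norm on the torus. -/
def LpN {m : ℕ} (p : ℝ) (f : Spc m → ℝ) : ℝ≥0∞ := eLpNorm f (ENNReal.ofReal p) (μT m)

/-- Gagliardo (Sobolev–Slobodeckij) seminorm of fractional order `s`. -/
def gagl {m : ℕ} {F : Type*} [NormedAddCommGroup F] (s p : ℝ) (f : Spc m → F) : ℝ≥0∞ :=
  (∫⁻ x in cube m, ∫⁻ y in cube m,
      ENNReal.ofReal (‖f x - f y‖ ^ p / ‖x - y‖ ^ ((m : ℝ) + 1 + s * p))) ^ (1 / p)

/-- The differential of `f`. -/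
def grd {m : ℕ} (f : Spc m → ℝ) (x : Spc m) : Spc m →L[ℝ] ℝ := fderiv ℝ f x

/-- The `W^{σ,p}`-norm on the torus, for `0 ≤ σ ≤ 2`. -/
def WNorm {m : ℕ} (σ p : ℝ) (f : Spc m → ℝ) : ℝ≥0∞ :=
  if σ ≤ 0 then LpN p f
  else if σ < 1 then LpN p f + gagl σ p f
  else if σ < 2 then
    LpN p f + eLpNorm (fun x => ‖grd f x‖) (ENNReal.ofReal p) (μT m)
      + (if σ = 1 then 0 else gagl (σ - 1) p (grd f))
  else
    LpN p f + eLpNorm (fun x => ‖grd f x‖) (ENNReal.ofReal p) (μT m)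
      + eLpNorm (fun x => ‖iteratedFDeriv ℝ 2 f x‖) (ENNReal.ofReal p) (μT m)

/-- Membership in `W^{σ,p}(𝕋^{m+1})`, for `0 ≤ σ ≤ 2`. -/
def MemW {m : ℕ} (σ p : ℝ) (f : Spc m → ℝ) : Prop :=
  IsPeriodic f ∧ Measurable f ∧ (1 ≤ σ → Differentiable ℝ f) ∧
    (2 ≤ σ → Differentiable ℝ (grd f)) ∧ WNorm σ p f < ⊤

/-- Membership in `𝒟^{σ,p}(𝕋^{m+1}) = {ψ ∈ W^{σ,p} | ψ̄ > 0}`. -/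
def MemD {m : ℕ} (σ p : ℝ) (f : Spc m → ℝ) : Prop :=
  MemW σ p f ∧ ∀ x1 : ℝ, 0 < marg f x1

/-- Hypothesis `[H₁]`: `ψ₀ ∈ 𝒟^{σ,p}`, `ψ₀ ≥ 0`, `∫ ψ₀ = 1`. -/
def Hyp1 {m : ℕ} (σ p : ℝ) (ψ0 : Spc m → ℝ) : Prop :=
  MemD σ p ψ0 ∧ (∀ x, 0 ≤ ψ0 x) ∧ (∫ x in cube m, ψ0 x) = 1

/-- Hypothesis `[H₂]`: `n = m + 1 ≥ 2`, `p > n`, `σ ∈ (1 + n/p, 2)`. -/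
def Hyp2 (m : ℕ) (σ p : ℝ) : Prop :=
  1 ≤ m ∧ (m : ℝ) + 1 < p ∧ 1 + ((m : ℝ) + 1) / p < σ ∧ σ < 2

/-- The real interval `[0, Tmax)`, where `Tmax ∈ (0, ∞]`. -/
def Ico0 (Tmax : ℝ≥0∞) : Set ℝ := {t : ℝ | 0 ≤ t ∧ ENNReal.ofReal t < Tmax}

/-- The real interval `(0, Tmax)`, where `Tmax ∈ (0, ∞]`. -/
def Ioo0 (Tmax : ℝ≥0∞) : Set ℝ := {t : ℝ | 0 < t ∧ ENNReal.ofReal t < Tmax}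

/-- Continuity in `W^{σ,p}`-norm of a curve, on a time set `s`. -/
def ContW {m : ℕ} (σ p : ℝ) (s : Set ℝ) (ψ : ℝ → Spc m → ℝ) : Prop :=
  ∀ t ∈ s, ∀ ε : ℝ, 0 < ε → ∃ δ > 0, ∀ t' ∈ s, |t' - t| < δ →
    WNorm σ p (fun x => ψ t' x - ψ t x) < ENNReal.ofReal ε

/-- Hölder continuity (exponent `α`) in `W^{σ,p}`-norm of a curve, on a time set `s`. -/
def HolderW {m : ℕ} (α σ p : ℝ) (s : Set ℝ) (ψ : ℝ → Spc m → ℝ) : Prop :=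
  ∃ C : ℝ, ∀ t ∈ s, ∀ t' ∈ s,
    WNorm σ p (fun x => ψ t' x - ψ t x) ≤ ENNReal.ofReal (C * |t' - t| ^ α)

/-- `ψ` is an `L^p`-solution on `[0, Tmax)` of the nonlocal Fokker–Planck equation
`∂ₜψ = div(∇V ψ + β⁻¹∇ψ) − ∂_{x₁}(φ_ψ ψ) = β⁻¹Δψ + F(ψ)`, `ψ(0) = ψ₀`. -/
structure IsLpSolution {m : ℕ} (V : Spc m → ℝ) (β σ p : ℝ) (ψ0 : Spc m → ℝ)
    (Tmax : ℝ≥0∞) (ψ : ℝ → Spc m → ℝ) : Prop where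
  init : ∀ x, ψ 0 x = ψ0 x
  contLp : ContW 0 p (Ico0 Tmax) ψ
  regW2 : ∀ t ∈ Ioo0 Tmax, MemW 2 p (ψ t)
  regD : ∀ t ∈ Ioo0 Tmax, MemD σ p (ψ t)
  eqn : ∀ t ∈ Ioo0 Tmax,
    Tendsto (fun h : ℝ => LpN p
        (fun x => (ψ (t + h) x - ψ t x) / h - (β⁻¹ * lap (ψ t) x + Fop V (ψ t) x)))
      (nhdsWithin 0 {h : ℝ | h ≠ 0}) (nhds 0)
  derivCont : ContW 0 p (Ioo0 Tmax)
    (fun t x => β⁻¹ * lap (ψ t) x + Fop V (ψ t) x)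

/-- A maximal `L^p`-solution: an `L^p`-solution admitting no proper extension. -/
def IsMaximalLpSolution {m : ℕ} (V : Spc m → ℝ) (β σ p : ℝ) (ψ0 : Spc m → ℝ)
    (Tmax : ℝ≥0∞) (ψ : ℝ → Spc m → ℝ) : Prop :=
  IsLpSolution V β σ p ψ0 Tmax ψ ∧ 0 < Tmax ∧
    ∀ (Tmax' : ℝ≥0∞) (ψ' : ℝ → Spc m → ℝ), IsLpSolution V β σ p ψ0 Tmax' ψ' →
      (∀ t ∈ Ico0 Tmax, ψ' t = ψ t) → Tmax' ≤ Tmax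

/-- The Euclidean quadratic form on `Spc m`. -/
def qd {m : ℕ} (z : Spc m) : ℝ := z.1 ^ 2 + ∑ i, z.2 i ^ 2

/-- The heat semigroup `e^{β⁻¹ t Δ}` on the torus, realized by convolution with the Gaussian
heat kernel on the universal cover (and the identity for `t ≤ 0`). -/
def heatSG {m : ℕ} (β t : ℝ) (f : Spc m → ℝ) (x : Spc m) : ℝ :=
  if t ≤ 0 then f x
  else ∫ y : Spc m, (4 * Real.pi * (t / β)) ^ (-((m : ℝ) + 1) / 2) *
      Real.exp (-qd (x - y) / (4 * (t / β))) * f y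

/-- `ψ` is a mild solution of the nonlocal Fokker–Planck equation on `[0, Tmax)`:
`ψ ∈ C([0,Tmax), 𝒟^{σ,p})` and `ψ(t) = e^{β⁻¹tΔ}ψ₀ + ∫₀ᵗ e^{β⁻¹(t−s)Δ} F(ψ(s)) ds`. -/
def IsMildSolution {m : ℕ} (V : Spc m → ℝ) (β σ p : ℝ) (ψ0 : Spc m → ℝ)
    (Tmax : ℝ≥0∞) (ψ : ℝ → Spc m → ℝ) : Prop :=
  (∀ x, ψ 0 x = ψ0 x) ∧ (∀ t ∈ Ico0 Tmax, MemD σ p (ψ t)) ∧ ContW σ p (Ico0 Tmax) ψ ∧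
    ∀ t ∈ Ico0 Tmax, ∀ᵐ x ∂(volume : Measure (Spc m)),
      ψ t x = heatSG β t ψ0 x + ∫ s in Set.Ioc (0 : ℝ) t, heatSG β (t - s) (Fop V (ψ s)) x

/-- A maximal mild solution. -/
def IsMaximalMildSolution {m : ℕ} (V : Spc m → ℝ) (β σ p : ℝ) (ψ0 : Spc m → ℝ)
    (Tmax : ℝ≥0∞) (ψ : ℝ → Spc m → ℝ) : Prop :=
  IsMildSolution V β σ p ψ0 Tmax ψ ∧ 0 < Tmax ∧
    ∀ (Tmax' : ℝ≥0∞) (ψ' : ℝ → Spc m → ℝ), IsMildSolution V β σ p ψ0 Tmax' ψ' →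
      (∀ t ∈ Ico0 Tmax, ψ' t = ψ t) → Tmax' ≤ Tmax

/-- `L^p`-norm on the one-dimensional torus `𝕋`. -/
def LpN1 (p : ℝ) (g : ℝ → ℝ) : ℝ≥0∞ :=
  eLpNorm g (ENNReal.ofReal p) (volume.restrict (Set.Ico (0 : ℝ) 1))

/-- Membership in `L^p₀(𝕋^{m+1})`: periodic, `L^p` and of mean zero. -/
def MemL0 {m : ℕ} (p : ℝ) (f : Spc m → ℝ) : Prop :=
  IsPeriodic f ∧ Measurable f ∧ LpN p f < ⊤ ∧ (∫ x in cube m, f x) = 0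

/-- The `C^{1+ρ}(𝕋^{m+1})`-norm: sup norm of `f`, of its differential, and the `ρ`-Hölder
seminorm of the differential. -/
def C1rhoNorm {m : ℕ} (ρ : ℝ) (f : Spc m → ℝ) : ℝ≥0∞ :=
  (⨆ x : Spc m, ENNReal.ofReal |f x|) + (⨆ x : Spc m, ENNReal.ofReal ‖grd f x‖) +
    ⨆ (x : Spc m) (y : Spc m), ENNReal.ofReal (‖grd f x - grd f y‖ / ‖x - y‖ ^ ρ)

/-- Membership in `C^{1+ρ}(𝕋^{m+1})`. -/
def MemC1rho {m : ℕ} (ρ : ℝ) (f : Spc m → ℝ) : Prop :=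
  Differentiable ℝ f ∧ C1rhoNorm ρ f < ⊤

/-- `ψ ∈ C^ρ([0,Tmax), C^{1+ρ}(𝕋^{m+1}))`. -/
def HolderC1rho {m : ℕ} (ρ : ℝ) (Tmax : ℝ≥0∞) (ψ : ℝ → Spc m → ℝ) : Prop :=
  (∀ t ∈ Ico0 Tmax, MemC1rho ρ (ψ t)) ∧
    ∃ C : ℝ, ∀ s ∈ Ico0 Tmax, ∀ t ∈ Ico0 Tmax,
      C1rhoNorm ρ (fun x => ψ t x - ψ s x) ≤ ENNReal.ofReal (C * |t - s| ^ ρ)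

/-- Membership in `W^{σ,∞}(𝕋^{m+1})` for `σ ∈ (1,2)`, i.e. the Hölder space `C^{σ}`. -/
def MemWInf {m : ℕ} (σ : ℝ) (f : Spc m → ℝ) : Prop :=
  IsPeriodic f ∧ MemC1rho (σ - 1) f

instance haarSpc (m : ℕ) : (volume : Measure (Spc m)).IsAddHaarMeasure := by
  rw [Measure.volume_eq_prod]; infer_instance

/-- Periodicity for general targets. -/
def Per {m : ℕ} {Y : Type*} (f : Spc m → Y) : Prop :=
  ∀ (x : Spc m) (k : ℤ) (j : Fin m → ℤ), f (x.1 + k, fun i => x.2 i + j i) = f x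

def bas (m : ℕ) : Module.Basis (Unit ⊕ Fin m) ℝ (Spc m) :=
  (Module.Basis.singleton Unit ℝ).prod (Pi.basisFun ℝ (Fin m))

lemma cube_eq (m : ℕ) : cube m = ZSpan.fundamentalDomain (bas m) := by
  ext x
  simp only [cube, cube1, ZSpan.fundamentalDomain, bas, Set.mem_prod, Set.mem_pi, Set.mem_univ,
    true_implies, Set.mem_ofPred_eq, Sum.forall]
  simp

lemma meas_cube1 (m : ℕ) : MeasurableSet (cube1 m) :=
  MeasurableSet.univ_pi fun _ => measurableSet_Ico

lemma meas_cube (m : ℕ) : MeasurableSet (cube m) := measurableSet_Ico.prod (meas_cube1 m)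

lemma vol_cube1 (m : ℕ) : volume (cube1 m) = 1 := by
  simp [cube1, Real.volume_pi_Ico]

lemma vol_cube (m : ℕ) : volume (cube m) = 1 := by
  rw [cube, Measure.volume_eq_prod, Measure.prod_prod, vol_cube1]; simp

instance probT (m : ℕ) : IsProbabilityMeasure (μT m) :=
  ⟨by simp [μT, vol_cube]⟩

instance prob1 (m : ℕ) : IsProbabilityMeasure (volume.restrict (cube1 m)) :=
  ⟨by simp [vol_cube1]⟩

lemma μT_prod (m : ℕ) : μT m =
    (volume.restrict (Set.Ico (0:ℝ) 1)).prod (volume.restrict (cube1 m)) := by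
  rw [μT, cube, Measure.volume_eq_prod, Measure.prod_restrict]

lemma Per.lat {m : ℕ} {Y : Type*} {f : Spc m → Y} (hf : Per f)
    (g : Submodule.span ℤ (Set.range (bas m))) (x : Spc m) : f (g +ᵥ x) = f x := by
  have h : ∃ (k : ℤ) (j : Fin m → ℤ), (g : Spc m) = ((k : ℝ), fun i => (j i : ℝ)) := by
    obtain ⟨g, hg⟩ := g
    rw [Module.Basis.mem_span_iff_repr_mem] at hg
    choose c hc using hg
    refine ⟨c (Sum.inl ()), fun i => c (Sum.inr i), ?_⟩
    have h1 := hc (Sum.inl ())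
    have h2 := fun i => hc (Sum.inr i)
    simp [bas] at h1 h2
    ext <;> simp [h1, h2]
  obtain ⟨k, j, h⟩ := h
  have := hf x k j
  rw [← this]
  congr 1
  change (g : Spc m) + x = _
  rw [h]
  ext <;> simp [add_comm]

lemma fdom (m : ℕ) : IsAddFundamentalDomain (Submodule.span ℤ (Set.range (bas m))) (cube m)
    (volume : Measure (Spc m)) := by
  rw [cube_eq]; exact ZSpan.isAddFundamentalDomain _ _

lemma fdom_tr {m : ℕ} (v : Spc m) :
    IsAddFundamentalDomain (Submodule.span ℤ (Set.range (bas m))) ((fun u => v + u) ⁻¹' cube m)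
    (volume : Measure (Spc m)) := by
  have := (fdom m).preimage_of_equiv (f := fun u => v + u)
    (measurePreserving_add_left volume v).quasiMeasurePreserving (e := id) Function.bijective_id
    (fun g x => by
      change v + ((g : Spc m) + x) = (g : Spc m) + (v + x)
      abel)
  exact this

/-- Torus translation invariance. -/
lemma TI {m : ℕ} {h : Spc m → ℝ≥0∞} (hp : Per h) (v : Spc m) :
    ∫⁻ u in cube m, h (v + u) = ∫⁻ u in cube m, h u := by
  have hinv : VAddInvariantMeasure (Submodule.span ℤ (Set.range (bas m))) (Spc m) volume :=
    inferInstanceAs <| VAddInvariantMeasure (Submodule.span ℤ (Set.range (bas m))).toAddSubgroup (Spc m) volume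
  have hmv : MeasurableConstVAdd (Submodule.span ℤ (Set.range (bas m))) (Spc m) :=
    inferInstanceAs <| MeasurableConstVAdd (Submodule.span ℤ (Set.range (bas m))).toAddSubgroup (Spc m)
  have h1 := (fdom_tr (-v)).setLIntegral_eq (fdom m) h hp.lat
  rw [← h1]
  have h2 := (measurePreserving_add_left volume v).setLIntegral_comp_preimage_emb
    (MeasurableEquiv.addLeft v).measurableEmbedding h ((fun u => -v + u) ⁻¹' cube m)
  rw [← h2]
  congr 2
  ext u; simp

lemma TIint {m : ℕ} {h : Spc m → ℝ} (hp : Per h) (v : Spc m) :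
    ∫ u in cube m, h (v + u) = ∫ u in cube m, h u := by
  have hinv : VAddInvariantMeasure (Submodule.span ℤ (Set.range (bas m))) (Spc m) volume :=
    inferInstanceAs <| VAddInvariantMeasure (Submodule.span ℤ (Set.range (bas m))).toAddSubgroup (Spc m) volume
  have hmv : MeasurableConstVAdd (Submodule.span ℤ (Set.range (bas m))) (Spc m) :=
    inferInstanceAs <| MeasurableConstVAdd (Submodule.span ℤ (Set.range (bas m))).toAddSubgroup (Spc m)
  have h1 := (fdom_tr (-v)).setIntegral_eq (fdom m) (f := h) hp.lat
  rw [← h1]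
  have h2 := (measurePreserving_add_left volume v).setIntegral_preimage_emb
    (MeasurableEquiv.addLeft v).measurableEmbedding h ((fun u => -v + u) ⁻¹' cube m)
  rw [← h2]
  congr 2
  ext u; simp

/-! dot product and coordinates -/
def dt {m : ℕ} (z v : Spc m) : ℝ := z.1 * v.1 + ∑ i, z.2 i * v.2 i

def ed {m : ℕ} : Option (Fin m) → Spc m
  | none => e1 m
  | some i => eC m i

def co {m : ℕ} : Option (Fin m) → Spc m → ℝ
  | none => fun z => z.1
  | some i => fun z => z.2 i

lemma qd_eq {m : ℕ} (z : Spc m) : qd z = dt z z := by simp [qd, dt, sq]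
lemma qd_nonneg {m : ℕ} (z : Spc m) : 0 ≤ qd z := by
  unfold qd; positivity
lemma dt_add_left {m : ℕ} (x y v : Spc m) : dt (x + y) v = dt x v + dt y v := by
  simp only [dt, Prod.fst_add, Prod.snd_add, Pi.add_apply, add_mul, Finset.sum_add_distrib]; ring
lemma dt_smul_left {m : ℕ} (c : ℝ) (y v : Spc m) : dt (c • y) v = c * dt y v := by
  simp only [dt, Prod.smul_fst, Prod.smul_snd, Pi.smul_apply, smul_eq_mul, mul_add, Finset.mul_sum]
  simp [mul_assoc]
lemma dt_comm {m : ℕ} (x y : Spc m) : dt x y = dt y x := by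
  simp [dt, mul_comm]
lemma qd_add {m : ℕ} (x y : Spc m) : qd (x + y) = qd x + 2 * dt x y + qd y := by
  simp only [qd_eq, dt_add_left, dt_comm _ (x + y)]; rw [dt_comm y x]; ring

lemma qd_add_le {m : ℕ} (x y : Spc m) : qd (x + y) ≤ 2 * qd x + 2 * qd y := by
  have h : 0 ≤ qd (x + (-1 : ℝ) • y) := qd_nonneg _
  rw [qd_add, dt_comm, dt_smul_left] at h
  have h2 : qd ((-1:ℝ) • y) = qd y := by simp [qd]
  rw [h2, dt_comm y x] at h
  rw [qd_add]; linarith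

lemma norm_sq_le_qd {m : ℕ} (z : Spc m) : ‖z‖ ^ 2 ≤ qd z := by
  have h1 : ‖z.1‖ ^ 2 ≤ qd z := by
    simp only [qd, Real.norm_eq_abs, sq_abs]
    have : 0 ≤ ∑ i, z.2 i ^ 2 := by positivity
    linarith
  have h2 : ∀ i, ‖z.2 i‖ ^ 2 ≤ qd z := fun i => by
    simp only [qd, Real.norm_eq_abs, sq_abs]
    have := Finset.single_le_sum (f := fun i => z.2 i ^ 2) (fun i _ => sq_nonneg _) (Finset.mem_univ i)
    have := sq_nonneg z.1
    linarith
  have key : ‖z‖ ≤ √(qd z) := by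
    rw [Prod.norm_def, max_le_iff]
    refine ⟨Real.le_sqrt_of_sq_le h1, (pi_norm_le_iff_of_nonneg (Real.sqrt_nonneg _)).2 fun i => Real.le_sqrt_of_sq_le (h2 i)⟩
  calc ‖z‖ ^ 2 ≤ √(qd z) ^ 2 := by gcongr
    _ = qd z := Real.sq_sqrt (qd_nonneg z)

lemma abs_dt_le {m : ℕ} (z v : Spc m) : |dt z v| ≤ (m + 1) * (‖z‖ * ‖v‖) := by
  unfold dt
  have h1 : |z.1 * v.1| ≤ ‖z‖ * ‖v‖ := by
    rw [abs_mul]; exact mul_le_mul (norm_fst_le z) (norm_fst_le v) (abs_nonneg _) (norm_nonneg _)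
  have h2 : |∑ i, z.2 i * v.2 i| ≤ m * (‖z‖ * ‖v‖) := by
    refine (Finset.abs_sum_le_sum_abs _ _).trans ?_
    have : ∀ i ∈ Finset.univ, |z.2 i * v.2 i| ≤ ‖z‖ * ‖v‖ := fun i _ => by
      rw [abs_mul]
      exact mul_le_mul ((norm_le_pi_norm z.2 i).trans (norm_snd_le z))
        ((norm_le_pi_norm v.2 i).trans (norm_snd_le v)) (abs_nonneg _) (norm_nonneg _)
    refine (Finset.sum_le_sum this).trans ?_
    simp
  have := abs_add_le (z.1 * v.1) (∑ i, z.2 i * v.2 i)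
  linarith

lemma qd_le {m : ℕ} (z : Spc m) : qd z ≤ (m + 1) * ‖z‖ ^ 2 := by
  have := abs_dt_le z z
  rw [← qd_eq] at this
  have := le_abs_self (qd z)
  nlinarith

lemma norm_ed {m : ℕ} (o : Option (Fin m)) : ‖(ed o : Spc m)‖ = 1 := by
  cases o with
  | none => simp [ed, e1, Prod.norm_def]
  | some i => 
    have : ‖(Pi.single i (1:ℝ) : Fin m → ℝ)‖ = 1 := by simp [Pi.norm_single]
    simp [ed, eC, Prod.norm_def, this]

lemma cont_qd {m : ℕ} : Continuous (qd : Spc m → ℝ) := by unfold qd; fun_prop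
lemma cont_dt {m : ℕ} (v : Spc m) : Continuous (fun z : Spc m => dt z v) := by unfold dt; fun_prop

/-! Gaussian integrals -/
lemma exp_qd_prod {m : ℕ} (c : ℝ) (z : Spc m) :
    Real.exp (-c * qd z) = Real.exp (-c * z.1 ^ 2) * ∏ i, Real.exp (-c * z.2 i ^ 2) := by
  rw [← Real.exp_sum, ← Real.exp_add, qd, mul_add, Finset.mul_sum]

lemma integrable_gauss {m : ℕ} {c : ℝ} (hc : 0 < c) :
    Integrable (fun z : Spc m => Real.exp (-c * qd z)) := by
  simp_rw [exp_qd_prod]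
  refine Integrable.mul_prod (f := fun x : ℝ => Real.exp (-c * x ^ 2))
    (g := fun y : Fin m → ℝ => ∏ i, Real.exp (-c * y i ^ 2)) (integrable_exp_neg_mul_sq hc) ?_
  exact Integrable.fintype_prod (f := fun _ x => Real.exp (-c * x ^ 2)) fun _ => integrable_exp_neg_mul_sq hc

lemma integral_gauss {m : ℕ} (c : ℝ) :
    ∫ z : Spc m, Real.exp (-c * qd z) = √(Real.pi / c) ^ (m + 1) := by
  simp_rw [exp_qd_prod]
  rw [Measure.volume_eq_prod, integral_prod_mul (fun x : ℝ => Real.exp (-c * x ^ 2))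
    (fun y : Fin m → ℝ => ∏ i, Real.exp (-c * y i ^ 2)), integral_gaussian,
    integral_fintype_prod_volume_eq_prod (fun (_ : Fin m) x => Real.exp (-c * x ^ 2))]
  simp only [integral_gaussian, Finset.prod_const, Finset.card_univ, Fintype.card_fin]
  rw [pow_succ, mul_comm]

/-- key periodic bound -/
lemma L1P {m : ℕ} {c : ℝ} (hc : 0 < c) : ∃ C : ℝ, 0 < C ∧ ∀ h : Spc m → ℝ≥0∞, Measurable h → Per h →
    ∀ x, ∫⁻ z, ENNReal.ofReal (Real.exp (-c * qd z)) * h (x - z) ≤ ENNReal.ofReal C * ∫⁻ u in cube m, h u := by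
  set K : ℝ := Real.exp (c * (m + 1)) with hK
  set I : ℝ := ∫ z : Spc m, Real.exp (-(c/2) * qd z) with hI
  have hIpos : 0 < I := by rw [hI, integral_gauss]; positivity
  refine ⟨K * I, by positivity, fun h hm hp x => ?_⟩
  have hmz : Measurable fun z : Spc m => ENNReal.ofReal (Real.exp (-(c/2) * qd z)) :=
    (Real.measurable_exp.comp (cont_qd.measurable.const_mul _)).ennreal_ofReal
  have hmz' : Measurable fun z : Spc m => ENNReal.ofReal (Real.exp (-c * qd z)) :=
    (Real.measurable_exp.comp (cont_qd.measurable.const_mul _)).ennreal_ofReal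
  have hpt : ∀ u ∈ cube m, ∀ z, ENNReal.ofReal (Real.exp (-c * qd z)) ≤
      ENNReal.ofReal K * ENNReal.ofReal (Real.exp (-(c/2) * qd (z + u))) := by
    intro u hu z
    rw [← ENNReal.ofReal_mul (Real.exp_pos _).le, ← Real.exp_add]
    apply ENNReal.ofReal_le_ofReal
    apply Real.exp_le_exp.2
    have hun : ‖u‖ ≤ 1 := by
      obtain ⟨h1, h2⟩ := hu
      rw [Prod.norm_def, max_le_iff]
      refine ⟨by rw [Real.norm_eq_abs, abs_of_nonneg h1.1]; exact h1.2.le,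
        (pi_norm_le_iff_of_nonneg zero_le_one).2 fun i => ?_⟩
      have := h2 i (Set.mem_univ i)
      rw [Real.norm_eq_abs, abs_of_nonneg this.1]; exact this.2.le
    have h1 := qd_add_le z u
    have h2 : qd u ≤ m + 1 := (qd_le u).trans (by
      have : ‖u‖ ^ 2 ≤ 1 := pow_le_one₀ (norm_nonneg _) hun
      nlinarith)
    nlinarith
  calc ∫⁻ z, ENNReal.ofReal (Real.exp (-c * qd z)) * h (x - z)
      = ∫⁻ u in cube m, ∫⁻ z, ENNReal.ofReal (Real.exp (-c * qd z)) * h (x - z) := by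
        rw [setLIntegral_const, vol_cube, mul_one]
    _ ≤ ∫⁻ u in cube m, ∫⁻ z, ENNReal.ofReal K * (ENNReal.ofReal (Real.exp (-(c/2) * qd (z + u))) * h (x - z)) := by
        refine setLIntegral_mono' (meas_cube m) fun u hu => lintegral_mono fun z => ?_
        rw [← mul_assoc]
        gcongr
        exact hpt u hu z
    _ = ∫⁻ u in cube m, ENNReal.ofReal K * ∫⁻ w, (ENNReal.ofReal (Real.exp (-(c/2) * qd w)) * h (x - w + u)) := by
        congr 1; ext u
        rw [lintegral_const_mul _ (by
          refine Measurable.mul ?_ (hm.comp (measurable_const.sub measurable_id))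
          exact hmz.comp (measurable_id.add_const u))]
        congr 1
        rw [← lintegral_add_right_eq_self (fun w => (ENNReal.ofReal (Real.exp (-(c/2) * qd w)) * h (x - w + u))) u]
        congr 1; ext z; congr 2; abel
    _ = ENNReal.ofReal K * ∫⁻ w, ∫⁻ u in cube m, (ENNReal.ofReal (Real.exp (-(c/2) * qd w)) * h (x - w + u)) := by
        have hmm : Measurable fun q : Spc m × Spc m => ENNReal.ofReal (Real.exp (-(c/2) * qd q.2)) * h (x - q.2 + q.1) :=
          (hmz.comp measurable_snd).mul (hm.comp ((measurable_const.sub measurable_snd).add measurable_fst))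
        rw [lintegral_const_mul _ hmm.lintegral_prod_right', lintegral_lintegral_swap]
        exact hmm.aemeasurable
    _ = ENNReal.ofReal K * ∫⁻ w : Spc m, ENNReal.ofReal (Real.exp (-(c/2) * qd w)) * ∫⁻ u in cube m, h u := by
        congr 2; ext w
        have hw : Measurable fun u => h (x - w + u) := hm.comp (measurable_const_add (x - w))
        rw [lintegral_const_mul _ hw, TI hp]
    _ = ENNReal.ofReal (K * I) * ∫⁻ u in cube m, h u := by
        rw [lintegral_mul_const _ hmz, ENNReal.ofReal_mul (Real.exp_pos _).le, hI,
          ofReal_integral_eq_lintegral_ofReal (integrable_gauss (by positivity)) (ae_of_all _ fun _ => (Real.exp_pos _).le)]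
        ring

def Gk {m : ℕ} (a : ℝ) (z : Spc m) : ℝ := (√(Real.pi * 4 * a))⁻¹ ^ (m + 1) * Real.exp (-(1 / (4 * a)) * qd z)
def G1 {m : ℕ} (a : ℝ) (v z : Spc m) : ℝ := -(dt z v) / (2 * a) * Gk a z
def G2 {m : ℕ} (a : ℝ) (v w z : Spc m) : ℝ :=
  (dt z v * dt z w / (4 * a ^ 2) - dt v w / (2 * a)) * Gk a z
def Gt {m : ℕ} (a : ℝ) (z : Spc m) : ℝ := (qd z / (4 * a ^ 2) - (m + 1) / (2 * a)) * Gk a z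
def Hk {m : ℕ} (a : ℝ) (z : Spc m) : ℝ := (√a)⁻¹ ^ (m + 1) * Real.exp (-(1 / (16 * a)) * qd z)

lemma Hk_nonneg {m : ℕ} (a : ℝ) (z : Spc m) : 0 ≤ Hk a z := by unfold Hk; positivity
lemma Gk_nonneg {m : ℕ} (a : ℝ) (z : Spc m) : 0 ≤ Gk a z := by unfold Gk; positivity

def CH (m : ℕ) : ℝ := √(16 * Real.pi) ^ (m + 1)
lemma CH_pos (m : ℕ) : 0 < CH m := by unfold CH; positivity

lemma integrable_Hk {m : ℕ} {a : ℝ} (ha : 0 < a) : Integrable (Hk a : Spc m → ℝ) :=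
  (integrable_gauss (by positivity)).const_mul _

lemma integral_Hk {m : ℕ} {a : ℝ} (ha : 0 < a) : ∫ z : Spc m, Hk a z = CH m := by
  unfold Hk CH
  rw [integral_const_mul, integral_gauss, ← mul_pow]
  congr 1
  rw [show Real.pi / (1 / (16 * a)) = (16 * Real.pi) * a by field_simp, Real.sqrt_mul (by positivity)]
  field_simp

lemma integral_Gk {m : ℕ} {a : ℝ} (ha : 0 < a) : ∫ z : Spc m, Gk a z = 1 := by
  unfold Gk
  rw [integral_const_mul, integral_gauss, ← mul_pow]
  rw [show Real.pi / (1 / (4 * a)) = (Real.pi * 4 * a) by field_simp, inv_mul_cancel₀ (by positivity), one_pow]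

lemma KB {m : ℕ} {a : ℝ} (ha : 0 < a) (z : Spc m) :
    (1 + ‖z‖ / √a) ^ 3 * Gk a z ≤ 2 ^ 15 * Hk a z := by
  set s := ‖z‖ / √a with hs
  have hs0 : 0 ≤ s := by positivity
  have hsa : s ^ 2 ≤ qd z / a := by
    rw [hs, div_pow, Real.sq_sqrt ha.le]
    gcongr; exact norm_sq_le_qd z
  have h1 : (1 + s) ^ 3 ≤ 2 ^ 15 * Real.exp (3 * (s ^ 2 / 16)) := by
    have e1 : 1 + s ≤ 32 * Real.exp (s ^ 2 / 16) := by
      have := Real.add_one_le_exp (s ^ 2 / 16)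
      nlinarith [sq_nonneg (s - 1)]
    calc (1 + s) ^ 3 ≤ (32 * Real.exp (s ^ 2 / 16)) ^ 3 := by gcongr
      _ = 2 ^ 15 * Real.exp (3 * (s ^ 2 / 16)) := by
        rw [mul_pow, ← Real.exp_nat_mul]; norm_num
  have h2 : Gk a z ≤ (√a)⁻¹ ^ (m + 1) * Real.exp (-(1 / (4 * a)) * qd z) := by
    unfold Gk
    gcongr
    nlinarith [Real.pi_gt_three]
  calc (1 + s) ^ 3 * Gk a z ≤ (2 ^ 15 * Real.exp (3 * (s ^ 2 / 16))) * ((√a)⁻¹ ^ (m + 1) * Real.exp (-(1 / (4 * a)) * qd z)) := by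
        gcongr
        exact Gk_nonneg _ _
    _ = 2 ^ 15 * ((√a)⁻¹ ^ (m + 1) * Real.exp (3 * (s ^ 2 / 16) + -(1 / (4 * a)) * qd z)) := by
        rw [Real.exp_add]; ring
    _ ≤ _ := by
        unfold Hk
        gcongr
        have e : -(1 / (16 * a)) * qd z = 3 * (qd z / a / 16) + -(1 / (4 * a)) * qd z := by field_simp; ring
        rw [e]; gcongr

lemma norm_rpow_le {m : ℕ} {a θ : ℝ} (ha : 0 < a) (h0 : 0 ≤ θ) (h1 : θ ≤ 1) (z : Spc m) :
    ‖z‖ ^ θ ≤ a ^ (θ / 2) * (1 + ‖z‖ / √a) := by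
  have e : ‖z‖ ^ θ = a ^ (θ / 2) * (‖z‖ / √a) ^ θ := by
    rw [Real.div_rpow (norm_nonneg _) (Real.sqrt_nonneg _), Real.sqrt_eq_rpow, ← Real.rpow_mul ha.le]
    rw [show (1 / 2 * θ) = θ / 2 by ring]
    field_simp
  rw [e]
  gcongr
  have hs0 : 0 ≤ ‖z‖ / √a := by positivity
  calc (‖z‖ / √a) ^ θ ≤ (1 + ‖z‖ / √a) ^ θ := by gcongr; linarith
    _ ≤ (1 + ‖z‖ / √a) ^ (1 : ℝ) := Real.rpow_le_rpow_of_exponent_le (by linarith) h1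
    _ = _ := Real.rpow_one _

lemma k0 {m : ℕ} {a θ : ℝ} (ha : 0 < a) (h0 : 0 ≤ θ) (h1 : θ ≤ 1) (z : Spc m) :
    ‖z‖ ^ θ * |Gk a z| ≤ 2 ^ 15 * a ^ (θ / 2) * Hk a z := by
  rw [abs_of_nonneg (Gk_nonneg _ _)]
  have hs0 : 0 ≤ ‖z‖ / √a := by positivity
  calc ‖z‖ ^ θ * Gk a z ≤ (a ^ (θ / 2) * (1 + ‖z‖ / √a)) * Gk a z := by
        gcongr
        · exact Gk_nonneg _ _
        · exact norm_rpow_le ha h0 h1 z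
    _ ≤ a ^ (θ / 2) * ((1 + ‖z‖ / √a) ^ 3 * Gk a z) := by
        rw [mul_assoc]
        gcongr
        · exact Gk_nonneg _ _
        · nlinarith [pow_nonneg hs0 2, pow_nonneg hs0 3]
    _ ≤ a ^ (θ / 2) * (2 ^ 15 * Hk a z) := by gcongr ?_ * ?_; exact KB ha z
    _ = _ := by ring

lemma k1 {m : ℕ} {a : ℝ} (ha : 0 < a) (v z : Spc m) :
    |G1 a v z| ≤ 2 ^ 15 * (m + 1) * ‖v‖ * a ^ (-(1/2) : ℝ) * Hk a z := by
  have hs0 : 0 ≤ ‖z‖ / √a := by positivity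
  have hsa : 0 < √a := by positivity
  have e : |G1 a v z| = |dt z v| / (2 * a) * Gk a z := by
    rw [G1, abs_mul, abs_div, abs_neg, abs_of_pos (by positivity : 0 < 2 * a), abs_of_nonneg (Gk_nonneg _ _)]
  have e2 : a ^ (-(1/2) : ℝ) = (√a)⁻¹ := by rw [Real.rpow_neg ha.le, Real.sqrt_eq_rpow]
  rw [e, e2]
  have h3 : |dt z v| / (2 * a) ≤ (m + 1) * ‖v‖ * (√a)⁻¹ * (‖z‖ / √a) := by
    have : (m + 1) * ‖v‖ * (√a)⁻¹ * (‖z‖ / √a) = (m + 1) * (‖z‖ * ‖v‖) / a := by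
      conv_rhs => rw [← Real.mul_self_sqrt ha.le]
      field_simp
    rw [this, div_le_div_iff₀ (by positivity) ha]
    have := abs_dt_le z v
    have h0 : 0 ≤ |dt z v| := abs_nonneg _
    nlinarith
  calc |dt z v| / (2 * a) * Gk a z ≤ ((m + 1) * ‖v‖ * (√a)⁻¹ * (‖z‖ / √a)) * Gk a z := by
        gcongr; exact Gk_nonneg _ _
    _ ≤ ((m + 1) * ‖v‖ * (√a)⁻¹) * ((1 + ‖z‖ / √a) ^ 3 * Gk a z) := by
        rw [mul_assoc _ (‖z‖ / √a)]
        gcongr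
        · exact Gk_nonneg _ _
        · nlinarith [pow_nonneg hs0 2, pow_nonneg hs0 3]
    _ ≤ ((m + 1) * ‖v‖ * (√a)⁻¹) * (2 ^ 15 * Hk a z) := by gcongr ?_ * ?_; exact KB ha z
    _ = _ := by ring

lemma k2 {m : ℕ} {a θ : ℝ} (ha : 0 < a) (h0 : 0 ≤ θ) (h1 : θ ≤ 1) (v w z : Spc m) :
    ‖z‖ ^ θ * |G2 a v w z| ≤ 2 ^ 15 * (m + 1) ^ 2 * ‖v‖ * ‖w‖ * a ^ (-1 + θ / 2) * Hk a z := by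
  have hs0 : 0 ≤ ‖z‖ / √a := by positivity
  have hsa : 0 < √a := by positivity
  set s := ‖z‖ / √a with hs
  have hsq : s ^ 2 = ‖z‖ ^ 2 / a := by rw [hs, div_pow, Real.sq_sqrt ha.le]
  have e : |G2 a v w z| ≤ (m + 1) ^ 2 * ‖v‖ * ‖w‖ * a⁻¹ * ((1 + s) ^ 2 * Gk a z) := by
    rw [G2, abs_mul, abs_of_nonneg (Gk_nonneg _ _), ← mul_assoc]
    gcongr
    · exact Gk_nonneg _ _
    have h3 := abs_dt_le z v
    have h4 := abs_dt_le z w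
    have h5 := abs_dt_le v w
    have h6 : |dt z v * dt z w / (4 * a ^ 2)| ≤ (m + 1) ^ 2 * ‖v‖ * ‖w‖ * a⁻¹ * s ^ 2 := by
      rw [hsq, abs_div, abs_mul, abs_of_pos (by positivity : 0 < 4 * a ^ 2)]
      have : (m + 1) ^ 2 * ‖v‖ * ‖w‖ * a⁻¹ * (‖z‖ ^ 2 / a) = (((m:ℝ) + 1) * (‖z‖ * ‖v‖)) * ((m + 1) * (‖z‖ * ‖w‖)) / a ^ 2 := by
        field_simp
      rw [this]
      gcongr
      nlinarith [sq_nonneg a]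
    have h7 : |dt v w / (2 * a)| ≤ (m + 1) ^ 2 * ‖v‖ * ‖w‖ * a⁻¹ := by
      rw [abs_div, abs_of_pos (by positivity : 0 < 2 * a), ← div_eq_mul_inv]
      gcongr
      · refine h5.trans ?_
        have : (0:ℝ) ≤ ‖v‖ * ‖w‖ := by positivity
        have hm : (0:ℝ) ≤ m := by positivity
        nlinarith [mul_nonneg hm this, mul_nonneg (mul_nonneg hm hm) this]
      · linarith
    have := abs_sub (dt z v * dt z w / (4 * a ^ 2)) (dt v w / (2 * a))
    have hP : 0 ≤ ((m:ℝ) + 1) ^ 2 * ‖v‖ * ‖w‖ * a⁻¹ := by positivity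
    nlinarith [mul_nonneg hP hs0]
  have er : a ^ (-1 + θ / 2) = a⁻¹ * a ^ (θ / 2) := by
    rw [Real.rpow_add ha, Real.rpow_neg_one]
  rw [er]
  calc ‖z‖ ^ θ * |G2 a v w z| ≤ (a ^ (θ / 2) * (1 + s)) * ((m + 1) ^ 2 * ‖v‖ * ‖w‖ * a⁻¹ * ((1 + s) ^ 2 * Gk a z)) := by
        gcongr; exact norm_rpow_le ha h0 h1 z
    _ = (m + 1) ^ 2 * ‖v‖ * ‖w‖ * a⁻¹ * a ^ (θ / 2) * ((1 + s) ^ 3 * Gk a z) := by ring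
    _ ≤ (m + 1) ^ 2 * ‖v‖ * ‖w‖ * a⁻¹ * a ^ (θ / 2) * (2 ^ 15 * Hk a z) := by
        gcongr ?_ * ?_; exact KB ha z
    _ = _ := by ring

lemma sum_qd_ed {m : ℕ} (z : Spc m) : ∑ o : Option (Fin m), dt z (ed o) * dt z (ed o) = qd z := by
  rw [Fintype.sum_option]
  simp [ed, e1, eC, dt, qd, sq, Pi.single_apply]

lemma dt_ed {m : ℕ} (o : Option (Fin m)) : dt (ed o : Spc m) (ed o) = 1 := by
  cases o <;> simp [ed, e1, eC, dt, Pi.single_apply]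

lemma Gt_eq {m : ℕ} (a : ℝ) (z : Spc m) : Gt a z = ∑ o : Option (Fin m), G2 a (ed o) (ed o) z := by
  simp only [G2, ← Finset.sum_mul, Finset.sum_sub_distrib, ← Finset.sum_div, sum_qd_ed, dt_ed, Gt]
  simp

/-! derivatives -/
lemma deriv_qd_line {m : ℕ} (z w : Spc m) (u : ℝ) :
    HasDerivAt (fun u : ℝ => qd (z + u • w)) (2 * dt (z + u • w) w) u := by
  have h : (fun u : ℝ => qd (z + u • w)) = fun u => qd z + 2 * (u * dt z w) + u ^ 2 * qd w := by
    ext u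
    rw [qd_add, dt_comm z, dt_smul_left, dt_comm w z, qd_eq (u • w), dt_smul_left, dt_comm w, dt_smul_left, ← qd_eq]
    ring
  rw [h, dt_add_left, dt_smul_left, ← qd_eq]
  have h1 := ((hasDerivAt_id u).mul_const (dt z w)).const_mul 2
  have h2 := ((hasDerivAt_pow 2 u).mul_const (qd w))
  have := (h1.const_add (qd z)).add h2
  refine this.congr_deriv ?_
  norm_num; ring

lemma deriv_dt_line {m : ℕ} (z v w : Spc m) (u : ℝ) :
    HasDerivAt (fun u : ℝ => dt (z + u • w) v) (dt w v) u := by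
  simp_rw [dt_add_left, dt_smul_left]
  have := ((hasDerivAt_id u).mul_const (dt w v)).const_add (dt z v)
  simpa using this

lemma deriv_Gk {m : ℕ} {a : ℝ} (ha : 0 < a) (w z : Spc m) (u : ℝ) :
    HasDerivAt (fun u : ℝ => Gk a (z + u • w)) (G1 a w (z + u • w)) u := by
  unfold G1 Gk
  refine ((((deriv_qd_line z w u).const_mul (-(1 / (4 * a)))).exp).const_mul _).congr_deriv ?_
  field_simp; ring

lemma deriv_G1 {m : ℕ} {a : ℝ} (ha : 0 < a) (v w z : Spc m) (u : ℝ) :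
    HasDerivAt (fun u : ℝ => G1 a v (z + u • w)) (G2 a v w (z + u • w)) u := by
  have h1 := ((deriv_dt_line z v w u).neg.div_const (2 * a)).mul (deriv_Gk ha w z u)
  refine h1.congr_deriv ?_
  simp only [G2, G1, dt_comm w v, Pi.neg_apply]
  field_simp; ring

lemma deriv_Gk_a {m : ℕ} {a : ℝ} (ha : 0 < a) (z : Spc m) :
    HasDerivAt (fun a : ℝ => Gk a z) (Gt a z) a := by
  have h1 : HasDerivAt (fun a : ℝ => (√(Real.pi * 4 * a))⁻¹ ^ (m + 1))
     (-((m + 1) / (2 * a)) * (√(Real.pi * 4 * a))⁻¹ ^ (m + 1)) a := by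
    have hb := ((hasDerivAt_id a).const_mul (Real.pi * 4)).sqrt (by simp [ha.ne'])
    have hs : 0 < √(Real.pi * 4 * a) := by positivity
    refine ((hb.inv hs.ne').pow (m + 1)).congr_deriv ?_
    simp only [id, Pi.inv_apply]
    have e : √(Real.pi * 4 * a) ^ 2 = Real.pi * 4 * a := Real.sq_sqrt (by positivity)
    have e' : Real.pi * 4 = √(Real.pi * 4 * a) ^ 2 / a := by rw [e]; field_simp
    rw [show Real.pi * 4 * 1 = √(Real.pi * 4 * a) ^ 2 / a by rw [← e']; ring]
    generalize √(Real.pi * 4 * a) = s at *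
    rw [Nat.add_sub_cancel, pow_succ s⁻¹ m]
    push_cast
    field_simp
  have h2 : HasDerivAt (fun a : ℝ => Real.exp (-(1 / (4 * a)) * qd z)) (Real.exp (-(1 / (4 * a)) * qd z) * (qd z / (4 * a ^ 2))) a := by
    have hb : HasDerivAt (fun a : ℝ => -(1 / (4 * a)) * qd z) (qd z / (4 * a ^ 2)) a := by
      have := ((((hasDerivAt_id a).const_mul 4).inv (by simp [ha.ne'])).neg).mul_const (qd z)
      simp only [id] at this
      have e : (fun a : ℝ => -(1 / (4 * a)) * qd z) = fun a => -(4 * a)⁻¹ * qd z := by ext; simp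
      rw [e]
      refine this.congr_deriv ?_
      field_simp
    exact hb.exp
  refine (h1.mul h2).congr_deriv ?_
  unfold Gt Gk
  ring

lemma cont_Gk {m : ℕ} (a : ℝ) : Continuous (Gk a : Spc m → ℝ) := by
  unfold Gk; have := cont_qd (m := m); fun_prop
lemma cont_Hk {m : ℕ} (a : ℝ) : Continuous (Hk a : Spc m → ℝ) := by
  unfold Hk; have := cont_qd (m := m); fun_prop
lemma cont_G1 {m : ℕ} (a : ℝ) (v : Spc m) : Continuous (G1 a v) := by
  unfold G1; have := cont_Gk (m := m) a; have := cont_dt v; fun_prop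
lemma cont_G2 {m : ℕ} (a : ℝ) (v w : Spc m) : Continuous (G2 a v w) := by
  unfold G2; have := cont_Gk (m := m) a; have := cont_dt v; have := cont_dt w; fun_prop
lemma cont_Gt {m : ℕ} (a : ℝ) : Continuous (Gt a : Spc m → ℝ) := by
  unfold Gt; have := cont_Gk (m := m) a; have := cont_qd (m := m); fun_prop

def PI {m : ℕ} (f : Spc m → ℝ) : Prop := Per f ∧ Measurable f ∧ Integrable f (μT m)
def cv {m : ℕ} (k f : Spc m → ℝ) (x : Spc m) : ℝ := ∫ z, k z * f (x - z)
def Dec {m : ℕ} (k : Spc m → ℝ) : Prop :=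
  Continuous k ∧ ∃ C c : ℝ, 0 < c ∧ ∀ z, |k z| ≤ C * Real.exp (-c * qd z)

lemma Dec.of {m : ℕ} {k : Spc m → ℝ} (hk : Continuous k) {a K : ℝ} (ha : 0 < a)
    (h : ∀ z, |k z| ≤ K * Hk a z) : Dec k :=
  ⟨hk, K * (√a)⁻¹ ^ (m + 1), 1 / (16 * a), by positivity, fun z => by
    have := h z; unfold Hk at this; rwa [mul_assoc]⟩

lemma k0' {m : ℕ} {a : ℝ} (ha : 0 < a) (z : Spc m) : |Gk a z| ≤ 2 ^ 15 * Hk a z := by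
  have := k0 ha le_rfl zero_le_one z
  simpa using this
lemma k2' {m : ℕ} {a : ℝ} (ha : 0 < a) (v w z : Spc m) :
    |G2 a v w z| ≤ 2 ^ 15 * (m + 1) ^ 2 * ‖v‖ * ‖w‖ * a ^ (-1 : ℝ) * Hk a z := by
  have := k2 ha le_rfl zero_le_one v w z
  simpa using this
lemma kt {m : ℕ} {a : ℝ} (ha : 0 < a) (z : Spc m) :
    |Gt a z| ≤ 2 ^ 15 * (m + 1) ^ 3 * a ^ (-1 : ℝ) * Hk a z := by
  rw [Gt_eq]
  refine (Finset.abs_sum_le_sum_abs _ _).trans ?_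
  refine (Finset.sum_le_sum fun o _ => k2' ha (ed o) (ed o) z).trans ?_
  simp only [norm_ed]
  simp
  apply le_of_eq; ring

lemma dec_Gk {m : ℕ} {a : ℝ} (ha : 0 < a) : Dec (Gk a : Spc m → ℝ) := Dec.of (cont_Gk a) ha (k0' ha)
lemma dec_G1 {m : ℕ} {a : ℝ} (ha : 0 < a) (v : Spc m) : Dec (G1 a v) := Dec.of (cont_G1 a v) ha (k1 ha v)
lemma dec_G2 {m : ℕ} {a : ℝ} (ha : 0 < a) (v w : Spc m) : Dec (G2 a v w) := Dec.of (cont_G2 a v w) ha (k2' ha v w)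
lemma dec_Gt {m : ℕ} {a : ℝ} (ha : 0 < a) : Dec (Gt a : Spc m → ℝ) := Dec.of (cont_Gt a) ha (kt ha)

lemma PI.enorm_per {m : ℕ} {f : Spc m → ℝ} (hf : Per f) : Per (fun x => ‖f x‖ₑ) := fun x k j => by
  simp only [hf x k j]

lemma PI.l1 {m : ℕ} {f : Spc m → ℝ} (hf : PI f) {c : ℝ} (hc : 0 < c) (x : Spc m) :
    ∫⁻ z, ENNReal.ofReal (Real.exp (-c * qd z)) * ‖f (x - z)‖ₑ < ⊤ := by
  obtain ⟨C, hC, h⟩ := L1P (m := m) hc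
  refine (h _ hf.2.1.enorm (PI.enorm_per hf.1) x).trans_lt ?_
  exact ENNReal.mul_lt_top ENNReal.ofReal_lt_top hf.2.2.2

lemma PI.expi {m : ℕ} {f : Spc m → ℝ} (hf : PI f) {c : ℝ} (hc : 0 < c) (x : Spc m) :
    Integrable (fun z => Real.exp (-c * qd z) * f (x - z)) := by
  have := cont_qd (m := m)
  refine ⟨?_, ?_⟩
  · exact (Measurable.mul (by fun_prop) (hf.2.1.comp (measurable_const.sub measurable_id))).aestronglyMeasurable
  · refine lt_of_eq_of_lt ?_ (hf.l1 hc x)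
    refine lintegral_congr fun z => ?_
    rw [enorm_mul, Real.enorm_eq_ofReal (Real.exp_nonneg _)]

lemma PI.integ {m : ℕ} {k f : Spc m → ℝ} (hk : Dec k) (hf : PI f) (x : Spc m) :
    Integrable (fun z => k z * f (x - z)) := by
  obtain ⟨hk, C, c, hc, hb⟩ := hk
  refine ((hf.expi hc x).const_mul C).mono ?_ (ae_of_all _ fun z => ?_)
  · exact (hk.measurable.mul (hf.2.1.comp (measurable_const.sub measurable_id))).aestronglyMeasurable
  · rw [norm_mul, ← mul_assoc, norm_mul]
    gcongr
    rw [Real.norm_eq_abs, Real.norm_eq_abs]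
    exact (hb z).trans (le_abs_self _)

lemma Dec.int {m : ℕ} {k : Spc m → ℝ} (hk : Dec k) : Integrable k := by
  have h1 : PI (fun _ : Spc m => (1:ℝ)) := ⟨fun _ _ _ => rfl, measurable_const, integrable_const _⟩
  simpa using PI.integ hk h1 0

/-- differentiation under the convolution -/
lemma DI {m : ℕ} {f : Spc m → ℝ} (hf : PI f) (x : Spc m) {k k' : ℝ → Spc m → ℝ} {u0 ε C c : ℝ}
    (hε : 0 < ε) (hc : 0 < c) (hk : ∀ u, Continuous (k u)) (h0 : Dec (k u0)) (hk' : Continuous (k' u0))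
    (hd : ∀ z, ∀ u ∈ Metric.ball u0 ε, HasDerivAt (fun u => k u z) (k' u z) u)
    (hb : ∀ z, ∀ u ∈ Metric.ball u0 ε, |k' u z| ≤ C * Real.exp (-c * qd z)) :
    HasDerivAt (fun u => cv (k u) f x) (cv (k' u0) f x) u0 := by
  have hm : Measurable (fun z => f (x - z)) := hf.2.1.comp (measurable_const.sub measurable_id)
  refine (hasDerivAt_integral_of_dominated_loc_of_deriv_le (F := fun u z => k u z * f (x - z))
    (F' := fun u z => k' u z * f (x - z))
    (bound := fun z => ‖C * (Real.exp (-c * qd z) * f (x - z))‖) (Metric.ball_mem_nhds u0 hε) ?_ ?_ ?_ ?_ ?_ ?_).2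
  · exact Eventually.of_forall fun u => ((hk u).measurable.mul hm).aestronglyMeasurable
  · exact hf.integ h0 x
  · exact (hk'.measurable.mul hm).aestronglyMeasurable
  · refine ae_of_all _ fun z u hu => ?_
    rw [norm_mul, ← mul_assoc, norm_mul]
    gcongr
    rw [Real.norm_eq_abs, Real.norm_eq_abs]
    exact (hb z u hu).trans (le_abs_self _)
  · exact ((hf.expi hc x).const_mul C).norm
  · exact ae_of_all _ fun z u hu => (hd z u hu).mul_const _

lemma cv_shift {m : ℕ} (k f : Spc m → ℝ) (x v : Spc m) :
    cv k f (x + v) = cv (fun z => k (z + v)) f x := by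
  unfold cv
  rw [← integral_add_right_eq_self _ v]
  congr 1; ext z
  rw [show x + v - (z + v) = x - z by abel]

lemma PX {m : ℕ} {k k' f : Spc m → ℝ} (hk : Dec k) (hk' : Dec k') (hf : PI f) (w x : Spc m)
    (hd : ∀ z u, HasDerivAt (fun u : ℝ => k (z + u • w)) (k' (z + u • w)) u) (u : ℝ) :
    HasDerivAt (fun u : ℝ => cv k f (x + u • w)) (cv k' f (x + u • w)) u := by
  obtain ⟨C, c, hc, hb⟩ := hk'.2
  obtain ⟨C0, c0, hc0, hb0⟩ := hk.2
  have key : ∀ (C c : ℝ) (k : Spc m → ℝ), 0 < c → (∀ z, |k z| ≤ C * Real.exp (-c * qd z)) → ∀ (z v : Spc m),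
      |k (z + v)| ≤ C * Real.exp (c * qd v) * Real.exp (-(c/2) * qd z) := by
    intro C c k hc hb z v
    have hC : 0 ≤ C := by
      have := (abs_nonneg _).trans (hb 0)
      by_contra h; push Not at h
      nlinarith [Real.exp_pos (-c * qd (0 : Spc m))]
    refine (hb (z + v)).trans ?_
    rw [mul_assoc, ← Real.exp_add]
    gcongr
    have h1 := qd_add_le (z + v) (-v)
    rw [add_neg_cancel_right, show qd (-v) = qd v by simp [qd]] at h1
    nlinarith
  simp_rw [cv_shift k f x]
  rw [cv_shift k' f x]
  refine DI hf x (ε := 1) (C := C * Real.exp (c * ((m + 1) * ((|u| + 1) * ‖w‖) ^ 2))) (c := c / 2) one_pos (by positivity)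
    (k := fun u z => k (z + u • w)) (k' := fun u z => k' (z + u • w)) ?_ ?_ ?_ (fun z u _ => hd z u) ?_
  · intro u; have := hk.1; fun_prop
  · exact ⟨by have := hk.1; fun_prop, _, c0 / 2, by positivity, fun z => key C0 c0 k hc0 hb0 z _⟩
  · have := hk'.1; fun_prop
  · intro z v hv
    refine (key C c k' hc hb z _).trans ?_
    have hC : 0 ≤ C := by
      have := (abs_nonneg _).trans (hb 0)
      by_contra h; push Not at h
      nlinarith [Real.exp_pos (-c * qd (0 : Spc m))]
    gcongr
    refine (qd_le _).trans ?_
    gcongr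
    rw [norm_smul, Real.norm_eq_abs]
    gcongr
    rw [Metric.mem_ball, Real.dist_eq] at hv
    have := abs_sub_abs_le_abs_sub v u
    linarith

lemma PA {m : ℕ} {f : Spc m → ℝ} (hf : PI f) (x : Spc m) {a : ℝ} (ha : 0 < a) :
    HasDerivAt (fun a => cv (Gk a) f x) (cv (Gt a) f x) a := by
  have hpos : ∀ u ∈ Metric.ball a (a / 2), a / 2 < u ∧ u < 2 * a := by
    intro u hu
    rw [Metric.mem_ball, Real.dist_eq, abs_lt] at hu
    constructor <;> linarith [hu.1, hu.2]
  refine DI hf x (ε := a / 2) (C := 2 ^ 15 * (m + 1) ^ 3 * (a / 2) ^ (-1 : ℝ) * (√(a / 2))⁻¹ ^ (m + 1)) (c := 1 / (16 * (2 * a)))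
    (by positivity) (by positivity) (fun u => cont_Gk u) (dec_Gk ha) (cont_Gt a) ?_ ?_
  · intro z u hu
    exact deriv_Gk_a (by linarith [hpos u hu]) z
  · intro z u hu
    obtain ⟨h1, h2⟩ := hpos u hu
    have hu0 : 0 < u := by linarith
    refine (kt hu0 z).trans ?_
    unfold Hk
    rw [mul_assoc _ ((√(a/2))⁻¹ ^ (m+1))]
    have := qd_nonneg z
    have e : u ^ (-1 : ℝ) ≤ (a / 2) ^ (-1 : ℝ) := by
      rw [Real.rpow_neg_one, Real.rpow_neg_one]; gcongr
    gcongr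

/-- integration by parts -/
lemma PB {m : ℕ} {k k' u : Spc m → ℝ} (hk : Dec k) (hk' : Dec k') (v x : Spc m)
    (hd : ∀ z u, HasDerivAt (fun u : ℝ => k (z + u • v)) (k' (z + u • v)) u)
    (hu : PI u) (hdu : Differentiable ℝ u) (hpu : PI (pd v u)) : cv k (pd v u) x = cv k' u x := by
  have h := integral_bilinear_hasLineDerivAt_right_eq_neg_left_of_integrable (μ := (volume : Measure (Spc m)))
    (f := k) (f' := k') (g := fun z => u (x - z)) (g' := fun z => - pd v u (x - z)) (v := v)
    (B := ContinuousLinearMap.mul ℝ ℝ) (by simpa using hu.integ hk' x) (by simpa using (hpu.integ hk x).neg)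
    (by simpa using hu.integ hk x) ?_ ?_
  · simp only [ContinuousLinearMap.mul_apply', mul_neg, integral_neg, neg_inj] at h
    exact h
  · intro z _
    have := hd z 0
    simpa [HasLineDerivAt] using this
  · intro z _
    have h1 : HasFDerivAt u (fderiv ℝ u (x - z)) (x - z) := (hdu _).hasFDerivAt
    have h2 : HasFDerivAt (fun z => u (x - z)) ((fderiv ℝ u (x - z)).comp (-(ContinuousLinearMap.id ℝ (Spc m)))) z :=
      h1.comp z ((hasFDerivAt_id z).const_sub x)
    have := h2.hasLineDerivAt v
    simpa [pd] using this

lemma PI.one {m : ℕ} (c : ℝ) : PI (fun _ : Spc m => c) :=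
  ⟨fun _ _ _ => rfl, measurable_const, integrable_const _⟩

lemma int_deriv_zero {m : ℕ} {k k' : Spc m → ℝ} (hk : Dec k) (hk' : Dec k') (v : Spc m)
    (hd : ∀ z u, HasDerivAt (fun u : ℝ => k (z + u • v)) (k' (z + u • v)) u) : ∫ z, k' z = 0 := by
  have e : pd v (fun _ : Spc m => (1:ℝ)) = fun _ => 0 := by ext x; simp [pd]
  have := PB hk hk' v 0 hd (PI.one 1) (by fun_prop) (by rw [e]; exact PI.one 0)
  rw [e] at this
  simpa [cv] using this.symm

lemma int_G1 {m : ℕ} {a : ℝ} (ha : 0 < a) (v : Spc m) : ∫ z, G1 a v z = 0 :=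
  int_deriv_zero (dec_Gk ha) (dec_G1 ha v) v (deriv_Gk ha v)
lemma int_G2 {m : ℕ} {a : ℝ} (ha : 0 < a) (v w : Spc m) : ∫ z, G2 a v w z = 0 :=
  int_deriv_zero (dec_G1 ha v) (dec_G2 ha v w) w (deriv_G1 ha v w)

lemma cv_sup {m : ℕ} {k f : Spc m → ℝ} {a K M : ℝ} (ha : 0 < a) (hk : ∀ z, |k z| ≤ K * Hk a z)
    (x : Spc m) (hf : ∀ z, |f z| ≤ M) : |cv k f x| ≤ K * CH m * M := by
  have := norm_integral_le_of_norm_le (f := fun z => k z * f (x - z)) (((integrable_Hk (m := m) ha).const_mul K).mul_const M)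
    (ae_of_all _ fun z => ?_)
  · rw [integral_mul_const, integral_const_mul, integral_Hk ha] at this
    exact this
  · rw [norm_mul, Real.norm_eq_abs, Real.norm_eq_abs]
    exact mul_le_mul (hk z) (hf _) (abs_nonneg _) ((abs_nonneg _).trans (hk z))

/-- weighted bound -/
lemma cv_wt {m : ℕ} {k f : Spc m → ℝ} (hk : Dec k) (hf : PI f) {a K L θ I : ℝ} (ha : 0 < a) (hI : ∫ z, k z = I)
    (hkb : ∀ z, ‖z‖ ^ θ * |k z| ≤ K * Hk a z)
    (x : Spc m) (hL : ∀ z, |f (x - z) - f x| ≤ L * ‖z‖ ^ θ) : |cv k f x - I * f x| ≤ K * CH m * L := by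
  have e : cv k f x - I * f x = ∫ z, k z * (f (x - z) - f x) := by
    simp_rw [mul_sub]
    rw [integral_sub (hf.integ hk x) (hk.int.mul_const _), integral_mul_const, hI]; rfl
  rw [e]
  have := norm_integral_le_of_norm_le (f := fun z => k z * (f (x - z) - f x)) (((integrable_Hk (m := m) ha).const_mul K).mul_const L)
    (ae_of_all _ fun z => ?_)
  · rw [integral_mul_const, integral_const_mul, integral_Hk ha] at this
    exact this
  · rw [norm_mul, Real.norm_eq_abs, Real.norm_eq_abs]
    have hL0 : 0 ≤ L := by
      have h1 := (abs_nonneg _).trans (hL (1, 0))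
      have h2 : ‖((1, 0) : Spc m)‖ = 1 := by simp [Prod.norm_def]
      rw [h2, Real.one_rpow, mul_one] at h1; exact h1
    calc |k z| * |f (x - z) - f x| ≤ |k z| * (L * ‖z‖ ^ θ) := by gcongr; exact hL z
      _ = ‖z‖ ^ θ * |k z| * L := by ring
      _ ≤ _ := mul_le_mul_of_nonneg_right (hkb z) hL0

lemma cv_sub {m : ℕ} {k f g : Spc m → ℝ} (hk : Dec k) (hf : PI f) (hg : PI g) (x : Spc m) :
    cv k (fun z => f z - g z) x = cv k f x - cv k g x := by
  unfold cv; simp_rw [mul_sub]; exact integral_sub (hf.integ hk x) (hg.integ hk x)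
lemma cv_add {m : ℕ} {k f g : Spc m → ℝ} (hk : Dec k) (hf : PI f) (hg : PI g) (x : Spc m) :
    cv k (fun z => f z + g z) x = cv k f x + cv k g x := by
  unfold cv; simp_rw [mul_add]; exact integral_add (hf.integ hk x) (hg.integ hk x)
lemma cv_smul {m : ℕ} {k f : Spc m → ℝ} (c : ℝ) (x : Spc m) :
    cv k (fun z => c * f z) x = c * cv k f x := by
  unfold cv; rw [← integral_const_mul]; congr 1; ext; ring

lemma PI.sub {m : ℕ} {f g : Spc m → ℝ} (hf : PI f) (hg : PI g) : PI (fun x => f x - g x) :=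
  ⟨fun x k j => by simp only [hf.1 x k j, hg.1 x k j], hf.2.1.sub hg.2.1, hf.2.2.sub hg.2.2⟩
lemma PI.add {m : ℕ} {f g : Spc m → ℝ} (hf : PI f) (hg : PI g) : PI (fun x => f x + g x) :=
  ⟨fun x k j => by simp only [hf.1 x k j, hg.1 x k j], hf.2.1.add hg.2.1, hf.2.2.add hg.2.2⟩
lemma PI.smul {m : ℕ} {f : Spc m → ℝ} (c : ℝ) (hf : PI f) : PI (fun x => c * f x) :=
  ⟨fun x k j => by simp only [hf.1 x k j], hf.2.1.const_mul c, hf.2.2.const_mul c⟩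
lemma PI.sum {m : ℕ} {ι : Type*} (s : Finset ι) {f : ι → Spc m → ℝ} (hf : ∀ i, PI (f i)) : PI (fun x => ∑ i ∈ s, f i x) :=
  ⟨fun x k j => by simp only [(hf _).1 x k j], Finset.measurable_sum _ fun i _ => (hf i).2.1, integrable_finsetSum _ fun i _ => (hf i).2.2⟩
lemma cv_sum {m : ℕ} {ι : Type*} (s : Finset ι) {k : Spc m → ℝ} {f : ι → Spc m → ℝ} (hk : Dec k) (hf : ∀ i, PI (f i)) (x : Spc m) :
    cv k (fun z => ∑ i ∈ s, f i z) x = ∑ i ∈ s, cv k (f i) x := by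
  unfold cv; simp_rw [Finset.mul_sum]; exact integral_finsetSum _ fun i _ => (hf i).integ hk x

/-- the `L^p` bound -/
lemma LpB (m : ℕ) {p : ℝ} (hp : 1 ≤ p) : ∃ C : ℝ, 0 < C ∧ ∀ (k f : Spc m → ℝ) (a K : ℝ) (x : Spc m),
    Per f → Measurable f → 0 < a → a ≤ 1 → (∀ z, |k z| ≤ K * Hk a z) →
    ENNReal.ofReal |cv k f x| ≤ ENNReal.ofReal (K * C * a ^ (-((m + 1) / (2 * p)))) * LpN p f := by
  obtain ⟨C, hC, h⟩ := L1P (m := m) (c := 1 / 16) (by norm_num)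
  refine ⟨C ^ (1 / p) * (CH m) ^ (1 - 1 / p), by have := CH_pos m; positivity, ?_⟩
  intro k f a K x hf hfm ha ha1 hk
  have hK : 0 ≤ K := by
    have h1 := (abs_nonneg _).trans (hk 0)
    have h2 : 0 < Hk a (0 : Spc m) := by unfold Hk; positivity
    by_contra hh; push Not at hh; nlinarith
  have hp0 : 0 < p := by linarith
  set g : Spc m → ℝ := fun z => f (x - z) with hg
  have hgm : Measurable g := hfm.comp (measurable_const.sub measurable_id)
  have hHm : Measurable (fun z : Spc m => ENNReal.ofReal (Hk a z)) := (cont_Hk a).measurable.ennreal_ofReal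
  set ν : Measure (Spc m) := volume.withDensity (fun z => ENNReal.ofReal (Hk a z)) with hν
  have hνu : ν univ = ENNReal.ofReal (CH m) := by
    rw [hν, withDensity_apply _ MeasurableSet.univ, Measure.restrict_univ, ← ofReal_integral_eq_lintegral_ofReal (integrable_Hk ha)
      (ae_of_all _ fun z => Hk_nonneg a z), integral_Hk ha]
  have h1 : ENNReal.ofReal |cv k f x| ≤ ENNReal.ofReal K * eLpNorm g 1 ν := by
    rw [eLpNorm_one_eq_lintegral_enorm, hν, lintegral_withDensity_eq_lintegral_mul _ hHm hgm.enorm]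
    rw [← Real.enorm_eq_ofReal_abs]
    refine (enorm_integral_le_lintegral_enorm _).trans ?_
    rw [← lintegral_const_mul _ (hHm.mul hgm.enorm)]
    refine lintegral_mono fun z => ?_
    simp only [Pi.mul_apply]
    rw [enorm_mul, ← mul_assoc, ← ENNReal.ofReal_mul hK]
    gcongr
    rw [Real.enorm_eq_ofReal_abs]
    exact ENNReal.ofReal_le_ofReal (hk z)
  have h2 : eLpNorm g 1 ν ≤ eLpNorm g (ENNReal.ofReal p) ν * ν univ ^ (1 - 1 / p) := by
    have := eLpNorm_le_eLpNorm_mul_rpow_measure_univ (μ := ν) (p := 1) (q := ENNReal.ofReal p) (f := g)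
      (by simpa using ENNReal.ofReal_le_ofReal hp) hgm.aestronglyMeasurable
    simpa [ENNReal.toReal_ofReal hp0.le] using this
  have h3 : eLpNorm g (ENNReal.ofReal p) ν ≤ ENNReal.ofReal (C ^ (1 / p) * a ^ (-((m + 1) / (2 * p)))) * LpN p f := by
    have hpn : ENNReal.ofReal p ≠ 0 := by simpa using hp0
    rw [LpN, eLpNorm_eq_lintegral_rpow_enorm_toReal hpn ENNReal.ofReal_ne_top,
      eLpNorm_eq_lintegral_rpow_enorm_toReal hpn ENNReal.ofReal_ne_top, ENNReal.toReal_ofReal hp0.le]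
    have e : ENNReal.ofReal (C ^ (1 / p) * a ^ (-(((m:ℝ) + 1) / (2 * p)))) = ENNReal.ofReal (C * (√a)⁻¹ ^ (m + 1)) ^ (1 / p) := by
      rw [ENNReal.ofReal_rpow_of_nonneg (by positivity) (by positivity), Real.mul_rpow hC.le (by positivity)]
      congr 2
      rw [Real.sqrt_eq_rpow, ← Real.rpow_neg ha.le, ← Real.rpow_natCast, ← Real.rpow_mul ha.le, ← Real.rpow_mul ha.le]
      congr 1; push_cast; field_simp
    rw [e, ← ENNReal.mul_rpow_of_nonneg _ _ (by positivity)]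
    gcongr
    rw [hν, lintegral_withDensity_eq_lintegral_mul _ hHm (hgm.enorm.pow_const p)]
    have h4 := h (fun z => ‖f z‖ₑ ^ p) (hfm.enorm.pow_const p) (fun y k j => by simp only [hf y k j]) x
    simp only [Pi.mul_apply]
    calc ∫⁻ z, ENNReal.ofReal (Hk a z) * ‖g z‖ₑ ^ p
        ≤ ∫⁻ z, ENNReal.ofReal ((√a)⁻¹ ^ (m + 1)) * (ENNReal.ofReal (Real.exp (-(1 / 16) * qd z)) * ‖f (x - z)‖ₑ ^ p) := by
          refine lintegral_mono fun z => ?_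
          rw [← mul_assoc, ← ENNReal.ofReal_mul (by positivity)]
          refine mul_le_mul' (ENNReal.ofReal_le_ofReal ?_) le_rfl
          unfold Hk
          have := qd_nonneg z
          gcongr
          linarith
      _ = ENNReal.ofReal ((√a)⁻¹ ^ (m + 1)) * ∫⁻ z, (ENNReal.ofReal (Real.exp (-(1 / 16) * qd z)) * ‖f (x - z)‖ₑ ^ p) := by
          rw [lintegral_const_mul' _ _ ENNReal.ofReal_ne_top]
      _ ≤ ENNReal.ofReal ((√a)⁻¹ ^ (m + 1)) * (ENNReal.ofReal C * ∫⁻ u in cube m, ‖f u‖ₑ ^ p) := by gcongr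
      _ = _ := by rw [← mul_assoc, ← ENNReal.ofReal_mul (by positivity), mul_comm C]; rfl
  have hCH := CH_pos m
  calc ENNReal.ofReal |cv k f x| ≤ ENNReal.ofReal K * (eLpNorm g (ENNReal.ofReal p) ν * ν univ ^ (1 - 1 / p)) := h1.trans (by gcongr)
    _ ≤ ENNReal.ofReal K * ((ENNReal.ofReal (C ^ (1 / p) * a ^ (-((m + 1) / (2 * p)))) * LpN p f) * ENNReal.ofReal ((CH m) ^ (1 - 1 / p))) := by
        gcongr
        rw [hνu, ENNReal.ofReal_rpow_of_pos hCH]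
    _ = _ := by
        rw [show K * (C ^ (1 / p) * CH m ^ (1 - 1 / p)) * a ^ (-(((m:ℝ) + 1) / (2 * p))) = K * ((C ^ (1 / p) * a ^ (-(((m:ℝ) + 1) / (2 * p)))) * (CH m) ^ (1 - 1 / p)) by ring,
          ENNReal.ofReal_mul hK, ENNReal.ofReal_mul (p := C ^ (1 / p) * a ^ (-(((m:ℝ) + 1) / (2 * p)))) (by positivity)]
        generalize ENNReal.ofReal (C ^ (1 / p) * a ^ (-(((m:ℝ) + 1) / (2 * p)))) = X
        ring

structure Sol {m : ℕ} (β p : ℝ) (T : ℝ≥0∞) (u R : ℝ → Spc m → ℝ) (g : ℝ → Option (Fin m) → Spc m → ℝ) : Prop where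
  pi : ∀ t ∈ Ico0 T, PI (u t)
  cont : ∀ t ∈ Ico0 T, ∀ ε : ℝ, 0 < ε → ∃ δ > 0, ∀ t' ∈ Ico0 T, |t' - t| < δ →
    LpN p (fun x => u t' x - u t x) < ENNReal.ofReal ε
  piR : ∀ t ∈ Ioo0 T, PI (R t)
  lpR : ∀ t ∈ Ioo0 T, LpN p (R t) < ⊤
  eqn : ∀ t ∈ Ioo0 T, Tendsto (fun h : ℝ => LpN p (fun x => (u (t + h) x - u t x) / h - R t x))
      (nhdsWithin 0 {h : ℝ | h ≠ 0}) (nhds 0)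
  weak : ∀ t ∈ Ioo0 T, ∀ a : ℝ, 0 < a → ∀ x, cv (Gk a) (R t) x = β⁻¹ * cv (Gt a) (u t) x +
    ∑ o, cv (G1 a (ed o)) (g t o) x
  lip : ∀ t ∈ Ioo0 T, ∃ L : ℝ, 0 ≤ L ∧ ∀ x y, |u t x - u t y| ≤ L * ‖x - y‖

lemma isOpen_Ioo0 (T : ℝ≥0∞) : IsOpen (Ioo0 T) := by
  have : Ioo0 T = Set.Ioi 0 ∩ (fun t : ℝ => ENNReal.ofReal t) ⁻¹' Set.Iio T := rfl
  rw [this]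
  exact isOpen_Ioi.inter (isOpen_Iio.preimage ENNReal.continuous_ofReal)

lemma io_sub {T : ℝ≥0∞} {t : ℝ} (h : t ∈ Ioo0 T) : t ∈ Ico0 T := ⟨h.1.le, h.2⟩
lemma ic_mid {T : ℝ≥0∞} {r t : ℝ} (ht : t ∈ Ico0 T) (h0 : 0 ≤ r) (h : r ≤ t) : r ∈ Ico0 T :=
  ⟨h0, (ENNReal.ofReal_le_ofReal h).trans_lt ht.2⟩
lemma ic_mid' {T : ℝ≥0∞} {r t : ℝ} (ht : t ∈ Ico0 T) (h0 : 0 < r) (h : r ≤ t) : r ∈ Ioo0 T :=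
  ⟨h0, (ENNReal.ofReal_le_ofReal h).trans_lt ht.2⟩

lemma LpBr (m : ℕ) {p : ℝ} (hp : 1 ≤ p) : ∃ C : ℝ, 0 < C ∧ ∀ (k f : Spc m → ℝ) (a K q : ℝ) (x : Spc m),
    Per f → Measurable f → 0 < a → a ≤ 1 → 0 ≤ K → (∀ z, |k z| ≤ K * Hk a z) → LpN p f ≤ ENNReal.ofReal q → 0 ≤ q →
    |cv k f x| ≤ K * C * a ^ (-(((m:ℝ) + 1) / (2 * p))) * q := by
  obtain ⟨C, hC, h⟩ := LpB m hp
  refine ⟨C, hC, fun k f a K q x h1 h2 h3 h4 hK h5 h6 hq => ?_⟩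
  have := (h k f a K x h1 h2 h3 h4 h5).trans (mul_le_mul' le_rfl h6)
  rw [← ENNReal.ofReal_mul (by positivity)] at this
  exact (ENNReal.ofReal_le_ofReal_iff (by positivity)).1 this

lemma LpN_smul {m : ℕ} (p c : ℝ) (f : Spc m → ℝ) : LpN p (fun x => c * f x) = ENNReal.ofReal |c| * LpN p f := by
  unfold LpN
  rw [← Real.enorm_eq_ofReal_abs, ← eLpNorm_const_smul c f (ENNReal.ofReal p) (μT m)]; rfl

section
variable {m : ℕ} {β p : ℝ} {T : ℝ≥0∞} {u R : ℝ → Spc m → ℝ} {g : ℝ → Option (Fin m) → Spc m → ℝ}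

lemma Sol.derivA (S : Sol β p T u R g) (hβ : 0 < β) (hp : 1 ≤ p) {r t : ℝ} (hr : r ∈ Ioo0 T) (hrt : r < t)
    (hb : t - r < β) (y : Spc m) :
    HasDerivAt (fun r => cv (Gk ((t - r) / β)) (u r) y) (∑ o, cv (G1 ((t - r) / β) (ed o)) (g r o) y) r := by
  set a := (t - r) / β with ha
  have ha0 : 0 < a := div_pos (by linarith) hβ
  have hamap : HasDerivAt (fun r' => (t - r') / β) (-β⁻¹) r := by
    have := ((hasDerivAt_id r).const_sub t).div_const β
    refine this.congr_deriv ?_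
    field_simp
  have hPA : ∀ f, PI f → HasDerivAt (fun r' => cv (Gk ((t - r') / β)) f y) (cv (Gt a) f y * (-β⁻¹)) r := by
    intro f hf
    exact HasDerivAt.comp r (h₂ := fun a => cv (Gk a) f y) (PA hf y ha0) hamap
  have hu := S.pi r (io_sub hr)
  have hR := S.piR r hr
  have hF2 : HasDerivAt (fun r' => cv (Gk ((t - r') / β)) (u r) y + (r' - r) * cv (Gk ((t - r') / β)) (R r) y)
      (∑ o, cv (G1 a (ed o)) (g r o) y) r := by
    have := (hPA _ hu).add (((hasDerivAt_id r).sub_const r).mul (hPA _ hR))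
    refine this.congr_deriv ?_
    have hw := S.weak r hr a ha0 y
    simp only [id, sub_self, zero_mul, one_mul, add_zero]
    rw [← ha, hw]; ring
  have hF1 : HasDerivAt (fun r' => cv (Gk ((t - r') / β)) (fun x => u r' x - u r x - (r' - r) * R r x) y) 0 r := by
    rw [hasDerivAt_iff_tendsto_slope_zero]
    obtain ⟨C, hC, hLp⟩ := LpB m hp
    have hz : cv (Gk ((t - r) / β)) (fun x => u r x - u r x - (r - r) * R r x) y = 0 := by simp [cv]
    rw [hz]
    have hlim : Tendsto (fun h => ENNReal.ofReal (2 ^ 15 * C * (a / 2) ^ (-(((m:ℝ) + 1) / (2 * p)))) *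
        LpN p (fun x => (u (r + h) x - u r x) / h - R r x)) (nhdsWithin 0 {h : ℝ | h ≠ 0}) (nhds 0) := by
      have := ENNReal.Tendsto.const_mul (S.eqn r hr) (a := ENNReal.ofReal (2 ^ 15 * C * (a / 2) ^ (-(((m:ℝ) + 1) / (2 * p))))) (Or.inr ENNReal.ofReal_ne_top)
      simpa using this
    have hev : ∀ᶠ h in nhdsWithin (0:ℝ) {h : ℝ | h ≠ 0}, r + h ∈ Ioo0 T ∧ a / 2 < (t - (r + h)) / β ∧ (t - (r + h)) / β < 1 ∧ h ≠ 0 := by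
      have c1 : Tendsto (fun h : ℝ => r + h) (nhdsWithin (0:ℝ) {h : ℝ | h ≠ 0}) (nhds r) := by
        have : Tendsto (fun h : ℝ => r + h) (nhds 0) (nhds (r + 0)) := (continuous_const.add continuous_id).tendsto 0
        rw [add_zero] at this
        exact this.mono_left nhdsWithin_le_nhds
      have c2 : Tendsto (fun h : ℝ => (t - (r + h)) / β) (nhdsWithin (0:ℝ) {h : ℝ | h ≠ 0}) (nhds a) := by
        exact (hamap.continuousAt.tendsto).comp c1
      filter_upwards [c1.eventually ((isOpen_Ioo0 T).mem_nhds hr), c2.eventually (lt_mem_nhds (half_lt_self ha0)),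
        c2.eventually (gt_mem_nhds (show a < 1 by rw [ha, div_lt_one hβ]; exact hb)), self_mem_nhdsWithin] with h h1 h2 h3 h4
      exact ⟨h1, h2, h3, h4⟩
    have hsq : Tendsto (fun h : ℝ => ENNReal.ofReal |h⁻¹ • (cv (Gk ((t - (r + h)) / β)) (fun x => u (r + h) x - u r x - (r + h - r) * R r x) y - 0)|)
        (nhdsWithin 0 {h : ℝ | h ≠ 0}) (nhds 0) := by
      refine tendsto_of_tendsto_of_tendsto_of_le_of_le' tendsto_const_nhds hlim (Eventually.of_forall fun _ => zero_le) ?_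
      filter_upwards [hev] with h ⟨h1, h2, h3, h4⟩
      have e : h⁻¹ • (cv (Gk ((t - (r + h)) / β)) (fun x => u (r + h) x - u r x - (r + h - r) * R r x) y - 0)
          = cv (Gk ((t - (r + h)) / β)) (fun x => (u (r + h) x - u r x) / h - R r x) y := by
        rw [sub_zero, smul_eq_mul, ← cv_smul]
        congr 1; ext x; field_simp; ring
      rw [e]
      have hpi1 := (S.pi _ (io_sub h1))
      have hpos : 0 < (t - (r + h)) / β := by linarith
      refine (hLp _ _ _ (2^15) y ?_ ?_ hpos h3.le (k0' hpos)).trans ?_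
      · intro x k j; simp only [hpi1.1 x k j, hu.1 x k j, hR.1 x k j]
      · exact ((hpi1.2.1.sub hu.2.1).div_const _).sub hR.2.1
      · refine mul_le_mul' (ENNReal.ofReal_le_ofReal ?_) le_rfl
        refine mul_le_mul_of_nonneg_left ?_ (by positivity)
        exact Real.rpow_le_rpow_of_nonpos (by positivity) h2.le (by rw [neg_nonpos]; positivity)
    have h0 := (ENNReal.tendsto_toReal ENNReal.zero_ne_top).comp hsq
    simp only [Function.comp_def, ENNReal.toReal_ofReal (abs_nonneg _), ENNReal.toReal_zero] at h0
    exact (tendsto_zero_iff_abs_tendsto_zero _).2 h0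
  have := hF1.add hF2
  rw [zero_add] at this
  refine this.congr_of_eventuallyEq ?_
  filter_upwards [(isOpen_Ioo0 T).mem_nhds hr, gt_mem_nhds hrt] with r' h1 h2
  have hd := dec_Gk (m := m) (a := (t - r') / β) (div_pos (by linarith) hβ)
  have hu' := S.pi r' (io_sub h1)
  simp only [Pi.add_apply]
  rw [cv_sub hd (hu'.sub hu) (hR.smul _), cv_sub hd hu' hu, cv_smul]
  ring

lemma Sol.contA (S : Sol β p T u R g) (hβ : 0 < β) (hp : 1 ≤ p) (hpm : (m : ℝ) + 1 < 2 * p) {s t : ℝ} (hs : s ∈ Ico0 T) (ht : t ∈ Ico0 T)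
    (hst : s < t) (hb : t - s ≤ β) (y : Spc m) :
    ContinuousOn (fun r => if r < t then cv (Gk ((t - r) / β)) (u r) y else u t y) (Icc s t) := by
  obtain ⟨C, hC, hLp⟩ := LpBr m hp
  have ht' : t ∈ Ioo0 T := ⟨hs.1.trans_lt hst, ht.2⟩
  have hpi : ∀ r ∈ Icc s t, PI (u r) := fun r hr => S.pi r (ic_mid ht (hs.1.trans hr.1) hr.2)
  intro r hr
  rcases lt_or_eq_of_le hr.2 with hrt | rfl
  · have hrI : r ∈ Ico0 T := ic_mid ht (hs.1.trans hr.1) hr.2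
    set a := (t - r) / β with ha
    have ha0 : 0 < a := div_pos (by linarith) hβ
    have hamap : ContinuousAt (fun r' => (t - r') / β) r := by fun_prop
    have h2 : Tendsto (fun r' => cv (Gk ((t - r') / β)) (u r) y) (nhdsWithin r (Icc s t)) (nhds (cv (Gk a) (u r) y)) :=
      (ContinuousAt.comp (f := fun r' => (t - r') / β) (g := fun a => cv (Gk a) (u r) y) (PA (hpi r hr) y ha0).continuousAt hamap).tendsto.mono_left nhdsWithin_le_nhds
    have h1 : Tendsto (fun r' => cv (Gk ((t - r') / β)) (fun x => u r' x - u r x) y) (nhdsWithin r (Icc s t)) (nhds 0) := by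
      rw [Metric.tendsto_nhds]
      intro ε hε
      set K := 2 ^ 15 * C * (a / 2) ^ (-(((m:ℝ) + 1) / (2 * p))) with hK
      have hK0 : 0 < K := by positivity
      obtain ⟨δ, hδ, hc⟩ := S.cont r hrI (ε / (2 * K)) (by positivity)
      have e1 : ∀ᶠ r' in nhdsWithin r (Icc s t), |r' - r| < δ :=
        nhdsWithin_le_nhds (Metric.ball_mem_nhds r hδ)
      have e2 : ∀ᶠ r' in nhdsWithin r (Icc s t), a / 2 < (t - r') / β :=
        nhdsWithin_le_nhds (hamap.tendsto.eventually (lt_mem_nhds (half_lt_self ha0)))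
      filter_upwards [e1, e2, self_mem_nhdsWithin] with r' h1 h2 h3
      have hpos : 0 < (t - r') / β := by linarith
      have hle : (t - r') / β ≤ 1 := by rw [div_le_one hβ]; linarith [h3.1]
      have h4 := hLp _ _ _ (2^15) (ε / (2 * K)) y ((hpi r' h3).sub (hpi r hr)).1 ((hpi r' h3).sub (hpi r hr)).2.1 hpos hle (by norm_num)
        (k0' hpos) (hc r' (ic_mid ht (hs.1.trans h3.1) h3.2) h1).le (by positivity)
      rw [Real.dist_eq, sub_zero]
      have h5 : ((t - r') / β) ^ (-(((m:ℝ) + 1) / (2 * p))) ≤ (a / 2) ^ (-(((m:ℝ) + 1) / (2 * p))) :=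
        Real.rpow_le_rpow_of_nonpos (by positivity) h2.le (by rw [neg_nonpos]; positivity)
      calc _ ≤ _ := h4
        _ ≤ K * (ε / (2 * K)) := by rw [hK]; gcongr
        _ < ε := by field_simp; linarith
    have h3 := h1.add h2
    rw [zero_add] at h3
    unfold ContinuousWithinAt
    simp only [hrt, if_true]
    refine h3.congr' ?_
    have e3 : ∀ᶠ r' in nhdsWithin r (Icc s t), r' < t := nhdsWithin_le_nhds (gt_mem_nhds hrt)
    filter_upwards [e3, self_mem_nhdsWithin] with r' h4 h5
    rw [if_pos h4, cv_sub (dec_Gk (div_pos (by linarith) hβ)) (hpi r' h5) (hpi r hr)]; ring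
  · obtain ⟨L, hL0, hL⟩ := S.lip r ht'
    have hut := hpi r hr
    set Q := 1 + (LpN p (R r)).toReal with hQ
    have hQ0 : 0 ≤ Q := by positivity
    set e := -(((m:ℝ) + 1) / (2 * p)) with he
    have he1 : 0 < 1 + e := by
      rw [he]
      have : ((m:ℝ) + 1) / (2 * p) < 1 := by rw [div_lt_one (by linarith)]; exact hpm
      linarith
    have hquot : ∀ᶠ r' in nhdsWithin r {r' | r' ≠ r}, LpN p (fun x => u r' x - u r x) ≤ ENNReal.ofReal (|r' - r| * Q) := by
      have hmap : Tendsto (fun r' : ℝ => r' - r) (nhdsWithin r {r' | r' ≠ r}) (nhdsWithin 0 {h : ℝ | h ≠ 0}) := by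
        refine tendsto_nhdsWithin_iff.2 ⟨?_, ?_⟩
        · have : Tendsto (fun r' : ℝ => r' - r) (nhds r) (nhds (r - r)) := (continuous_id.sub continuous_const).tendsto r
          rw [sub_self] at this
          exact this.mono_left nhdsWithin_le_nhds
        · filter_upwards [self_mem_nhdsWithin] with r' h
          exact sub_ne_zero.2 h
      have h0 : r ∈ {x : ℝ | x ∈ Ioo0 T} := ht'
      have hin : ∀ᶠ r' in nhdsWithin r {r' | r' ≠ r}, r' ∈ Ioo0 T := nhdsWithin_le_nhds ((isOpen_Ioo0 T).mem_nhds ht')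
      filter_upwards [hmap.eventually ((S.eqn r ht').eventually (gt_mem_nhds (show (0:ℝ≥0∞) < 1 from one_pos))), self_mem_nhdsWithin, hin] with r' h1 h2 hi
      have hne : r' - r ≠ 0 := sub_ne_zero.2 h2
      rw [add_sub_cancel] at h1
      have hpi' := S.pi r' (io_sub hi)
      have hRr := S.piR r ht'
      have e1 : (fun x => u r' x - u r x) = fun x => (r' - r) * (((u r' x - u r x) / (r' - r) - R r x) + R r x) := by
        ext x; field_simp; ring
      rw [e1, LpN_smul, ENNReal.ofReal_mul (abs_nonneg _)]
      gcongr
      refine (eLpNorm_add_le (((hpi'.2.1.sub hut.2.1).div_const _).sub hRr.2.1).aestronglyMeasurable hRr.2.1.aestronglyMeasurable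
        (by simpa using ENNReal.ofReal_le_ofReal hp)).trans ?_
      rw [hQ, ENNReal.ofReal_add zero_le_one ENNReal.toReal_nonneg, ENNReal.ofReal_toReal (S.lpR r ht').ne]
      refine add_le_add ?_ le_rfl
      rw [ENNReal.ofReal_one]; exact h1.le
    unfold ContinuousWithinAt
    simp only [lt_irrefl, if_false]
    rw [tendsto_iff_dist_tendsto_zero]
    have hbound : ∀ᶠ r' in nhdsWithin r (Icc s r),
        dist (if r' < r then cv (Gk ((r - r') / β)) (u r') y else u r y) (u r y)
         ≤ 2 ^ 15 * C * (β ^ (-e) * |r' - r| ^ (1 + e)) * Q + 2 ^ 15 * (|r' - r| / β) ^ (1 / 2 : ℝ) * CH m * L := by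
      have hCH := CH_pos m
      have := eventually_nhdsWithin_iff.1 hquot
      filter_upwards [nhdsWithin_le_nhds this, self_mem_nhdsWithin] with r' h1 h2
      split_ifs with hlt
      · have hpos : 0 < (r - r') / β := div_pos (by linarith) hβ
        have hle : (r - r') / β ≤ 1 := by rw [div_le_one hβ]; linarith [h2.1]
        have hab : |r' - r| = r - r' := by rw [abs_sub_comm, abs_of_pos]; linarith
        have hu' := hpi r' h2
        have b1 := hLp _ _ _ (2^15) _ y (hu'.sub hut).1 (hu'.sub hut).2.1 hpos hle (by norm_num) (k0' hpos) (h1 hlt.ne) (by positivity)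
        have b2 := cv_wt (dec_Gk hpos) hut (L := L) hpos (integral_Gk hpos) (k0 hpos zero_le_one le_rfl) y
          (fun z => by rw [Real.rpow_one]; refine (hL _ _).trans (le_of_eq ?_); congr 1; rw [sub_sub_cancel_left, norm_neg])
        rw [cv_sub (dec_Gk hpos) hu' hut] at b1
        rw [Real.dist_eq]
        rw [one_mul] at b2
        have e2 : ∀ e : ℝ, ((r - r') / β) ^ e * |r' - r| = β ^ (-e) * |r' - r| ^ (1 + e) := by
          intro e
          rw [hab, Real.div_rpow (by linarith) hβ.le, Real.rpow_add (by linarith), Real.rpow_one, Real.rpow_neg hβ.le]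
          field_simp
        calc _ ≤ |cv (Gk ((r - r') / β)) (u r') y - cv (Gk ((r - r') / β)) (u r) y| + |cv (Gk ((r - r') / β)) (u r) y - u r y| := abs_sub_le _ _ _
          _ ≤ _ := by
            refine add_le_add (b1.trans (le_of_eq ?_)) (b2.trans (le_of_eq ?_))
            · rw [← e2 e]; ring
            · rw [hab]
      · rw [dist_self]; positivity
    refine squeeze_zero' (Eventually.of_forall fun _ => dist_nonneg) hbound ?_
    have hc : ContinuousAt (fun r' => 2 ^ 15 * C * (β ^ (-e) * |r' - r| ^ (1 + e)) * Q + 2 ^ 15 * (|r' - r| / β) ^ (1 / 2 : ℝ) * CH m * L) r := by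
      have a1 : ContinuousAt (fun r' : ℝ => |r' - r| ^ (1 + e)) r := ContinuousAt.rpow_const (by fun_prop) (Or.inr he1.le)
      have a2 : ContinuousAt (fun r' : ℝ => (|r' - r| / β) ^ (1 / 2 : ℝ)) r := ContinuousAt.rpow_const (by fun_prop) (Or.inr (by norm_num))
      fun_prop
    have := hc.tendsto
    simp only [sub_self, abs_zero, zero_div] at this
    rw [Real.zero_rpow he1.ne', Real.zero_rpow (by norm_num)] at this
    simp only [mul_zero, zero_mul, add_zero] at this
    exact this.mono_left nhdsWithin_le_nhds

lemma Sol.duh (S : Sol β p T u R g) (hβ : 0 < β) (hp : 1 ≤ p) (hpm : (m : ℝ) + 1 < 2 * p) {s t : ℝ} (hs : s ∈ Ico0 T) (ht : t ∈ Ico0 T)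
    (hst : s < t) (hb : t - s ≤ β) {ι : Type*} [Fintype ι] (c : ι → ℝ) (y : ι → Spc m) {K γ : ℝ} (hγ : 0 < γ)
    (hK : ∀ r ∈ Ioo s t, |∑ i, c i * ∑ o, cv (G1 ((t - r) / β) (ed o)) (g r o) (y i)| ≤ K * (t - r) ^ (γ - 1)) :
    |∑ i, c i * u t (y i) - ∑ i, c i * cv (Gk ((t - s) / β)) (u s) (y i)| ≤ K * (t - s) ^ γ / γ := by
  set D : ℝ → ℝ := fun r => ∑ i, c i * (if r < t then cv (Gk ((t - r) / β)) (u r) (y i) else u t (y i)) with hD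
  have hDc : ContinuousOn D (Icc s t) := by
    refine continuousOn_finsetSum _ fun i _ => ?_
    exact continuousOn_const.mul (S.contA hβ hp hpm hs ht hst hb (y i))
  have hDd : ∀ r ∈ Ioo s t, HasDerivAt D (∑ i, c i * ∑ o, cv (G1 ((t - r) / β) (ed o)) (g r o) (y i)) r := by
    intro r hr
    refine HasDerivAt.fun_sum fun i _ => ?_
    refine HasDerivAt.const_mul _ ?_
    refine (S.derivA hβ hp (r := r) (t := t) (ic_mid' ht (hs.1.trans_lt hr.1) hr.2.le) hr.2 (by linarith [hr.1]) (y i)).congr_of_eventuallyEq ?_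
    filter_upwards [gt_mem_nhds hr.2] with r' h
    rw [if_pos h]
  set B : ℝ → ℝ := fun r => -(K * (t - r) ^ γ / γ) with hB
  have hBc : ContinuousOn B (Icc s t) := by
    refine ContinuousOn.neg (ContinuousOn.div_const (continuousOn_const.mul ?_) _)
    exact ContinuousOn.rpow_const (by fun_prop) fun x _ => Or.inr hγ.le
  have hBd : ∀ r ∈ Ioo s t, HasDerivAt B (K * (t - r) ^ (γ - 1)) r := by
    intro r hr
    have h1 : HasDerivAt (fun r => t - r) (-1) r := by simpa using (hasDerivAt_id r).const_sub t
    have := (((h1.rpow_const (p := γ) (Or.inl (by linarith [hr.2]))).const_mul K).div_const γ).neg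
    refine this.congr_deriv ?_
    field_simp
  have hmono : ∀ E : ℝ → ℝ, ContinuousOn E (Icc s t) → (∀ r ∈ Ioo s t, ∃ d, HasDerivAt E d r ∧ 0 ≤ d) → E s ≤ E t := by
    intro E h1 h2
    have : MonotoneOn E (Icc s t) := by
      refine monotoneOn_of_deriv_nonneg (convex_Icc s t) h1 ?_ ?_
      · rw [interior_Icc]; intro r hr
        obtain ⟨d, hd, _⟩ := h2 r hr
        exact hd.differentiableAt.differentiableWithinAt
      · rw [interior_Icc]; intro r hr
        obtain ⟨d, hd, h0⟩ := h2 r hr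
        rw [hd.deriv]; exact h0
    exact this (left_mem_Icc.2 hst.le) (right_mem_Icc.2 hst.le) hst.le
  have m1 := hmono (fun r => B r - D r) (hBc.sub hDc) fun r hr => ⟨_, (hBd r hr).sub (hDd r hr), by linarith [(abs_le.1 (hK r hr)).2]⟩
  have m2 := hmono (fun r => B r + D r) (hBc.add hDc) fun r hr => ⟨_, (hBd r hr).add (hDd r hr), by linarith [(abs_le.1 (hK r hr)).1]⟩
  simp only [hB, hD, hst, if_true, lt_irrefl, if_false, sub_self, Real.zero_rpow hγ.ne', mul_zero, zero_div, neg_zero] at m1 m2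
  rw [abs_le]
  constructor <;> linarith
end

lemma Per.per_add {m : ℕ} {Y : Type*} {f : Spc m → Y} (hf : Per f) (k : ℤ) (j : Fin m → ℤ) (x : Spc m) :
    f (x + ((k:ℝ), fun i => (j i : ℝ))) = f x := hf x k j

lemma Per.comp' {m : ℕ} {Y Z : Type*} {f : Spc m → Y} (hf : Per f) (G : Y → Z) : Per (fun x => G (f x)) :=
  fun x k j => by simp only [hf x k j]

lemma Per.fderiv {m : ℕ} {f : Spc m → ℝ} (hf : Per f) : Per (fderiv ℝ f) := fun x k j => by
  have h : (fun y => f (y + ((k:ℝ), fun i => (j i : ℝ)))) = f := funext fun y => hf y k j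
  have := fderiv_comp_add_right (𝕜 := ℝ) (f := f) (x := x) ((k:ℝ), fun i => (j i : ℝ))
  rw [h] at this
  exact this.symm

lemma Per.pd {m : ℕ} {f : Spc m → ℝ} (hf : Per f) (v : Spc m) : Per (pd v f) :=
  hf.fderiv.comp' (fun L => L v)

/-- reduction to the closed cube -/
lemma Per.red {m : ℕ} {Y : Type*} {f : Spc m → Y} (hf : Per f) (x : Spc m) : ∃ y ∈ cube m, f y = f x := by
  refine ⟨(Int.fract x.1, fun i => Int.fract (x.2 i)), ?_, ?_⟩
  · exact ⟨⟨Int.fract_nonneg _, Int.fract_lt_one _⟩, fun i _ => ⟨Int.fract_nonneg _, Int.fract_lt_one _⟩⟩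
  · have := hf (Int.fract x.1, fun i => Int.fract (x.2 i)) ⌊x.1⌋ (fun i => ⌊x.2 i⌋)
    simp only [Int.fract_add_floor] at this
    exact this.symm

def ccube (m : ℕ) : Set (Spc m) := Icc (0 : Spc m) ((1:ℝ), fun _ => (1:ℝ))

lemma cube_sub_ccube (m : ℕ) : cube m ⊆ ccube m := by
  intro x hx
  exact ⟨⟨hx.1.1, fun i => (hx.2 i trivial).1⟩, ⟨hx.1.2.le, fun i => (hx.2 i trivial).2.le⟩⟩

lemma per_bdd {m : ℕ} {f : Spc m → ℝ} (hf : Per f) (hc : Continuous f) : ∃ M : ℝ, 0 ≤ M ∧ ∀ x, |f x| ≤ M := by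
  obtain ⟨M, hM⟩ := (isCompact_Icc (a := (0 : Spc m)) (b := ((1:ℝ), fun _ => (1:ℝ)))).exists_bound_of_continuousOn hc.continuousOn
  have h : ∀ x, |f x| ≤ M := fun x => by
    obtain ⟨y, hy, e⟩ := hf.red x
    rw [← e]; exact hM y (cube_sub_ccube m hy)
  exact ⟨M, (abs_nonneg _).trans (h 0), h⟩

lemma PI.ofCont {m : ℕ} {f : Spc m → ℝ} (hf : Per f) (hc : Continuous f) : PI f := by
  obtain ⟨M, h0, hM⟩ := per_bdd hf hc
  exact ⟨hf, hc.measurable, (integrable_const M).mono' hc.aestronglyMeasurable (ae_of_all _ hM)⟩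

lemma LpN_cont {m : ℕ} {f : Spc m → ℝ} (p : ℝ) (hf : Per f) (hc : Continuous f) : LpN p f < ⊤ := by
  obtain ⟨M, h0, hM⟩ := per_bdd hf hc
  exact (MemLp.of_bound hc.aestronglyMeasurable M (ae_of_all _ hM)).2

def CP1 {m : ℕ} (f : Spc m → ℝ) : Prop := Per f ∧ ContDiff ℝ 1 f

lemma CP1.diff {m : ℕ} {f : Spc m → ℝ} (h : CP1 f) : Differentiable ℝ f := h.2.differentiable one_ne_zero
lemma CP1.cont {m : ℕ} {f : Spc m → ℝ} (h : CP1 f) : Continuous f := h.2.continuous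
lemma CP1.cpd {m : ℕ} {f : Spc m → ℝ} (h : CP1 f) (v : Spc m) : Continuous (pd v f) :=
  (h.2.continuous_fderiv one_ne_zero).clm_apply continuous_const
lemma CP1.pi {m : ℕ} {f : Spc m → ℝ} (h : CP1 f) : PI f := PI.ofCont h.1 h.cont
lemma CP1.pipd {m : ℕ} {f : Spc m → ℝ} (h : CP1 f) (v : Spc m) : PI (pd v f) := PI.ofCont (h.1.pd v) (h.cpd v)
lemma CP1.mul {m : ℕ} {f g : Spc m → ℝ} (hf : CP1 f) (hg : CP1 g) : CP1 (fun x => f x * g x) :=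
  ⟨fun x k j => by simp only [hf.1 x k j, hg.1 x k j], hf.2.mul hg.2⟩
lemma CP1.sub {m : ℕ} {f g : Spc m → ℝ} (hf : CP1 f) (hg : CP1 g) : CP1 (fun x => f x - g x) :=
  ⟨fun x k j => by simp only [hf.1 x k j, hg.1 x k j], hf.2.sub hg.2⟩

lemma CP1.lip {m : ℕ} {f : Spc m → ℝ} (h : CP1 f) : ∃ L : ℝ, 0 ≤ L ∧ ∀ x y, |f x - f y| ≤ L * ‖x - y‖ := by
  obtain ⟨L, h0, hL⟩ := per_bdd (f := fun x => ‖fderiv ℝ f x‖) (h.1.fderiv.comp' norm) (h.2.continuous_fderiv one_ne_zero).norm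
  refine ⟨L, h0, fun x y => ?_⟩
  exact Convex.norm_image_sub_le_of_norm_fderiv_le (𝕜 := ℝ) (s := univ) (fun x _ => h.diff x) (fun x _ => by simpa using hL x) convex_univ trivial trivial

lemma pd_mul {m : ℕ} {f g : Spc m → ℝ} (hf : Differentiable ℝ f) (hg : Differentiable ℝ g) (v x : Spc m) :
    pd v (fun x => f x * g x) x = pd v f x * g x + f x * pd v g x := by
  unfold pd
  rw [fderiv_fun_mul (hf x) (hg x)]
  simp; ring

lemma pd_sub {m : ℕ} {f g : Spc m → ℝ} (hf : Differentiable ℝ f) (hg : Differentiable ℝ g) (v x : Spc m) :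
    pd v (fun x => f x - g x) x = pd v f x - pd v g x := by
  unfold pd
  rw [fderiv_fun_sub (hf x) (hg x)]; rfl

lemma pd_add {m : ℕ} {f g : Spc m → ℝ} (hf : Differentiable ℝ f) (hg : Differentiable ℝ g) (v x : Spc m) :
    pd v (fun x => f x + g x) x = pd v f x + pd v g x := by
  unfold pd
  rw [fderiv_fun_add (hf x) (hg x)]; rfl

lemma pd_smul {m : ℕ} {f : Spc m → ℝ} (c : ℝ) (hf : Differentiable ℝ f) (v x : Spc m) :
    pd v (fun x => c * f x) x = c * pd v f x := by
  unfold pd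
  rw [fderiv_const_mul (hf x)]; rfl

/-! marginals -/
lemma marg_cont {m : ℕ} {f : Spc m → ℝ} (hf : Per f) (hc : Continuous f) : Continuous (marg f) := by
  obtain ⟨M, h0, hM⟩ := per_bdd hf hc
  refine continuous_of_dominated (bound := fun _ => M) ?_ ?_ (integrable_const _) ?_
  · intro x; exact (by fun_prop : Continuous fun y => f (x, y)).aestronglyMeasurable
  · intro x; exact ae_of_all _ fun y => hM _
  · exact ae_of_all _ fun y => by fun_prop

lemma marg_deriv {m : ℕ} {f : Spc m → ℝ} (hf : CP1 f) (x1 : ℝ) : HasDerivAt (marg f) (marg (pd (e1 m) f) x1) x1 := by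
  obtain ⟨M, h0, hM⟩ := per_bdd (hf.1.pd (e1 m)) (hf.cpd (e1 m))
  have hc := hf.cont
  have hcp := hf.cpd (e1 m)
  have hint : Integrable (fun y => f (x1, y)) (volume.restrict (cube1 m)) := by
    obtain ⟨M, h0, hM⟩ := per_bdd hf.1 hf.cont
    exact (integrable_const M).mono' (by fun_prop : Continuous fun y => f (x1, y)).aestronglyMeasurable (ae_of_all _ fun y => hM _)
  refine (hasDerivAt_integral_of_dominated_loc_of_deriv_le (F := fun x y => f (x, y)) (F' := fun x y => pd (e1 m) f (x, y))
    (bound := fun _ => M) (Metric.ball_mem_nhds x1 one_pos) ?_ hint ?_ ?_ (integrable_const _) ?_).2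
  · exact Eventually.of_forall fun x => (by fun_prop : Continuous fun y => f (x, y)).aestronglyMeasurable
  · exact (by fun_prop : Continuous fun y => pd (e1 m) f (x1, y)).aestronglyMeasurable
  · exact ae_of_all _ fun y x _ => hM _
  · refine ae_of_all _ fun y x _ => ?_
    have h1 : HasDerivAt (fun x : ℝ => ((x, y) : Spc m)) (1, 0) x := (hasDerivAt_id x).prodMk (hasDerivAt_const x y)
    exact (hf.diff (x, y)).hasFDerivAt.comp_hasDerivAt x h1

lemma marg_per {m : ℕ} {f : Spc m → ℝ} (hf : Per f) (x : ℝ) (k : ℤ) : marg f (x + k) = marg f x := by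
  unfold marg
  congr 1; ext y
  have := hf (x, y) k 0
  simpa using this

def margX {m : ℕ} (f : Spc m → ℝ) (x : Spc m) : ℝ := marg f x.1

lemma margX_per {m : ℕ} {f : Spc m → ℝ} (hf : Per f) : Per (margX f) := fun x k _ => marg_per hf x.1 k

lemma marg_C1 {m : ℕ} {f : Spc m → ℝ} (hf : CP1 f) : ContDiff ℝ 1 (marg f) := by
  rw [contDiff_one_iff_deriv]
  refine ⟨fun x => (marg_deriv hf x).differentiableAt, ?_⟩
  rw [show deriv (marg f) = marg (pd (e1 m) f) from funext fun x => (marg_deriv hf x).deriv]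
  exact marg_cont (hf.1.pd _) (hf.cpd _)

lemma margX_CP1 {m : ℕ} {f : Spc m → ℝ} (hf : CP1 f) : CP1 (margX f) :=
  ⟨margX_per hf.1, (marg_C1 hf).comp contDiff_fst⟩

lemma pd_margX_C {m : ℕ} {f : Spc m → ℝ} (hf : CP1 f) (i : Fin m) : pd (eC m i) (margX f) = fun _ => 0 := by
  ext x
  have h1 : HasFDerivAt (margX f) _ x := HasDerivAt.comp_hasFDerivAt x (marg_deriv hf x.1) (hasFDerivAt_fst : HasFDerivAt (Prod.fst : Spc m → ℝ) (ContinuousLinearMap.fst ℝ ℝ (Fin m → ℝ)) x)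
  unfold pd
  rw [h1.fderiv]
  simp [eC]

/-! drift -/
def bF {m : ℕ} (V u : Spc m → ℝ) (o : Option (Fin m)) (x : Spc m) : ℝ :=
  pd (ed o) V x - (if o = none then phiF V u x.1 else 0)
def gF {m : ℕ} (V u : Spc m → ℝ) (o : Option (Fin m)) (x : Spc m) : ℝ := bF V u o x * u x

lemma pdV_CP1 {m : ℕ} {V : Spc m → ℝ} (hV : ContDiff ℝ 2 V) (hp : Per V) (v : Spc m) : CP1 (pd v V) :=
  ⟨hp.pd v, (hV.fderiv_right (m := 1) (by norm_num)).clm_apply contDiff_const⟩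

lemma phi_CP1 {m : ℕ} {V u : Spc m → ℝ} (hV : ContDiff ℝ 2 V) (hp : Per V) (hu : CP1 u) (hpos : ∀ x, 0 < marg u x) :
    CP1 (fun x : Spc m => phiF V u x.1) := by
  have h1 : CP1 (fun x => pd (e1 m) V x * u x) := (pdV_CP1 hV hp _).mul hu
  have e : (fun x : Spc m => phiF V u x.1) = fun x => margX (fun x => pd (e1 m) V x * u x) x / margX u x := rfl
  rw [e]
  refine ⟨fun x k j => ?_, (margX_CP1 h1).2.div (margX_CP1 hu).2 fun x => (hpos _).ne'⟩
  simp only [margX_per h1.1 x k j, margX_per hu.1 x k j]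

lemma bF_CP1 {m : ℕ} {V u : Spc m → ℝ} (hV : ContDiff ℝ 2 V) (hp : Per V) (hu : CP1 u) (hpos : ∀ x, 0 < marg u x)
    (o : Option (Fin m)) : CP1 (bF V u o) := by
  refine (pdV_CP1 hV hp (ed o)).sub ?_
  by_cases h : o = none
  · simp only [h, if_true]; exact phi_CP1 hV hp hu hpos
  · simp only [h, if_false]; exact ⟨fun _ _ _ => rfl, contDiff_const⟩

lemma gF_CP1 {m : ℕ} {V u : Spc m → ℝ} (hV : ContDiff ℝ 2 V) (hp : Per V) (hu : CP1 u) (hpos : ∀ x, 0 < marg u x)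
    (o : Option (Fin m)) : CP1 (gF V u o) := (bF_CP1 hV hp hu hpos o).mul hu

lemma Fop_eq {m : ℕ} {V u : Spc m → ℝ} (hV : ContDiff ℝ 2 V) (hp : Per V) (hu : CP1 u) (hpos : ∀ x, 0 < marg u x) (x : Spc m) :
    Fop V u x = ∑ o, pd (ed o) (gF V u o) x := by
  rw [Fintype.sum_option]
  have h1 : ∀ i, pd (ed (some i)) (gF V u (some i)) x = pd (eC m i) (pd (eC m i) V) x * u x + pd (eC m i) V x * pd (eC m i) u x := by
    intro i
    have e : gF V u (some i) = fun x => pd (eC m i) V x * u x := by ext y; simp [gF, bF, ed]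
    rw [e, pd_mul (pdV_CP1 hV hp _).diff hu.diff]; rfl
  have h2 : pd (ed none) (gF V u none) x = pd (e1 m) (pd (e1 m) V) x * u x + pd (e1 m) V x * pd (e1 m) u x
     - pd (e1 m) (fun z => phiF V u z.1 * u z) x := by
    have e : gF V u none = fun x => pd (e1 m) V x * u x - phiF V u x.1 * u x := by ext y; simp [gF, bF, ed]; ring
    rw [e, pd_sub ((pdV_CP1 hV hp _).mul hu).diff ((phi_CP1 hV hp hu hpos).mul hu).diff,
      pd_mul (pdV_CP1 hV hp _).diff hu.diff]; rfl
  simp_rw [h1, h2, Fop, gradDot, lap, Finset.sum_add_distrib, add_mul, Finset.sum_mul]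
  ring

lemma lap_eq {m : ℕ} (u : Spc m → ℝ) (x : Spc m) : lap u x = ∑ o, pd (ed o) (pd (ed o) u) x := by
  rw [Fintype.sum_option]; rfl

/-- `W^{2,p}` facts -/
lemma W2_CP1 {m : ℕ} {p : ℝ} {u : Spc m → ℝ} (h : MemW 2 p u) : CP1 u := by
  refine ⟨h.1, ?_⟩
  rw [contDiff_one_iff_fderiv]
  exact ⟨h.2.2.1 (by norm_num), (h.2.2.2.1 le_rfl).continuous⟩

lemma W2_dpd {m : ℕ} {p : ℝ} {u : Spc m → ℝ} (h : MemW 2 p u) (v : Spc m) : Differentiable ℝ (pd v u) :=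
  (h.2.2.2.1 le_rfl).clm_apply (differentiable_const v)

lemma W2_lp {m : ℕ} {p : ℝ} (hp : 1 ≤ p) {u : Spc m → ℝ} (h : MemW 2 p u) (o : Option (Fin m)) :
    PI (pd (ed o) (pd (ed o) u)) ∧ LpN p (pd (ed o) (pd (ed o) u)) < ⊤ := by
  have hm : Measurable (pd (ed o) (pd (ed o) u)) := measurable_fderiv_apply_const ℝ _ _
  have h1 : eLpNorm (fun x => ‖iteratedFDeriv ℝ 2 u x‖) (ENNReal.ofReal p) (μT m) < ⊤ := by
    have := h.2.2.2.2
    unfold WNorm at this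
    norm_num at this
    rw [eLpNorm_norm]; exact this.2
  have h2 : LpN p (pd (ed o) (pd (ed o) u)) < ⊤ := by
    refine lt_of_le_of_lt (eLpNorm_mono fun x => ?_) h1
    have e : pd (ed o) (pd (ed o) u) x = iteratedFDeriv ℝ 2 u x ![ed o, ed o] := by
      rw [iteratedFDeriv_two_apply]
      simp only [Matrix.cons_val_zero, Matrix.cons_val_one]
      unfold pd
      rw [fderiv_clm_apply (show DifferentiableAt ℝ (fderiv ℝ u) x from h.2.2.2.1 le_rfl x) (differentiableAt_const _)]
      simp
    rw [e, norm_norm]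
    refine ((iteratedFDeriv ℝ 2 u x).le_opNorm _).trans ?_
    simp [norm_ed]
  refine ⟨⟨((show Per u from h.1).pd _).pd _, hm, ?_⟩, h2⟩
  have hml : MemLp (pd (ed o) (pd (ed o) u)) (ENNReal.ofReal p) (μT m) := ⟨hm.aestronglyMeasurable, h2⟩
  exact hml.integrable (by simpa using ENNReal.ofReal_le_ofReal hp)

def Rop {m : ℕ} (V : Spc m → ℝ) (β : ℝ) (u : Spc m → ℝ) (x : Spc m) : ℝ := β⁻¹ * lap u x + Fop V u x

lemma LpN_add {m : ℕ} {p : ℝ} (hp : 1 ≤ p) {f g : Spc m → ℝ} (hf : Measurable f) (hg : Measurable g)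
    : LpN p (fun x => f x + g x) ≤ LpN p f + LpN p g :=
  eLpNorm_add_le hf.aestronglyMeasurable hg.aestronglyMeasurable (by simpa using ENNReal.ofReal_le_ofReal hp)

lemma LpN_sum {m : ℕ} {p : ℝ} (hp : 1 ≤ p) {ι : Type*} (s : Finset ι) {f : ι → Spc m → ℝ} (hf : ∀ i, Measurable (f i))
    (h : ∀ i, LpN p (f i) < ⊤) : LpN p (fun x => ∑ i ∈ s, f i x) < ⊤ := by
  have := memLp_finsetSum s (fun i (_ : i ∈ s) => (⟨(hf i).aestronglyMeasurable, h i⟩ : MemLp (f i) (ENNReal.ofReal p) (μT m)))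
  exact this.2

lemma R_facts {m : ℕ} {V : Spc m → ℝ} {β p : ℝ} (hp : 1 ≤ p) {u : Spc m → ℝ} (hV : ContDiff ℝ 2 V) (hpV : Per V) (h : MemW 2 p u)
    (hpos : ∀ x, 0 < marg u x) : PI (Rop V β u) ∧ LpN p (Rop V β u) < ⊤ ∧ (∀ a : ℝ, 0 < a → ∀ x, cv (Gk a) (Rop V β u) x =
      β⁻¹ * cv (Gt a) u x + ∑ o, cv (G1 a (ed o)) (gF V u o) x) := by
  have hu := W2_CP1 h
  have hg := gF_CP1 hV hpV hu hpos
  have e : Rop V β u = fun x => β⁻¹ * (∑ o, pd (ed o) (pd (ed o) u) x) + ∑ o, pd (ed o) (gF V u o) x := by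
    ext x; rw [Rop, lap_eq, Fop_eq hV hpV hu hpos]
  have p1 : PI (fun x => ∑ o, pd (ed o) (pd (ed o) u) x) := PI.sum _ fun o => (W2_lp hp h o).1
  have p2 : PI (fun x => ∑ o, pd (ed o) (gF V u o) x) := PI.sum _ fun o => (hg o).pipd _
  rw [e]
  refine ⟨(p1.smul _).add p2, ?_, ?_⟩
  · refine lt_of_le_of_lt (LpN_add hp (p1.smul _).2.1 p2.2.1) ?_
    refine ENNReal.add_lt_top.2 ⟨?_, ?_⟩
    · rw [LpN_smul]
      exact ENNReal.mul_lt_top ENNReal.ofReal_lt_top (LpN_sum hp _ (fun o => (W2_lp hp h o).1.2.1) fun o => (W2_lp hp h o).2)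
    · exact LpN_sum hp _ (fun o => ((hg o).pipd _).2.1) fun o => LpN_cont p ((hg o).1.pd _) ((hg o).cpd _)
  · intro a ha x
    rw [cv_add (dec_Gk ha) (p1.smul _) p2, cv_smul, cv_sum _ (dec_Gk ha) fun o => (W2_lp hp h o).1,
      cv_sum _ (dec_Gk ha) fun o => (hg o).pipd _]
    congr 1
    · congr 1
      have : cv (Gt a) u x = ∑ o : Option (Fin m), cv (G2 a (ed o) (ed o)) u x := by
        unfold cv
        rw [← integral_finsetSum _ fun o _ => hu.pi.integ (dec_G2 ha _ _) x]
        congr 1; ext z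
        rw [Gt_eq, Finset.sum_mul]
      rw [this]
      refine Finset.sum_congr rfl fun o _ => ?_
      rw [PB (dec_Gk ha) (dec_G1 ha _) _ x (deriv_Gk ha (ed o)) (hu.pipd _) (W2_dpd h _) (W2_lp hp h o).1,
        PB (dec_G1 ha _) (dec_G2 ha _ _) _ x (deriv_G1 ha (ed o) (ed o)) hu.pi hu.diff (hu.pipd _)]
    · refine Finset.sum_congr rfl fun o _ => ?_
      exact PB (dec_Gk ha) (dec_G1 ha _) _ x (deriv_Gk ha (ed o)) (hg o).pi (hg o).diff ((hg o).pipd _)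

/-- standing assumptions -/
structure HS {m : ℕ} (V : Spc m → ℝ) (β p : ℝ) (T : ℝ≥0∞) (ψ : ℝ → Spc m → ℝ) : Prop where
  hV : ContDiff ℝ 2 V
  hVp : Per V
  hβ : 0 < β
  hm : 1 ≤ m
  hp : (m : ℝ) + 1 < p
  per0 : Per (ψ 0)
  cont0 : Continuous (ψ 0)
  pos0 : ∀ x, 0 < marg (ψ 0) x
  nn0 : ∀ x, 0 ≤ ψ 0 x
  mass0 : ∫ x in cube m, ψ 0 x = 1
  w2 : ∀ t ∈ Ioo0 T, MemW 2 p (ψ t)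
  pos : ∀ t ∈ Ioo0 T, ∀ x, 0 < marg (ψ t) x
  contLp : ∀ t ∈ Ico0 T, ∀ ε : ℝ, 0 < ε → ∃ δ > 0, ∀ t' ∈ Ico0 T, |t' - t| < δ →
    LpN p (fun x => ψ t' x - ψ t x) < ENNReal.ofReal ε
  eqn : ∀ t ∈ Ioo0 T, Tendsto (fun h : ℝ => LpN p (fun x => (ψ (t + h) x - ψ t x) / h - Rop V β (ψ t) x))
      (nhdsWithin 0 {h : ℝ | h ≠ 0}) (nhds 0)

section
variable {m : ℕ} {V : Spc m → ℝ} {β p : ℝ} {T : ℝ≥0∞} {ψ : ℝ → Spc m → ℝ}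

lemma HS.p2 (H : HS V β p T ψ) : 2 < p := by
  have h := H.hp
  have : (1:ℝ) ≤ m := by exact_mod_cast H.hm
  linarith
lemma HS.p1 (H : HS V β p T ψ) : 1 ≤ p := by linarith [H.p2]
lemma HS.pm (H : HS V β p T ψ) : (m : ℝ) + 1 < 2 * p := by linarith [H.p2, H.hp]

lemma ico_cases {T : ℝ≥0∞} {t : ℝ} (h : t ∈ Ico0 T) : t = 0 ∨ t ∈ Ioo0 T := by
  rcases h.1.eq_or_lt with h0 | h0
  · exact Or.inl h0.symm
  · exact Or.inr ⟨h0, h.2⟩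

lemma HS.per (H : HS V β p T ψ) {t : ℝ} (ht : t ∈ Ico0 T) : Per (ψ t) := by
  rcases ico_cases ht with rfl | h
  · exact H.per0
  · exact (W2_CP1 (H.w2 t h)).1
lemma HS.cont (H : HS V β p T ψ) {t : ℝ} (ht : t ∈ Ico0 T) : Continuous (ψ t) := by
  rcases ico_cases ht with rfl | h
  · exact H.cont0
  · exact (W2_CP1 (H.w2 t h)).cont
lemma HS.pi (H : HS V β p T ψ) {t : ℝ} (ht : t ∈ Ico0 T) : PI (ψ t) := PI.ofCont (H.per ht) (H.cont ht)
lemma HS.posm (H : HS V β p T ψ) {t : ℝ} (ht : t ∈ Ico0 T) : ∀ x, 0 < marg (ψ t) x := by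
  rcases ico_cases ht with rfl | h
  · exact H.pos0
  · exact H.pos t h

lemma HS.sol (H : HS V β p T ψ) : Sol β p T ψ (fun t => Rop V β (ψ t)) (fun t => gF V (ψ t)) where
  pi := fun t ht => H.pi ht
  cont := H.contLp
  piR := fun t ht => (R_facts H.p1 H.hV H.hVp (H.w2 t ht) (H.pos t ht)).1
  lpR := fun t ht => (R_facts H.p1 H.hV H.hVp (H.w2 t ht) (H.pos t ht)).2.1
  eqn := H.eqn
  weak := fun t ht a ha x => (R_facts H.p1 H.hV H.hVp (H.w2 t ht) (H.pos t ht)).2.2 a ha x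
  lip := fun t ht => (W2_CP1 (H.w2 t ht)).lip
end

/-! marginals of integrable functions -/
lemma meas_snd (m : ℕ) : MeasurePreserving (Prod.snd : Spc m → (Fin m → ℝ)) (μT m) (volume.restrict (cube1 m)) := by
  rw [μT_prod]
  have : IsProbabilityMeasure (volume.restrict (Set.Ico (0:ℝ) 1)) := ⟨by simp⟩
  exact measurePreserving_snd

lemma meas_fst (m : ℕ) : MeasurePreserving (Prod.fst : Spc m → ℝ) (μT m) (volume.restrict (Set.Ico (0:ℝ) 1)) := by
  rw [μT_prod]
  exact measurePreserving_fst

lemma TI1 {m : ℕ} {f : Spc m → ℝ} (hf : Per f) (hm : Measurable f) (x : ℝ) (v : Fin m → ℝ) :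
    ∫⁻ y in cube1 m, ‖f (x, y - v)‖ₑ = ∫⁻ y in cube1 m, ‖f (x, y)‖ₑ := by
  have h1 : Per (fun z : Spc m => ‖f (x, z.2)‖ₑ) := fun z k j => by
    have := hf (x, z.2) 0 j
    simp only [Int.cast_zero, add_zero] at this
    simp only [this]
  have h := TI h1 (0, -v)
  have m1 : Measurable (fun y : Fin m → ℝ => ‖f (x, y - v)‖ₑ) := (hm.comp (by fun_prop : Measurable fun y : Fin m → ℝ => ((x, y - v) : Spc m))).enorm
  have m2 : Measurable (fun y : Fin m → ℝ => ‖f (x, y)‖ₑ) := (hm.comp (by fun_prop : Measurable fun y : Fin m → ℝ => ((x, y) : Spc m))).enorm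
  have e1 := (meas_snd m).lintegral_comp m1
  have e2 := (meas_snd m).lintegral_comp m2
  rw [← e1, ← e2]
  simp only [μT]
  rw [← h]
  refine lintegral_congr fun z => ?_
  simp [sub_eq_neg_add]

lemma TI1r {m : ℕ} {f : Spc m → ℝ} (hf : Per f) (hm : Measurable f) (x : ℝ) (v : Fin m → ℝ) :
    ∫ y in cube1 m, f (x, y - v) = ∫ y in cube1 m, f (x, y) := by
  have h1 : Per (fun z : Spc m => f (x, z.2)) := fun z k j => by
    have := hf (x, z.2) 0 j
    simp only [Int.cast_zero, add_zero] at this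
    simp only [this]
  have h := TIint h1 (0, -v)
  have m1 : Measurable (fun y : Fin m → ℝ => f (x, y - v)) := (hm.comp (by fun_prop : Measurable fun y : Fin m → ℝ => ((x, y - v) : Spc m)))
  have m2 : Measurable (fun y : Fin m → ℝ => f (x, y)) := (hm.comp (by fun_prop : Measurable fun y : Fin m → ℝ => ((x, y) : Spc m)))
  have e1 := integral_map (μ := μT m) (meas_snd m).measurable.aemeasurable (f := fun y : Fin m → ℝ => f (x, y - v)) m1.aestronglyMeasurable
  have e2 := integral_map (μ := μT m) (meas_snd m).measurable.aemeasurable (f := fun y : Fin m → ℝ => f (x, y)) m2.aestronglyMeasurable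
  rw [(meas_snd m).map_eq] at e1 e2
  rw [e1, e2]
  simp only [μT]
  rw [← h]
  refine integral_congr_ae (ae_of_all _ fun z => ?_)
  simp [sub_eq_neg_add]

lemma margX_meas {m : ℕ} {f : Spc m → ℝ} (hf : Measurable f) : Measurable (margX f) := by
  have : Measurable (marg f) := (hf.stronglyMeasurable.integral_prod_right' (ν := volume.restrict (cube1 m))).measurable
  exact this.comp measurable_fst

lemma margX_jensen {m : ℕ} {p : ℝ} (hp : 1 ≤ p) {f : Spc m → ℝ} (hf : Measurable f) : LpN p (margX f) ≤ LpN p f := by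
  have hp0 : 0 < p := by linarith
  unfold LpN
  have h0 : ENNReal.ofReal p ≠ 0 := by simpa using hp0
  rw [eLpNorm_eq_lintegral_rpow_enorm_toReal h0 ENNReal.ofReal_ne_top, eLpNorm_eq_lintegral_rpow_enorm_toReal h0 ENNReal.ofReal_ne_top,
    ENNReal.toReal_ofReal hp0.le]
  refine ENNReal.rpow_le_rpow ?_ (by positivity)
  have hm : Measurable (marg f) := (hf.stronglyMeasurable.integral_prod_right' (ν := volume.restrict (cube1 m))).measurable
  have e1 : ∫⁻ x, ‖margX f x‖ₑ ^ p ∂μT m = ∫⁻ x in Set.Ico (0:ℝ) 1, ‖marg f x‖ₑ ^ p :=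
    (meas_fst m).lintegral_comp (f := fun x => ‖marg f x‖ₑ ^ p) (hm.enorm.pow_const p)
  rw [e1, μT_prod, lintegral_prod _ (by exact (hf.enorm.pow_const p).aemeasurable)]
  refine lintegral_mono fun x => ?_
  have hfx : Measurable (fun y => f (x, y)) := hf.comp (by fun_prop)
  have h1 : ‖marg f x‖ₑ ≤ ∫⁻ y in cube1 m, ‖f (x, y)‖ₑ := enorm_integral_le_lintegral_enorm _
  have h2 := eLpNorm_le_eLpNorm_of_exponent_le (μ := volume.restrict (cube1 m)) (p := 1) (q := ENNReal.ofReal p) (f := fun y => f (x, y))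
    (by simpa using ENNReal.ofReal_le_ofReal hp) hfx.aestronglyMeasurable
  rw [eLpNorm_one_eq_lintegral_enorm, eLpNorm_eq_lintegral_rpow_enorm_toReal h0 ENNReal.ofReal_ne_top, ENNReal.toReal_ofReal hp0.le] at h2
  have h3 := ENNReal.rpow_le_rpow (h1.trans h2) hp0.le
  rwa [← ENNReal.rpow_mul, one_div, inv_mul_cancel₀ hp0.ne', ENNReal.rpow_one] at h3

lemma PI.margX {m : ℕ} {f : Spc m → ℝ} (hf : PI f) : PI (margX f) := by
  refine ⟨margX_per hf.1, margX_meas hf.2.1, ?_⟩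
  have h := margX_jensen le_rfl hf.2.1
  unfold LpN at h
  rw [ENNReal.ofReal_one] at h
  rw [← memLp_one_iff_integrable]
  exact ⟨(margX_meas hf.2.1).aestronglyMeasurable, h.trans_lt (memLp_one_iff_integrable.2 hf.2.2).2⟩

lemma swap_int {m : ℕ} {k f : Spc m → ℝ} (hk : Dec k) (hf : PI f) (x1 : ℝ) :
    Integrable (fun q : Spc m × (Fin m → ℝ) => k q.1 * f ((x1, q.2) - q.1)) ((volume : Measure (Spc m)).prod (volume.restrict (cube1 m))) := by
  obtain ⟨hkc, C, c, hc, hb⟩ := hk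
  have hmes : Measurable (fun q : Spc m × (Fin m → ℝ) => k q.1 * f ((x1, q.2) - q.1)) :=
    (hkc.measurable.comp measurable_fst).mul (hf.2.1.comp (by fun_prop))
  refine ⟨hmes.aestronglyMeasurable, ?_⟩
  unfold HasFiniteIntegral
  rw [lintegral_prod _ hmes.enorm.aemeasurable]
  set h : Spc m → ℝ≥0∞ := fun x => ∫⁻ y in cube1 m, ‖f (x.1, y)‖ₑ with hh
  have hhm : Measurable h := by
    have : Measurable (fun x : ℝ => ∫⁻ y in cube1 m, ‖f (x, y)‖ₑ) := Measurable.lintegral_prod_right (by exact hf.2.1.enorm)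
    exact this.comp measurable_fst
  have hhp : Per h := fun x k j => by
    simp only [hh]
    refine lintegral_congr fun y => ?_
    have := hf.1 (x.1, y) k 0
    simp at this
    rw [this]
  obtain ⟨C1, hC1, hL⟩ := L1P (m := m) hc
  have h1 := hL h hhm hhp (x1, 0)
  have h2 : ∫⁻ u in cube m, h u < ⊤ := by
    have : ∫⁻ u in cube m, h u = ∫⁻ u, ‖f u‖ₑ ∂μT m := by
      have m' : Measurable (fun x : ℝ => ∫⁻ y in cube1 m, ‖f (x, y)‖ₑ) := Measurable.lintegral_prod_right (by exact hf.2.1.enorm)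
      have := (meas_fst m).lintegral_comp m'
      rw [μT] at this
      rw [hh, this, μT_prod, lintegral_prod _ (by exact hf.2.1.enorm.aemeasurable)]
    rw [this]; exact hf.2.2.2
  have h3 : ∀ z : Spc m, ∫⁻ y in cube1 m, ‖k z * f ((x1, y) - z)‖ₑ ≤ ENNReal.ofReal C * (ENNReal.ofReal (Real.exp (-c * qd z)) * h ((x1, 0) - z)) := by
    intro z
    simp_rw [enorm_mul]
    have hfx : Measurable (fun y => f ((x1, y) - z)) := hf.2.1.comp (by fun_prop)
    rw [lintegral_const_mul _ hfx.enorm, ← mul_assoc]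
    refine mul_le_mul' ?_ ?_
    · rw [Real.enorm_eq_ofReal_abs, ← ENNReal.ofReal_mul']
      · exact ENNReal.ofReal_le_ofReal (hb z)
      · positivity
    · have := TI1 hf.1 hf.2.1 (x1 - z.1) z.2
      simp only [hh]
      exact this.le
  refine (lintegral_mono h3).trans_lt ?_
  rw [lintegral_const_mul' _ _ ENNReal.ofReal_ne_top]
  exact ENNReal.mul_lt_top ENNReal.ofReal_lt_top (h1.trans_lt (ENNReal.mul_lt_top ENNReal.ofReal_lt_top h2))

lemma swap {m : ℕ} {k f : Spc m → ℝ} (hk : Dec k) (hf : PI f) (x : Spc m) :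
    cv k (margX f) x = ∫ y in cube1 m, cv k f (x.1, y) ∧ Integrable (fun y => cv k f (x.1, y)) (volume.restrict (cube1 m)) := by
  have hI := swap_int hk hf x.1
  refine ⟨?_, hI.integral_prod_right⟩
  have e := integral_integral_swap (f := fun (z : Spc m) y => k z * f ((x.1, y) - z)) hI
  unfold cv
  rw [← e]
  congr 1; ext z
  rw [integral_const_mul]
  congr 1
  exact (TI1r hf.1 hf.2.1 (x.1 - z.1) z.2).symm

lemma ae_slice {m : ℕ} {f : Spc m → ℝ} (hf : PI f) : ∀ᵐ x ∂μT m, Integrable (fun y => f (x.1, y)) (volume.restrict (cube1 m)) := by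
  have h := hf.2.2
  rw [μT_prod] at h
  exact (meas_fst m).quasiMeasurePreserving.ae h.prod_right_ae

section
variable {m : ℕ} {V : Spc m → ℝ} {β p : ℝ} {T : ℝ≥0∞} {ψ : ℝ → Spc m → ℝ}

lemma marg_g_none {u : Spc m → ℝ} (hV : ContDiff ℝ 2 V) (hp : Per V) (hu : CP1 u) (hpos : ∀ x, 0 < marg u x) :
    margX (gF V u none) = fun _ => 0 := by
  ext x
  have e : ∀ y, gF V u none (x.1, y) = pd (e1 m) V (x.1, y) * u (x.1, y) - phiF V u x.1 * u (x.1, y) := by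
    intro y; simp [gF, bF, ed]; ring
  have hi : ∀ f : Spc m → ℝ, CP1 f → Integrable (fun y => f (x.1, y)) (volume.restrict (cube1 m)) := fun f hf => by
    obtain ⟨M, h0, hM⟩ := per_bdd hf.1 hf.cont
    have := hf.cont
    exact (integrable_const M).mono' (by fun_prop : Continuous fun y => f (x.1, y)).aestronglyMeasurable (ae_of_all _ fun y => hM _)
  unfold margX marg
  simp_rw [e]
  rw [integral_sub (hi _ ((pdV_CP1 hV hp (e1 m)).mul hu)) ((hi _ hu).const_mul _), integral_const_mul]
  have h2 := hpos x.1
  unfold phiF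
  rw [show ∫ y in cube1 m, u (x.1, y) = marg u x.1 from rfl, div_mul_cancel₀ _ h2.ne', sub_self]

lemma HS.solM (H : HS V β p T ψ) : Sol β p T (fun t => margX (ψ t)) (fun t => margX (Rop V β (ψ t))) (fun _ _ _ => 0) where
  pi := fun t ht => (H.pi ht).margX
  cont := fun t ht ε hε => by
    obtain ⟨δ, hδ, h⟩ := H.contLp t ht ε hε
    refine ⟨δ, hδ, fun t' ht' hd => lt_of_le_of_lt ?_ (h t' ht' hd)⟩
    refine le_trans (le_of_eq ?_) (margX_jensen H.p1 ((H.pi ht').sub (H.pi ht)).2.1)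
    refine eLpNorm_congr_ae ?_
    filter_upwards [ae_slice (H.pi ht'), ae_slice (H.pi ht)] with x h1 h2
    exact (integral_sub h1 h2).symm
  piR := fun t ht => (H.sol.piR t ht).margX
  lpR := fun t ht => (margX_jensen H.p1 (H.sol.piR t ht).2.1).trans_lt (H.sol.lpR t ht)
  eqn := fun t ht => by
    refine tendsto_of_tendsto_of_tendsto_of_le_of_le' tendsto_const_nhds (H.eqn t ht) (Eventually.of_forall fun _ => zero_le) ?_
    have : ∀ᶠ h : ℝ in nhdsWithin 0 {h : ℝ | h ≠ 0}, t + h ∈ Ioo0 T := by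
      refine nhdsWithin_le_nhds ?_
      have hc : ContinuousAt (fun h : ℝ => t + h) 0 := by fun_prop
      exact hc.eventually_mem ((isOpen_Ioo0 T).mem_nhds (by simpa using ht))
    filter_upwards [this] with h hh
    have p1 := H.pi (io_sub hh)
    have p2 := H.pi (io_sub ht)
    have p3 := H.sol.piR t ht
    refine le_trans (le_of_eq ?_) (margX_jensen H.p1 (f := fun x => (ψ (t + h) x - ψ t x) / h - Rop V β (ψ t) x) (((p1.2.1.sub p2.2.1).div_const h).sub p3.2.1))
    refine eLpNorm_congr_ae ?_
    filter_upwards [ae_slice p1, ae_slice p2, ae_slice p3] with x h1 h2 h3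
    have e1 := integral_sub ((h1.sub h2).div_const h) h3
    have e2 := integral_sub h1 h2
    simp only [Pi.sub_apply] at e1
    rw [integral_div, e2] at e1
    exact e1.symm
  weak := fun t ht a ha x => by
    have S := H.sol
    have hu := W2_CP1 (H.w2 t ht)
    have hg := gF_CP1 H.hV H.hVp hu (H.pos t ht)
    rw [(swap (dec_Gk ha) (S.piR t ht) x).1]
    simp_rw [S.weak t ht a ha]
    rw [integral_add ((swap (dec_Gt ha) hu.pi x).2.const_mul _) (integrable_finsetSum _ fun o _ => (swap (dec_G1 ha _) (hg o).pi x).2),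
      integral_const_mul, ← (swap (dec_Gt ha) hu.pi x).1, integral_finsetSum _ fun o _ => (swap (dec_G1 ha _) (hg o).pi x).2]
    congr 1
    refine Finset.sum_congr rfl fun o _ => ?_
    rw [← (swap (dec_G1 ha _) (hg o).pi x).1]
    have z0 : cv (G1 a (ed o)) (fun _ => 0) x = 0 := by simp [cv]
    rw [z0]
    cases o with
    | none => rw [marg_g_none H.hV H.hVp hu (H.pos t ht)]; simp [cv]
    | some i =>
      have c := margX_CP1 (hg (some i))
      rw [← PB (dec_Gk ha) (dec_G1 ha _) _ x (deriv_Gk ha (ed (some i))) c.pi c.diff (c.pipd _)]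
      have : pd (ed (some i)) (margX (gF V (ψ t) (some i))) = fun _ => 0 := pd_margX_C (hg (some i)) i
      rw [this]; simp [cv]
  lip := fun t ht => (margX_CP1 (W2_CP1 (H.w2 t ht))).lip

lemma cv_ge {f : Spc m → ℝ} (hf : PI f) {a c : ℝ} (ha : 0 < a) (h : ∀ x, c ≤ f x) (x : Spc m) : c ≤ cv (Gk a) f x := by
  have h1 := cv_sub (dec_Gk ha) hf (PI.one c) x
  have h2 : cv (Gk a) (fun _ => c) x = c := by
    unfold cv; rw [integral_mul_const, integral_Gk ha, one_mul]
  have h3 : 0 ≤ cv (Gk a) (fun z => f z - c) x := integral_nonneg fun z => mul_nonneg (Gk_nonneg _ _) (sub_nonneg.2 (h _))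
  linarith

/-- induction over time windows -/
lemma win {T : ℝ≥0∞} {b : ℝ} (hb : 0 < b) (P : ℝ → Prop) (h0 : P 0)
    (hs : ∀ s ∈ Ico0 T, ∀ t ∈ Ico0 T, s < t → t - s ≤ b → P s → P t) : ∀ t ∈ Ico0 T, P t := by
  have : ∀ n : ℕ, ∀ t ∈ Ico0 T, t ≤ n * b → P t := by
    intro n
    induction n with
    | zero => intro t ht h; have : t = 0 := le_antisymm (by simpa using h) ht.1; rwa [this]
    | succ n ih =>
      intro t ht h
      by_cases hc : t ≤ n * b
      · exact ih t ht hc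
      · push Not at hc
        have hn : 0 ≤ n * b := by positivity
        exact hs (n * b) (ic_mid ht hn hc.le) t ht hc (by push_cast at h; linarith) (ih _ (ic_mid ht hn hc.le) le_rfl)
  intro t ht
  obtain ⟨n, hn⟩ := exists_nat_ge (t / b)
  exact this n t ht (by rwa [div_le_iff₀ hb] at hn)

lemma HS.low (H : HS V β p T ψ) : ∃ c : ℝ, 0 < c ∧ ∀ t ∈ Ico0 T, ∀ x, c ≤ marg (ψ t) x := by
  obtain ⟨x0, hx0, hmin⟩ := (isCompact_Icc (a := (0:ℝ)) (b := 1)).exists_isMinOn ⟨0, by simp⟩ (marg_cont H.per0 H.cont0).continuousOn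
  refine ⟨marg (ψ 0) x0, H.pos0 x0, ?_⟩
  have key : ∀ t ∈ Ico0 T, ∀ x : Spc m, marg (ψ 0) x0 ≤ margX (ψ t) x := by
    refine win H.hβ (fun t => ∀ x : Spc m, marg (ψ 0) x0 ≤ margX (ψ t) x) ?_ ?_
    · intro x
      have h1 := marg_per H.per0 (Int.fract x.1) ⌊x.1⌋
      rw [Int.fract_add_floor] at h1
      unfold margX
      rw [h1]
      exact hmin ⟨Int.fract_nonneg _, (Int.fract_lt_one _).le⟩
    · intro s hs t ht hst hb hP x
      have hd := H.solM.duh H.hβ H.p1 H.pm hs ht hst hb (ι := Unit) (fun _ => 1) (fun _ => x) (K := 0) one_pos (by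
        intro r hr; simp [cv])
      simp only [Finset.univ_unique, Finset.sum_const, Finset.card_singleton, one_smul, one_mul, zero_mul, zero_div] at hd
      have e := abs_nonpos_iff.1 hd
      have := cv_ge (a := (t - s) / β) ((H.pi hs).margX) (div_pos (sub_pos.2 hst) H.hβ) hP x
      linarith
  exact fun t ht x => key t ht (x, 0)
end

lemma TIsub {m : ℕ} {f : Spc m → ℝ} (hf : Per f) (z : Spc m) : ∫ x, f (x - z) ∂μT m = ∫ x, f x ∂μT m := by
  have := TIint hf (-z)
  simp_rw [neg_add_eq_sub] at this
  exact this

lemma cv_cube {m : ℕ} {k f : Spc m → ℝ} (hk : Dec k) (hf : PI f) :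
    ∫ x, cv k f x ∂μT m = (∫ z, k z) * ∫ x, f x ∂μT m := by
  have hI : Integrable (fun q : Spc m × Spc m => k q.1 * f (q.2 - q.1)) ((volume : Measure (Spc m)).prod (μT m)) := by
    have hmes : Measurable (fun q : Spc m × Spc m => k q.1 * f (q.2 - q.1)) :=
      (hk.1.measurable.comp measurable_fst).mul (hf.2.1.comp (by fun_prop))
    refine ⟨hmes.aestronglyMeasurable, ?_⟩
    unfold HasFiniteIntegral
    rw [lintegral_prod _ hmes.enorm.aemeasurable]
    have h3 : ∀ z : Spc m, ∫⁻ y, ‖k z * f (y - z)‖ₑ ∂μT m = ‖k z‖ₑ * ∫⁻ y, ‖f y‖ₑ ∂μT m := by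
      intro z
      simp_rw [enorm_mul]
      have hfx : Measurable (fun y => f (y - z)) := hf.2.1.comp (by fun_prop)
      rw [lintegral_const_mul _ hfx.enorm]
      have := TI (PI.enorm_per hf.1) (-z)
      simp_rw [neg_add_eq_sub] at this
      simp only [μT]
      rw [this]
    simp only [h3]
    rw [lintegral_mul_const _ hk.1.measurable.enorm]
    exact ENNReal.mul_lt_top hk.int.2 hf.2.2.2
  have e := integral_integral_swap (f := fun (z : Spc m) x => k z * f (x - z)) hI
  unfold cv
  rw [← e, ← integral_mul_const]
  congr 1; ext z
  rw [integral_const_mul, TIsub hf.1]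

lemma ibp {m : ℕ} {u : Spc m → ℝ} (v : Spc m) (hu : PI u) (hd : Differentiable ℝ u) (hpu : PI (pd v u)) :
    ∫ x, pd v u x ∂μT m = 0 := by
  have h1 := cv_cube (dec_Gk one_pos) hpu
  have h2 := cv_cube (dec_G1 one_pos v) hu
  rw [int_G1 one_pos, zero_mul] at h2
  rw [integral_Gk one_pos, one_mul] at h1
  rw [← h1, ← h2]
  congr 1; ext x
  exact PB (dec_Gk one_pos) (dec_G1 one_pos _) _ x (deriv_Gk one_pos v) hu hd hpu

lemma lp_facts {m : ℕ} {p : ℝ} (hp : 2 ≤ p) {f : Spc m → ℝ} (hm : Measurable f) (h : LpN p f < ⊤) :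
    Integrable f (μT m) ∧ Integrable (fun x => f x ^ 2) (μT m) ∧ ∫ x, |f x| ∂μT m ≤ (LpN p f).toReal ∧
      ∫ x, f x ^ 2 ∂μT m ≤ (LpN p f).toReal ^ 2 := by
  have hL : MemLp f (ENNReal.ofReal p) (μT m) := ⟨hm.aestronglyMeasurable, h⟩
  have h2 : (2 : ℝ≥0∞) ≤ ENNReal.ofReal p := by simpa using ENNReal.ofReal_le_ofReal hp
  have hL2 : MemLp f 2 (μT m) := hL.mono_exponent h2
  have hL1 : MemLp f 1 (μT m) := hL2.mono_exponent (by norm_num)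
  refine ⟨memLp_one_iff_integrable.1 hL1, hL2.integrable_sq, ?_, ?_⟩
  · have e := integral_norm_eq_lintegral_enorm (μ := μT m) hm.aestronglyMeasurable
    simp only [Real.norm_eq_abs] at e
    rw [e, ← eLpNorm_one_eq_lintegral_enorm]
    exact ENNReal.toReal_mono h.ne (eLpNorm_le_eLpNorm_of_exponent_le ((by norm_num : (1:ℝ≥0∞) ≤ 2).trans h2) hm.aestronglyMeasurable)
  · have e : ∫ x, f x ^ 2 ∂μT m = (eLpNorm f 2 (μT m)).toReal ^ 2 := by
      rw [← ENNReal.toReal_pow, integral_eq_lintegral_of_nonneg_ae (ae_of_all _ fun x => sq_nonneg _) (hm.pow_const 2).aestronglyMeasurable]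
      congr 1
      have := eLpNorm_nnreal_pow_eq_lintegral (f := f) (μ := μT m) (p := 2) (by norm_num)
      norm_num at this
      rw [this]
      refine lintegral_congr fun x => ?_
      rw [Real.enorm_eq_ofReal_abs, ← ENNReal.ofReal_pow (abs_nonneg _), sq_abs]
    rw [e]
    have := ENNReal.toReal_mono h.ne (eLpNorm_le_eLpNorm_of_exponent_le h2 hm.aestronglyMeasurable)
    exact pow_le_pow_left₀ ENNReal.toReal_nonneg this 2

structure JF (j j1 j2 : ℝ → ℝ) (L η : ℝ) : Prop where
  L0 : 0 ≤ L
  d1 : ∀ r, HasDerivAt j (j1 r) r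
  d2 : ∀ r, HasDerivAt j1 (j2 r) r
  c2 : Continuous j2
  tay : ∀ r s, |j s - j r - j1 r * (s - r)| ≤ L * (s - r) ^ 2
  lip : ∀ r s, |j s - j r| ≤ |s - r|
  b1 : ∀ r, |j1 r| ≤ 1
  n2 : ∀ r, 0 ≤ j2 r
  q2 : ∀ r, j2 r * r ^ 2 ≤ η

section
variable {m : ℕ} {V : Spc m → ℝ} {β p : ℝ} {T : ℝ≥0∞} {ψ : ℝ → Spc m → ℝ} {j j1 j2 : ℝ → ℝ} {L η : ℝ}

lemma JF.cj (J : JF j j1 j2 L η) : Continuous j := continuous_iff_continuousAt.2 fun r => (J.d1 r).continuousAt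
lemma JF.c1 (J : JF j j1 j2 L η) : Continuous j1 := continuous_iff_continuousAt.2 fun r => (J.d2 r).continuousAt

lemma HS.piJ (H : HS V β p T ψ) {t : ℝ} (ht : t ∈ Ico0 T) {j : ℝ → ℝ} (hj : Continuous j) : PI (fun x => j (ψ t x)) :=
  PI.ofCont ((H.per ht).comp' j) (hj.comp (H.cont ht))

lemma HS.lpψ (H : HS V β p T ψ) {t : ℝ} (ht : t ∈ Ico0 T) : LpN p (ψ t) < ⊤ := LpN_cont p (H.per ht) (H.cont ht)

lemma HS.enDeriv (H : HS V β p T ψ) (J : JF j j1 j2 L η) {t : ℝ} (ht : t ∈ Ioo0 T) :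
    HasDerivAt (fun t => ∫ x, j (ψ t x) ∂μT m) (∫ x, j1 (ψ t x) * Rop V β (ψ t) x ∂μT m) t := by
  rw [hasDerivAt_iff_tendsto_slope_zero]
  set R := Rop V β (ψ t)
  have pR := H.sol.piR t ht
  obtain ⟨iR, iR2, -, -⟩ := lp_facts H.p2.le pR.2.1 (H.sol.lpR t ht)
  set r := ∫ x, R x ^ 2 ∂μT m
  set e : ℝ → ℝ := fun h => (LpN p (fun x => (ψ (t + h) x - ψ t x) / h - R x)).toReal with he
  have he0 : Tendsto e (nhdsWithin 0 {0}ᶜ) (nhds 0) := by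
    have := (ENNReal.tendsto_toReal ENNReal.zero_ne_top).comp (H.eqn t ht)
    exact this
  have hid : Tendsto (fun h : ℝ => |h|) (nhdsWithin 0 {0}ᶜ) (nhds 0) := by
    have : Tendsto (fun h : ℝ => |h|) (nhds 0) (nhds |0|) := continuous_abs.tendsto 0
    rw [abs_zero] at this
    exact this.mono_left nhdsWithin_le_nhds
  rw [tendsto_iff_dist_tendsto_zero]
  have hlim : Tendsto (fun h => L * |h| * (2 * e h ^ 2 + 2 * r) + e h) (nhdsWithin 0 {0}ᶜ) (nhds 0) := by
    have := ((hid.const_mul L).mul (((he0.pow 2).const_mul 2).add_const (2 * r))).add he0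
    simpa using this
  refine squeeze_zero' (Eventually.of_forall fun _ => dist_nonneg) ?_ hlim
  have hin : ∀ᶠ h : ℝ in nhdsWithin 0 {0}ᶜ, t + h ∈ Ioo0 T := by
    refine nhdsWithin_le_nhds ?_
    have hc : ContinuousAt (fun h : ℝ => t + h) 0 := by fun_prop
    exact hc.eventually_mem ((isOpen_Ioo0 T).mem_nhds (by simpa using ht))
  have hfin : ∀ᶠ h : ℝ in nhdsWithin 0 {0}ᶜ, LpN p (fun x => (ψ (t + h) x - ψ t x) / h - R x) < ⊤ :=
    (H.eqn t ht).eventually (gt_mem_nhds (show (0:ℝ≥0∞) < ⊤ by simp))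
  filter_upwards [hin, hfin, self_mem_nhdsWithin] with h hh hf h0
  have h0' : h ≠ 0 := h0
  have p1 := H.pi (io_sub hh)
  have p2 := H.pi (io_sub ht)
  have mD : Measurable (fun x => (ψ (t + h) x - ψ t x) / h - R x) := ((p1.2.1.sub p2.2.1).div_const h).sub pR.2.1
  obtain ⟨i1, i2, b1, b2⟩ := lp_facts H.p2.le mD hf
  have q1 := H.piJ (io_sub hh) J.cj
  have q2 := H.piJ (io_sub ht) J.cj
  have q3 : Integrable (fun x => j1 (ψ t x) * R x) (μT m) := by
    refine pR.2.2.abs.mono' ((J.c1.measurable.comp p2.2.1).mul pR.2.1).aestronglyMeasurable (ae_of_all _ fun x => ?_)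
    rw [Real.norm_eq_abs, abs_mul]
    exact mul_le_of_le_one_left (abs_nonneg _) (J.b1 _)
  have q4 : Integrable (fun x => h⁻¹ * (j (ψ (t + h) x) - j (ψ t x))) (μT m) := (q1.2.2.sub q2.2.2).const_mul _
  rw [Real.dist_eq, ← integral_sub q1.2.2 q2.2.2, smul_eq_mul, ← integral_const_mul, ← integral_sub q4 q3]
  refine (abs_integral_le_integral_abs).trans ?_
  have hb : ∀ x, |h⁻¹ * (j (ψ (t + h) x) - j (ψ t x)) - j1 (ψ t x) * R x| ≤
      L * |h| * (2 * ((ψ (t + h) x - ψ t x) / h - R x) ^ 2 + 2 * R x ^ 2) + |(ψ (t + h) x - ψ t x) / h - R x| := by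
    intro x
    set a := ψ (t + h) x
    set b := ψ t x
    have e1 : h⁻¹ * (j a - j b) - j1 b * R x = h⁻¹ * (j a - j b - j1 b * (a - b)) + j1 b * ((a - b) / h - R x) := by field_simp; ring
    rw [e1]
    refine (abs_add_le _ _).trans (add_le_add ?_ ?_)
    · rw [abs_mul, abs_inv]
      have hh : 0 < |h| := abs_pos.2 h0'
      refine (mul_le_mul_of_nonneg_left (J.tay b a) (by positivity)).trans ?_
      have e2 : (a - b) = h * ((a - b) / h) := by field_simp
      have e3 : |h|⁻¹ * (L * (a - b) ^ 2) = L * |h| * ((a - b) / h) ^ 2 := by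
        have : h ^ 2 = |h| ^ 2 := (sq_abs h).symm
        conv_lhs => rw [e2, mul_pow, this]
        field_simp
      rw [e3]
      refine mul_le_mul_of_nonneg_left ?_ (mul_nonneg J.L0 hh.le)
      nlinarith [sq_nonneg ((a - b) / h - 2 * R x)]
    · rw [abs_mul]
      exact mul_le_of_le_one_left (abs_nonneg _) (J.b1 _)
  have iS : Integrable (fun x => L * |h| * (2 * ((ψ (t + h) x - ψ t x) / h - R x) ^ 2 + 2 * R x ^ 2)) (μT m) :=
    ((i2.const_mul 2).add (iR2.const_mul 2)).const_mul _
  refine (integral_mono (q4.sub q3).abs (iS.add i1.abs) hb).trans ?_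
  have e4 : ∫ x, (L * |h| * (2 * ((ψ (t + h) x - ψ t x) / h - R x) ^ 2 + 2 * R x ^ 2) + |(ψ (t + h) x - ψ t x) / h - R x|) ∂μT m
     = L * |h| * (2 * (∫ x, ((ψ (t + h) x - ψ t x) / h - R x) ^ 2 ∂μT m) + 2 * r) + ∫ x, |(ψ (t + h) x - ψ t x) / h - R x| ∂μT m := by
    rw [integral_add iS i1.abs, integral_const_mul, integral_add (i2.const_mul 2) (iR2.const_mul 2), integral_const_mul, integral_const_mul]
  refine (le_of_eq e4).trans ?_
  have := J.L0
  gcongr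

lemma HS.enCont (H : HS V β p T ψ) (J : JF j j1 j2 L η) : ContinuousOn (fun t => ∫ x, j (ψ t x) ∂μT m) (Ico0 T) := by
  intro t ht
  rw [Metric.continuousWithinAt_iff]
  intro ε hε
  obtain ⟨δ, hδ, h⟩ := H.contLp t ht ε hε
  refine ⟨δ, hδ, fun t' ht' hd => ?_⟩
  have := h t' ht' hd
  obtain ⟨i1, -, b1, -⟩ := lp_facts H.p2.le ((H.pi ht').2.1.sub (H.pi ht).2.1) (this.trans ENNReal.ofReal_lt_top)
  rw [Real.dist_eq, ← integral_sub (H.piJ ht' J.cj).2.2 (H.piJ ht J.cj).2.2]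
  refine abs_integral_le_integral_abs.trans_lt ?_
  refine (integral_mono ((H.piJ ht' J.cj).2.2.sub (H.piJ ht J.cj).2.2).abs i1.abs fun x => J.lip _ _).trans_lt ?_
  refine b1.trans_lt ?_
  rw [← ENNReal.toReal_ofReal hε.le]
  exact (ENNReal.toReal_lt_toReal (this.trans ENNReal.ofReal_lt_top).ne ENNReal.ofReal_ne_top).2 this

/-- dissipation inequality -/
lemma HS.diss (H : HS V β p T ψ) (J : JF j j1 j2 L η) {t : ℝ} (ht : t ∈ Ioo0 T) :
    ∫ x, j1 (ψ t x) * Rop V β (ψ t) x ∂μT m ≤ β / 4 * η * ∑ o, ∫ x, bF V (ψ t) o x ^ 2 ∂μT m := by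
  have hw := H.w2 t ht
  have hu := W2_CP1 hw
  have hpos := H.pos t ht
  have hg := gF_CP1 H.hV H.hVp hu hpos
  have hb := bF_CP1 H.hV H.hVp hu hpos
  set u := ψ t
  have hβ := H.hβ
  set w : Option (Fin m) → Spc m → ℝ := fun o x => β⁻¹ * pd (ed o) u x + gF V u o x with hw_def
  have dw : ∀ o, Differentiable ℝ (w o) := fun o => ((W2_dpd hw _).const_mul _).add (hg o).diff
  have cw : ∀ o, Continuous (w o) := fun o => (dw o).continuous
  have pw : ∀ o, Per (w o) := fun o => fun x k l => by
    simp only [hw_def, hu.1.pd (ed o) x k l, (hg o).1 x k l]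
  have epw : ∀ o, pd (ed o) (w o) = fun x => β⁻¹ * pd (ed o) (pd (ed o) u) x + pd (ed o) (gF V u o) x := by
    intro o; ext x
    rw [hw_def]
    simp only
    rw [pd_add ((W2_dpd hw _).const_mul _) (hg o).diff, pd_smul _ (W2_dpd hw _)]
  have ipw : ∀ o, PI (pd (ed o) (w o)) := fun o => by
    rw [epw]; exact ((W2_lp H.p1 hw o).1.smul _).add ((hg o).pipd _)
  have eR : ∀ x, Rop V β u x = ∑ o, pd (ed o) (w o) x := fun x => by
    rw [Rop, lap_eq, Fop_eq H.hV H.hVp hu hpos]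
    simp_rw [epw, Finset.sum_add_distrib, Finset.mul_sum]
  have cj1 : Continuous (fun x => j1 (u x)) := J.c1.comp hu.cont
  have ij : ∀ o, Integrable (fun x => j1 (u x) * pd (ed o) (w o) x) (μT m) := fun o => by
    refine (ipw o).2.2.abs.mono' (cj1.measurable.mul (ipw o).2.1).aestronglyMeasurable (ae_of_all _ fun x => ?_)
    rw [Real.norm_eq_abs, abs_mul]
    exact mul_le_of_le_one_left (abs_nonneg _) (J.b1 _)
  simp_rw [eR, Finset.mul_sum]
  rw [integral_finsetSum _ fun o _ => ij o]
  refine Finset.sum_le_sum fun o _ => ?_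
  have dj : ∀ x, HasFDerivAt (fun x => j1 (u x)) (j2 (u x) • fderiv ℝ u x) x := fun x =>
    (J.d2 (u x)).comp_hasFDerivAt x (hu.diff x).hasFDerivAt
  have epj : ∀ x, pd (ed o) (fun x => j1 (u x) * w o x) x = j2 (u x) * pd (ed o) u x * w o x + j1 (u x) * pd (ed o) (w o) x := fun x => by
    rw [pd_mul (fun x => (dj x).differentiableAt) (dw o)]
    congr 2
    unfold pd; rw [(dj x).fderiv]; rfl
  have pk : PI (fun x => j2 (u x) * pd (ed o) u x * w o x) := by
    refine PI.ofCont (fun x k l => ?_) (((J.c2.comp hu.cont).mul (hu.cpd _)).mul (cw o))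
    simp only [hu.1 x k l, hu.1.pd (ed o) x k l, pw o x k l]
  have h0 := ibp (u := fun x => j1 (u x) * w o x) (ed o)
    (PI.ofCont (fun x k l => by simp only [hu.1 x k l, pw o x k l]) (cj1.mul (cw o)))
    (fun x => (dj x).differentiableAt.mul (dw o x)) (by
      rw [show pd (ed o) (fun x => j1 (u x) * w o x) = fun x => j2 (u x) * pd (ed o) u x * w o x + j1 (u x) * pd (ed o) (w o) x from funext epj]
      refine pk.add ⟨fun x k l => ?_, cj1.measurable.mul (ipw o).2.1, ij o⟩
      simp only [hu.1 x k l, (ipw o).1 x k l])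
  simp_rw [epj] at h0
  rw [integral_add pk.2.2 (ij o)] at h0
  have h1 : ∫ x, j1 (u x) * pd (ed o) (w o) x ∂μT m = ∫ x, -(j2 (u x) * pd (ed o) u x * w o x) ∂μT m := by
    rw [integral_neg]; linarith
  rw [h1, ← integral_const_mul]
  have ib : Integrable (fun x => β / 4 * η * bF V u o x ^ 2) (μT m) :=
    (PI.ofCont (f := fun x => bF V u o x ^ 2) (fun x k l => by simp only [(hb o).1 x k l]) ((hb o).cont.pow 2)).2.2.const_mul _
  refine integral_mono pk.2.2.neg ib fun x => ?_
  simp only [hw_def, gF]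
  have n2 := J.n2 (u x)
  have q2 := J.q2 (u x)
  generalize j2 (u x) = J2 at *
  generalize pd (ed o) u x = q
  generalize bF V u o x = b
  generalize u x = r at *
  have e1 : -(J2 * q * (β⁻¹ * q + b * r)) = J2 * (β / 4 * b ^ 2 * r ^ 2) - J2 * (β⁻¹ * (q + β * b * r / 2) ^ 2) := by
    field_simp; ring
  have e2 : 0 ≤ J2 * (β⁻¹ * (q + β * b * r / 2) ^ 2) := by positivity
  rw [e1]
  have e3 : J2 * (β / 4 * b ^ 2 * r ^ 2) = β / 4 * b ^ 2 * (J2 * r ^ 2) := by ring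
  have e4 : β / 4 * b ^ 2 * (J2 * r ^ 2) ≤ β / 4 * b ^ 2 * η := mul_le_mul_of_nonneg_left q2 (by positivity)
  calc _ ≤ β / 4 * b ^ 2 * η := by linarith
    _ = _ := by ring

lemma HS.enIneq (H : HS V β p T ψ) (J : JF j j1 j2 L η) {t K : ℝ} (ht : t ∈ Ico0 T)
    (hK : ∀ s ∈ Ioo0 T, s ≤ t → β / 4 * η * ∑ o, ∫ x, bF V (ψ s) o x ^ 2 ∂μT m ≤ K) :
    ∫ x, j (ψ t x) ∂μT m ≤ ∫ x, j (ψ 0 x) ∂μT m + K * t := by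
  have hsub : Icc 0 t ⊆ Ico0 T := fun s hs => ic_mid ht hs.1 hs.2
  have := Convex.image_sub_le_mul_sub_of_deriv_le (convex_Icc 0 t) ((H.enCont J).mono hsub) (C := K) (fun s hs => by
    rw [interior_Icc] at hs
    exact (H.enDeriv J (ic_mid' ht hs.1 hs.2.le)).differentiableAt.differentiableWithinAt) (fun s hs => by
    rw [interior_Icc] at hs
    rw [(H.enDeriv J (ic_mid' ht hs.1 hs.2.le)).deriv]
    exact (H.diss J (ic_mid' ht hs.1 hs.2.le)).trans (hK s (ic_mid' ht hs.1 hs.2.le) hs.2.le)) 0 ⟨le_rfl, ht.1⟩ t ⟨ht.1, le_rfl⟩ ht.1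
  linarith

lemma HS.mass (H : HS V β p T ψ) {t : ℝ} (ht : t ∈ Ico0 T) : ∫ x, ψ t x ∂μT m = 1 := by
  have J1 : JF (fun r => r) (fun _ => 1) (fun _ => 0) 0 0 := ⟨le_rfl, fun r => hasDerivAt_id r, fun r => hasDerivAt_const r _, continuous_const,
    fun r s => by simp, fun r s => le_rfl, fun r => by simp, fun r => le_rfl, fun r => by simp⟩
  have J2 : JF (fun r => -r) (fun _ => -1) (fun _ => 0) 0 0 := ⟨le_rfl, fun r => (hasDerivAt_id r).neg, fun r => hasDerivAt_const r _, continuous_const,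
    fun r s => by simp; ring, fun r s => by rw [← abs_neg]; exact le_of_eq (by congr 1; ring), fun r => by simp, fun r => le_rfl, fun r => by simp⟩
  have h1 := H.enIneq J1 (K := 0) ht (fun s _ _ => by simp)
  have h2 := H.enIneq J2 (K := 0) ht (fun s _ _ => by simp)
  rw [integral_neg, integral_neg] at h2
  have h3 : ∫ x, ψ 0 x ∂μT m = 1 := H.mass0
  linarith

lemma JFe {ε : ℝ} (hε : 0 < ε) : JF (fun r => √(r ^ 2 + ε ^ 2)) (fun r => r / √(r ^ 2 + ε ^ 2))
    (fun r => ε ^ 2 / (√(r ^ 2 + ε ^ 2)) ^ 3) (1 / ε) ε := by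
  have hs : ∀ r : ℝ, 0 < r ^ 2 + ε ^ 2 := fun r => by positivity
  have hS : ∀ r : ℝ, 0 < √(r ^ 2 + ε ^ 2) := fun r => Real.sqrt_pos.2 (hs r)
  have hSq : ∀ r : ℝ, √(r ^ 2 + ε ^ 2) ^ 2 = r ^ 2 + ε ^ 2 := fun r => Real.sq_sqrt (hs r).le
  have hSe : ∀ r : ℝ, ε ≤ √(r ^ 2 + ε ^ 2) := fun r => Real.le_sqrt_of_sq_le (by nlinarith)
  have hSr : ∀ r : ℝ, |r| ≤ √(r ^ 2 + ε ^ 2) := fun r => Real.abs_le_sqrt (by nlinarith)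
  have hd : ∀ r : ℝ, HasDerivAt (fun r => √(r ^ 2 + ε ^ 2)) (r / √(r ^ 2 + ε ^ 2)) r := fun r => by
    have := (((hasDerivAt_id' r).fun_pow 2).add_const (ε ^ 2)).sqrt (hs r).ne'
    refine this.congr_deriv ?_
    have := hS r
    field_simp
    norm_num
  refine ⟨by positivity, hd, fun r => ?_, ?_, fun r s => ?_, fun r s => ?_, fun r => ?_, fun r => by positivity, fun r => ?_⟩
  · have := (hasDerivAt_id' r).fun_div (hd r) (hS r).ne'
    refine this.congr_deriv ?_
    have h1 := hSq r; have h2 := hS r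
    field_simp
    linarith
  · have : ∀ r : ℝ, √(r ^ 2 + ε ^ 2) ^ 3 ≠ 0 := fun r => (pow_pos (hS r) 3).ne'
    fun_prop (disch := assumption)
  · have h1 := hSq r; have h2 := hS r; have h3 := hSq s; have h4 := hS s
    have h5 := hSe r; have h6 := hSe s
    set A := √(r ^ 2 + ε ^ 2); set B := √(s ^ 2 + ε ^ 2)
    have hAB : (A * B - (r * s + ε ^ 2)) * (A * B + (r * s + ε ^ 2)) = ε ^ 2 * (s - r) ^ 2 := by
      have : A * B * (A * B) = (r ^ 2 + ε ^ 2) * (s ^ 2 + ε ^ 2) := by rw [← h1, ← h3]; ring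
      nlinarith
    have hk : |r * s + ε ^ 2| ≤ A * B := abs_le_of_sq_le_sq (by nlinarith [mul_pow A B 2, sq_nonneg (ε * (s - r))]) (by positivity)
    have hk' := abs_le.1 hk
    have e : B - A - r / A * (s - r) = (A * B - (r * s + ε ^ 2)) / A := by
      field_simp; nlinarith
    rw [e, abs_of_nonneg (div_nonneg (by linarith) h2.le), div_le_iff₀ h2]
    have h7 : A * B - (r * s + ε ^ 2) ≤ (s - r) ^ 2 := by
      nlinarith [sq_nonneg (A - B)]
    refine h7.trans ?_
    rw [one_div, mul_assoc, mul_comm ((s - r) ^ 2), ← mul_assoc, inv_mul_eq_div]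
    exact le_mul_of_one_le_left (sq_nonneg _) ((one_le_div hε).2 h5)
  · have := Convex.norm_image_sub_le_of_norm_hasDerivWithin_le (f := fun r => √(r ^ 2 + ε ^ 2)) (s := univ) (C := 1) (x := r) (y := s)
      (fun x _ => (hd x).hasDerivWithinAt) (fun x _ => by
        rw [Real.norm_eq_abs, abs_div, abs_of_pos (hS x)]; exact (div_le_one (hS x)).2 (hSr x)) convex_univ trivial trivial
    simpa using this
  · rw [abs_div, abs_of_pos (hS r)]; exact (div_le_one (hS r)).2 (hSr r)
  · have h1 := hSq r; have h2 := hS r; have h5 := hSe r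
    set A := √(r ^ 2 + ε ^ 2)
    rw [div_mul_eq_mul_div, div_le_iff₀ (by positivity)]
    have : r ^ 2 ≤ A ^ 2 := by nlinarith
    calc ε ^ 2 * r ^ 2 ≤ ε ^ 2 * A ^ 2 := by gcongr
      _ = ε * (ε * A ^ 2) := by ring
      _ ≤ ε * (A * A ^ 2) := by gcongr
      _ = ε * A ^ 3 := by ring
end

lemma cube_cl (m : ℕ) : cube m ⊆ closure (interior (cube m)) := by
  have h1 : interior (cube m) = Ioo (0:ℝ) 1 ×ˢ Set.pi univ fun _ : Fin m => Ioo (0:ℝ) 1 := by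
    rw [cube, interior_prod_eq, cube1, interior_pi_set finite_univ]; simp
  rw [h1, closure_prod_eq, closure_pi_set, closure_Ioo (by norm_num)]
  intro x hx
  exact ⟨⟨hx.1.1, hx.1.2.le⟩, fun i _ => ⟨(hx.2 i trivial).1, (hx.2 i trivial).2.le⟩⟩

section
variable {m : ℕ} {V : Spc m → ℝ} {β p : ℝ} {T : ℝ≥0∞} {ψ : ℝ → Spc m → ℝ}

lemma HS.lpBd (H : HS V β p T ψ) {t1 : ℝ} (ht : t1 ∈ Ico0 T) : ∃ N : ℝ, 0 ≤ N ∧ ∀ s ∈ Icc 0 t1, LpN p (ψ s) ≤ ENNReal.ofReal N := by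
  refine (isCompact_Icc (a := (0:ℝ)) (b := t1)).induction_on (p := fun S => ∃ N : ℝ, 0 ≤ N ∧ ∀ s ∈ S, LpN p (ψ s) ≤ ENNReal.ofReal N) ?_ ?_ ?_ ?_
  · exact ⟨0, le_rfl, fun s hs => hs.elim⟩
  · rintro S S' hS ⟨N, h0, hN⟩; exact ⟨N, h0, fun s hs => hN s (hS hs)⟩
  · rintro S S' ⟨N, h0, hN⟩ ⟨N', h0', hN'⟩
    refine ⟨max N N', le_max_of_le_left h0, fun s hs => ?_⟩
    rcases hs with hs | hs
    · exact (hN s hs).trans (ENNReal.ofReal_le_ofReal (le_max_left _ _))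
    · exact (hN' s hs).trans (ENNReal.ofReal_le_ofReal (le_max_right _ _))
  · intro s hs
    have hs' := ic_mid ht hs.1 hs.2
    obtain ⟨δ, hδ, h⟩ := H.contLp s hs' 1 one_pos
    refine ⟨Icc 0 t1 ∩ Metric.ball s δ, inter_mem_nhdsWithin _ (Metric.ball_mem_nhds s hδ), 1 + (LpN p (ψ s)).toReal, by positivity, fun s' hs1 => ?_⟩
    have hs1' := ic_mid ht hs1.1.1 hs1.1.2
    have h1 := h s' hs1' hs1.2
    have h2 := LpN_add H.p1 ((H.pi hs1').2.1.sub (H.pi hs').2.1) (H.pi hs').2.1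
    have e : (fun x => (ψ s' x - ψ s x) + ψ s x) = ψ s' := by ext; ring
    simp only [Pi.sub_apply] at h2
    rw [e] at h2
    rw [ENNReal.ofReal_add one_pos.le ENNReal.toReal_nonneg, ENNReal.ofReal_toReal (H.lpψ hs').ne]
    exact h2.trans (add_le_add h1.le le_rfl)

lemma HS.VB (H : HS V β p T ψ) : ∃ B : ℝ, 0 < B ∧ (∀ o x, |pd (ed o) V x| ≤ B) := by
  have : ∀ o : Option (Fin m), ∃ M : ℝ, 0 ≤ M ∧ ∀ x, |pd (ed o) V x| ≤ M := fun o => per_bdd (H.hVp.pd _) (pdV_CP1 H.hV H.hVp _).cont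
  choose M h0 hM using this
  refine ⟨1 + ∑ o, M o, by have := Finset.sum_nonneg (s := Finset.univ) (fun o _ => h0 o); linarith, fun o x => (hM o x).trans ?_⟩
  have := Finset.single_le_sum (f := M) (fun o _ => h0 o) (Finset.mem_univ o)
  linarith

lemma slice_int {f : Spc m → ℝ} (hf : Per f) (hc : Continuous f) (x : ℝ) : Integrable (fun y => f (x, y)) (volume.restrict (cube1 m)) := by
  obtain ⟨M, h0, hM⟩ := per_bdd hf hc
  exact (integrable_const M).mono' (by fun_prop : Continuous fun y => f (x, y)).aestronglyMeasurable (ae_of_all _ fun y => hM _)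

lemma phi_le {u : Spc m → ℝ} {B : ℝ} (hB : ∀ x, |pd (e1 m) V x| ≤ B) (hu : Per u) (hc : Continuous u) (x : ℝ) (hpos : 0 < marg u x) :
    |phiF V u x| ≤ B * margX (fun z => |u z|) (x, 0) / marg u x := by
  unfold phiF
  rw [abs_div, abs_of_pos hpos]
  refine div_le_div_of_nonneg_right ?_ hpos.le
  refine abs_integral_le_integral_abs.trans ?_
  unfold margX marg
  rw [← integral_const_mul]
  refine integral_mono_of_nonneg (ae_of_all _ fun y => abs_nonneg _) ((slice_int (hu.comp' abs) hc.abs x).const_mul B) (ae_of_all _ fun y => ?_)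
  simp only [abs_mul]
  exact mul_le_mul_of_nonneg_right (hB _) (abs_nonneg _)

lemma HS.b2 (H : HS V β p T ψ) {t1 : ℝ} (ht : t1 ∈ Ico0 T) : ∃ K : ℝ, 0 ≤ K ∧ ∀ s ∈ Ioo0 T, s ≤ t1 →
    ∑ o, ∫ x, bF V (ψ s) o x ^ 2 ∂μT m ≤ K := by
  obtain ⟨N, hN0, hN⟩ := H.lpBd ht
  obtain ⟨B, hB0, hB⟩ := H.VB
  obtain ⟨c, hc, hlow⟩ := H.low
  refine ⟨∑ o : Option (Fin m), (2 * B ^ 2 + 2 * ((B / c) ^ 2 * N ^ 2)), Finset.sum_nonneg fun _ _ => by positivity, fun s hs hst => Finset.sum_le_sum fun o _ => ?_⟩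
  have hs' := io_sub hs
  have hpa : PI (fun z => |ψ s z|) := PI.ofCont ((H.per hs').comp' abs) (H.cont hs').abs
  have hm := hpa.margX
  have hl : LpN p (margX fun z => |ψ s z|) ≤ ENNReal.ofReal N := by
    refine (margX_jensen H.p1 hpa.2.1).trans (le_trans (le_of_eq ?_) (hN s ⟨hs.1.le, hst⟩))
    exact eLpNorm_norm (ψ s)
  obtain ⟨-, i2, -, b2⟩ := lp_facts H.p2.le hm.2.1 (hl.trans_lt ENNReal.ofReal_lt_top)
  have hN' : (LpN p (margX fun z => |ψ s z|)).toReal ≤ N := by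
    rw [← ENNReal.toReal_ofReal hN0]; exact ENNReal.toReal_mono ENNReal.ofReal_ne_top hl
  have hb : ∀ x, bF V (ψ s) o x ^ 2 ≤ 2 * B ^ 2 + 2 * ((B / c) ^ 2 * margX (fun z => |ψ s z|) x ^ 2) := by
    intro x
    have h1 : pd (ed o) V x ^ 2 ≤ B ^ 2 := sq_le_sq' (by linarith [(abs_le.1 (hB o x)).1]) (abs_le.1 (hB o x)).2
    have h2 : (if o = none then phiF V (ψ s) x.1 else 0) ^ 2 ≤ (B / c) ^ 2 * margX (fun z => |ψ s z|) x ^ 2 := by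
      split_ifs
      · rw [← mul_pow, ← sq_abs]
        refine pow_le_pow_left₀ (abs_nonneg _) ((phi_le (hB none) (H.per hs') (H.cont hs') x.1 (H.posm hs' _)).trans ?_) 2
        have hnn : 0 ≤ margX (fun z => |ψ s z|) x := integral_nonneg fun y => abs_nonneg _
        rw [div_mul_eq_mul_div]
        exact div_le_div_of_nonneg_left (mul_nonneg hB0.le hnn) hc (hlow s hs' _)
      · simp; positivity
    unfold bF
    nlinarith [sq_nonneg (pd (ed o) V x + (if o = none then phiF V (ψ s) x.1 else 0))]
  have ig : Integrable (fun x => 2 * B ^ 2 + 2 * ((B / c) ^ 2 * margX (fun z => |ψ s z|) x ^ 2)) (μT m) :=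
    (integrable_const _).add ((i2.const_mul _).const_mul _)
  refine (integral_mono_of_nonneg (ae_of_all _ fun x => sq_nonneg _) ig (ae_of_all _ hb)).trans ?_
  rw [integral_add (integrable_const _) ((i2.const_mul _).const_mul _), integral_const_mul, integral_const_mul]
  simp only [integral_const, probReal_univ, one_smul]
  have := b2.trans (pow_le_pow_left₀ ENNReal.toReal_nonneg hN' 2)
  have h9 : ∫ a, (B / c) ^ 2 * margX (fun z => |ψ s z|) a ^ 2 ∂μT m ≤ (B / c) ^ 2 * N ^ 2 := by
    rw [integral_const_mul]
    exact mul_le_mul_of_nonneg_left this (sq_nonneg _)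
  linarith

lemma HS.l1 (H : HS V β p T ψ) {t : ℝ} (ht : t ∈ Ico0 T) : ∫ x, |ψ t x| ∂μT m ≤ 1 := by
  obtain ⟨K, hK0, hK⟩ := H.b2 ht
  have hβ := H.hβ
  have key : ∀ ε : ℝ, 0 < ε → ∫ x, |ψ t x| ∂μT m ≤ 1 + ε * (1 + β / 4 * K * t) := by
    intro ε hε
    have h := H.enIneq (JFe hε) (K := β / 4 * ε * K) ht (fun s hs hst => mul_le_mul_of_nonneg_left (hK s hs hst) (by positivity))
    have h1 : ∫ x, |ψ t x| ∂μT m ≤ ∫ x, √(ψ t x ^ 2 + ε ^ 2) ∂μT m :=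
      integral_mono (H.piJ ht continuous_abs).2.2 (H.piJ ht (JFe hε).cj).2.2 fun x => Real.abs_le_sqrt (by nlinarith)
    have h0 : (0:ℝ) ∈ Ico0 T := ic_mid ht le_rfl ht.1
    have h2 : ∫ x, √(ψ 0 x ^ 2 + ε ^ 2) ∂μT m ≤ ∫ x, (ψ 0 x + ε) ∂μT m :=
      integral_mono (H.piJ h0 (JFe hε).cj).2.2 ((H.pi h0).2.2.add (integrable_const _)) fun x => by
        have := H.nn0 x
        exact Real.sqrt_le_iff.2 ⟨by positivity, by nlinarith⟩
    rw [integral_add (H.pi h0).2.2 (integrable_const _), H.mass h0] at h2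
    simp only [integral_const, probReal_univ, one_smul] at h2
    calc _ ≤ _ := h1
      _ ≤ _ := h
      _ ≤ 1 + ε + β / 4 * ε * K * t := by linarith
      _ = _ := by ring
  refine le_of_forall_pos_le_add fun δ hδ => ?_
  have hq : 0 < 1 + β / 4 * K * t := by have := ht.1; positivity
  have := key (δ / (1 + β / 4 * K * t)) (by positivity)
  rwa [div_mul_cancel₀ _ hq.ne'] at this

lemma HS.nn (H : HS V β p T ψ) {t : ℝ} (ht : t ∈ Ico0 T) (x : Spc m) : 0 ≤ ψ t x := by
  have i1 := H.piJ ht continuous_abs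
  have h0 : ∫ x, (|ψ t x| - ψ t x) ∂μT m = 0 := by
    refine le_antisymm ?_ (integral_nonneg fun x => sub_nonneg.2 (le_abs_self _))
    rw [integral_sub i1.2.2 (H.pi ht).2.2, H.mass ht]
    linarith [H.l1 ht]
  rw [integral_eq_zero_iff_of_nonneg (fun x => sub_nonneg.2 (le_abs_self _)) (i1.2.2.sub (H.pi ht).2.2)] at h0
  have h1 := Measure.eqOn_of_ae_eq (μ := volume) (s := cube m) (f := fun x => |ψ t x| - ψ t x) (g := fun _ => (0:ℝ)) h0
    ((H.cont ht).abs.sub (H.cont ht)).continuousOn continuousOn_const (cube_cl m)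
  obtain ⟨y, hy, e⟩ := (H.per ht).red x
  rw [← e]
  have := h1 hy
  simp only at this
  have := abs_nonneg (ψ t y)
  linarith

/-- uniform bound of the drift -/
lemma HS.bB (H : HS V β p T ψ) : ∃ B : ℝ, 0 < B ∧ (∀ t ∈ Ico0 T, ∀ o x, |bF V (ψ t) o x| ≤ B) := by
  obtain ⟨B, hB0, hB⟩ := H.VB
  refine ⟨2 * B, by positivity, fun t ht o x => ?_⟩
  unfold bF
  refine (abs_sub _ _).trans ?_
  have : |if o = none then phiF V (ψ t) x.1 else 0| ≤ B := by
    split_ifs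
    · refine (phi_le (hB none) (H.per ht) (H.cont ht) x.1 (H.posm ht _)).trans ?_
      have : margX (fun z => |ψ t z|) (x.1, 0) = marg (ψ t) x.1 := by
        unfold margX marg; simp_rw [abs_of_nonneg (H.nn ht _)]
      rw [this, mul_div_assoc, div_self (H.posm ht _).ne', mul_one]
    · simpa using hB0.le
  linarith [hB o x]

lemma HS.lp1 (H : HS V β p T ψ) {t : ℝ} (ht : t ∈ Ico0 T) : LpN 1 (ψ t) ≤ ENNReal.ofReal 1 := by
  unfold LpN
  rw [ENNReal.ofReal_one, eLpNorm_one_eq_lintegral_enorm, ← ENNReal.ofReal_one]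
  refine ENNReal.le_ofReal_iff_toReal_le ?_ one_pos.le |>.2 ?_
  · exact (H.pi ht).2.2.2.ne
  · rw [← integral_norm_eq_lintegral_enorm (H.pi ht).2.2.1]; exact H.l1 ht
end

def KK (m : ℕ) : ℝ := 2 ^ 15 * (m + 1) ^ 2 * CH m
lemma KK_pos (m : ℕ) : 0 < KK m := by have := CH_pos m; unfold KK; positivity

section
variable {m : ℕ} {V : Spc m → ℝ} {β p : ℝ} {T : ℝ≥0∞} {ψ : ℝ → Spc m → ℝ}

lemma k0_sup {a M : ℝ} (ha : 0 < a) {f : Spc m → ℝ} (x : Spc m) (hf : ∀ z, |f z| ≤ M) : |cv (Gk a) f x| ≤ KK m * M := by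
  have h := cv_sup ha (k0' ha) x hf
  have hM : 0 ≤ M := (abs_nonneg _).trans (hf 0)
  refine h.trans (mul_le_mul_of_nonneg_right ?_ hM)
  have := CH_pos m
  unfold KK
  have : (1:ℝ) ≤ ((m:ℝ) + 1) ^ 2 := by have : (0:ℝ) ≤ m := m.cast_nonneg; nlinarith
  calc 2 ^ 15 * CH m = 2 ^ 15 * 1 * CH m := by ring
    _ ≤ _ := by gcongr

lemma k1_sup {a M : ℝ} (ha : 0 < a) {f : Spc m → ℝ} (v x : Spc m) (hf : ∀ z, |f z| ≤ M) :
    |cv (G1 a v) f x| ≤ KK m * ‖v‖ * a ^ (-(1/2) : ℝ) * M := by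
  have h := cv_sup ha (k1 ha v) x hf
  have hM : 0 ≤ M := (abs_nonneg _).trans (hf 0)
  refine h.trans (mul_le_mul_of_nonneg_right ?_ hM)
  have := CH_pos m
  unfold KK
  have : (m:ℝ) + 1 ≤ ((m:ℝ) + 1) ^ 2 := by have : (0:ℝ) ≤ m := m.cast_nonneg; nlinarith
  calc 2 ^ 15 * ((m:ℝ) + 1) * ‖v‖ * a ^ (-(1/2) : ℝ) * CH m = 2 ^ 15 * ((m:ℝ) + 1) * CH m * ‖v‖ * a ^ (-(1/2) : ℝ) := by ring
    _ ≤ _ := by gcongr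

lemma k2_sup {a M : ℝ} (ha : 0 < a) {f : Spc m → ℝ} (v w x : Spc m) (hf : ∀ z, |f z| ≤ M) :
    |cv (G2 a v w) f x| ≤ KK m * ‖v‖ * ‖w‖ * a ^ (-1 : ℝ) * M := by
  refine (cv_sup ha (k2' ha v w) x hf).trans (le_of_eq ?_)
  unfold KK; ring

lemma mvt {F F' : ℝ → ℝ} {L : ℝ} (hd : ∀ u, HasDerivAt F (F' u) u) (hL : ∀ u, |F' u| ≤ L) (h : ℝ) : |F h - F 0| ≤ L * |h| := by
  have := Convex.norm_image_sub_le_of_norm_hasDerivWithin_le (f := F) (f' := F') (C := L) (s := univ) (x := 0) (y := h)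
    (fun u _ => (hd u).hasDerivWithinAt) (fun u _ => hL u) convex_univ trivial trivial
  simpa using this

lemma interp {A P Q θ : ℝ} (hA : 0 ≤ A) (h0 : 0 ≤ θ) (h1 : θ ≤ 1) (hP : A ≤ P) (hQ : A ≤ Q) : A ≤ P ^ (1 - θ) * Q ^ θ := by
  calc A = A ^ (1 - θ) * A ^ θ := by
        rcases hA.eq_or_lt with rfl | h
        · rcases h0.eq_or_lt with rfl | h0
          · simp
          · rw [Real.zero_rpow h0.ne', mul_zero]
        · rw [← Real.rpow_add h]; simp
    _ ≤ _ := by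
      have : 0 ≤ 1 - θ := by linarith
      exact mul_le_mul (Real.rpow_le_rpow hA hP this) (Real.rpow_le_rpow hA hQ h0) (by positivity) (Real.rpow_nonneg (hA.trans hP) _)

/-- Duhamel estimate with componentwise bounds -/
lemma HS.duhX (H : HS V β p T ψ) {s t : ℝ} (hs : s ∈ Ico0 T) (ht : t ∈ Ico0 T)
    (hst : s < t) (hb : t - s ≤ β) {ι : Type*} [Fintype ι] (c : ι → ℝ) (y : ι → Spc m) {K γ : ℝ} (hγ : 0 < γ)
    (hK : ∀ r ∈ Ioo s t, ∀ a, 0 < a → a ≤ 1 → a = (t - r) / β → ∀ o, |∑ i, c i * cv (G1 a (ed o)) (gF V (ψ r) o) (y i)| ≤ K * a ^ (γ - 1)) :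
    |∑ i, c i * ψ t (y i) - ∑ i, c i * cv (Gk ((t - s) / β)) (ψ s) (y i)| ≤ ((m + 1) * β ^ (1 - γ) / γ) * K * (t - s) ^ γ := by
  have hβ := H.hβ
  have := H.sol.duh H.hβ H.p1 H.pm hs ht hst hb c y (K := (m + 1) * β ^ (1 - γ) * K) hγ (fun r hr => ?_)
  · refine this.trans (le_of_eq ?_); ring
  · have ha : 0 < (t - r) / β := div_pos (by linarith [hr.2]) hβ
    have ha1 : (t - r) / β ≤ 1 := (div_le_one hβ).2 (by linarith [hr.1])
    have e : ∑ i, c i * ∑ o, cv (G1 ((t - r) / β) (ed o)) (gF V (ψ r) o) (y i)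
        = ∑ o, ∑ i, c i * cv (G1 ((t - r) / β) (ed o)) (gF V (ψ r) o) (y i) := by
      simp_rw [Finset.mul_sum]; exact Finset.sum_comm
    rw [e]
    refine (Finset.abs_sum_le_sum_abs _ _).trans ((Finset.sum_le_sum fun o _ => hK r hr _ ha ha1 rfl o).trans ?_)
    rw [Finset.sum_const, Finset.card_univ, Fintype.card_option, Fintype.card_fin, nsmul_eq_mul, Real.div_rpow (by linarith [hr.2]) hβ.le,
      show (1:ℝ) - γ = -(γ - 1) by ring, Real.rpow_neg hβ.le]
    push_cast
    refine le_of_eq ?_; ring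

lemma HS.duh1 (H : HS V β p T ψ) {s t : ℝ} (hs : s ∈ Ico0 T) (ht : t ∈ Ico0 T)
    (hst : s < t) (hb : t - s ≤ β) (x : Spc m) {K γ : ℝ} (hγ : 0 < γ)
    (hK : ∀ r ∈ Ioo s t, ∀ a, 0 < a → a ≤ 1 → a = (t - r) / β → ∀ o, |cv (G1 a (ed o)) (gF V (ψ r) o) x| ≤ K * a ^ (γ - 1)) :
    |ψ t x - cv (Gk ((t - s) / β)) (ψ s) x| ≤ ((m + 1) * β ^ (1 - γ) / γ) * K * (t - s) ^ γ := by
  have := H.duhX hs ht hst hb (ι := Unit) (fun _ => 1) (fun _ => x) hγ (K := K) (by simpa using hK)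
  simpa using this

lemma HS.gPI (H : HS V β p T ψ) {t : ℝ} (ht : t ∈ Ioo0 T) (o) : PI (gF V (ψ t) o) :=
  (gF_CP1 H.hV H.hVp (W2_CP1 (H.w2 t ht)) (H.pos t ht) o).pi

/-- starting time of a window of length `δ` -/
lemma start {T : ℝ≥0∞} {t δ : ℝ} (ht : t ∈ Ico0 T) (h0 : 0 < t) (hδ : 0 < δ) : ∃ s ∈ Ico0 T, s < t ∧ t - s ≤ δ ∧ (s = 0 ∨ t - s = δ) := by
  by_cases h : t ≤ δ
  · exact ⟨0, ic_mid ht le_rfl h0.le, h0, by linarith, Or.inl rfl⟩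
  · exact ⟨t - δ, ic_mid ht (by linarith) (by linarith), by linarith, by linarith, Or.inr (by ring)⟩

/-- local boundedness -/
lemma HS.c0 (H : HS V β p T ψ) {t1 : ℝ} (ht1 : t1 ∈ Ico0 T) : ∃ M : ℝ, ∀ t ∈ Icc 0 t1, ∀ x, |ψ t x| ≤ M := by
  have hβ := H.hβ
  obtain ⟨N, hN0, hN⟩ := H.lpBd ht1
  obtain ⟨B, hB0, hB⟩ := H.bB
  obtain ⟨M0, hM0, hM⟩ := per_bdd H.per0 H.cont0
  obtain ⟨C, hC, hLp⟩ := LpBr m H.p1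
  have hp0 : 0 < p := by linarith [H.p1]
  set γ : ℝ := 1 / 2 - ((m:ℝ) + 1) / (2 * p) with hγ
  have hγ0 : 0 < γ := by
    have : ((m:ℝ) + 1) / (2 * p) < 1 / 2 := by rw [div_lt_div_iff₀ (by positivity) (by norm_num)]; linarith [H.hp]
    linarith
  set K := 2 ^ 15 * ((m:ℝ) + 1) * C * (B * N) with hK
  refine ⟨M0 + ((m + 1) * β ^ (1 - γ) / γ) * K * β ^ γ + (KK m * M0 + 2 ^ 15 * C * N), fun t ht x => ?_⟩
  have hKK := KK_pos m
  have ht' : t ∈ Ico0 T := ic_mid ht1 ht.1 ht.2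
  have q1 : 0 ≤ ((m + 1) * β ^ (1 - γ) / γ) * K * β ^ γ := by positivity
  have q2 : 0 ≤ KK m * M0 + 2 ^ 15 * C * N := by positivity
  rcases ht.1.eq_or_lt with rfl | h0
  · linarith [hM x]
  obtain ⟨s, hs, hst, hsb, hcase⟩ := start ht' h0 hβ
  have hD := H.duh1 hs ht' hst hsb x (K := K) hγ0 (fun r hr a ha ha1 _ o => ?_)
  · have hD2 : ((m + 1) * β ^ (1 - γ) / γ) * K * (t - s) ^ γ ≤ ((m + 1) * β ^ (1 - γ) / γ) * K * β ^ γ := by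
      gcongr
    have hbase : |cv (Gk ((t - s) / β)) (ψ s) x| ≤ KK m * M0 + 2 ^ 15 * C * N := by
      rcases hcase with rfl | hc
      · have : 0 ≤ 2 ^ 15 * C * N := by positivity
        linarith [k0_sup (div_pos (sub_pos.2 hst) hβ) x hM]
      · rw [hc, div_self hβ.ne']
        have := hLp (Gk 1) (ψ s) 1 (2 ^ 15) N x (H.per hs) (H.cont hs).measurable one_pos le_rfl (by norm_num) (k0' one_pos) (hN s ⟨hs.1, by linarith [ht.2]⟩) hN0
        rw [Real.one_rpow] at this
        have : 0 ≤ KK m * M0 := by positivity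
        linarith
    have := abs_sub_abs_le_abs_sub (ψ t x) (cv (Gk ((t - s) / β)) (ψ s) x)
    linarith
  · have hr' : r ∈ Ioo0 T := ic_mid' ht' (by linarith [hr.1, hs.1]) hr.2.le
    have hg := H.gPI hr' o
    have hgl : LpN p (gF V (ψ r) o) ≤ ENNReal.ofReal (B * N) := by
      rw [ENNReal.ofReal_mul hB0.le]
      refine (eLpNorm_le_mul_eLpNorm_of_ae_le_mul (g := ψ r) (c := B) (ae_of_all _ fun z => ?_) _).trans (mul_le_mul' le_rfl (hN r ⟨hr'.1.le, by linarith [hr.2, ht.2]⟩))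
      rw [gF, norm_mul]
      exact mul_le_mul_of_nonneg_right (hB r (io_sub hr') o z) (norm_nonneg _)
    have := hLp (G1 a (ed o)) (gF V (ψ r) o) a (2 ^ 15 * (m + 1) * ‖ed o‖ * a ^ (-(1/2) : ℝ)) (B * N) x hg.1 hg.2.1 ha ha1 (by positivity) (k1 ha _) hgl (by positivity)
    refine this.trans (le_of_eq ?_)
    rw [norm_ed, hK, show γ - 1 = -(1/2) + -(((m:ℝ) + 1) / (2 * p)) by rw [hγ]; ring, Real.rpow_add ha]
    ring

/-- global boundedness -/
lemma HS.c1 (H : HS V β p T ψ) : ∃ M : ℝ, 0 < M ∧ ∀ t ∈ Ico0 T, ∀ x, |ψ t x| ≤ M := by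
  have hβ := H.hβ
  obtain ⟨B, hB0, hB⟩ := H.bB
  obtain ⟨M0, hM0, hM⟩ := per_bdd H.per0 H.cont0
  obtain ⟨C, hC, hLp⟩ := LpBr m (le_refl (1:ℝ))
  have hKK := KK_pos m
  set E := (((m:ℝ) + 1) * β ^ (1 - (1/2:ℝ)) / (1/2)) * (KK m * B) with hE
  have hE0 : 0 < E := by positivity
  set δ := min β ((2 * E) ^ (-2 : ℝ)) with hδ
  have hδ0 : 0 < δ := lt_min hβ (by positivity)
  have hδE : E * δ ^ (1/2 : ℝ) ≤ 1 / 2 := by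
    have : δ ^ (1/2 : ℝ) ≤ (2 * E)⁻¹ := by
      calc δ ^ (1/2 : ℝ) ≤ ((2 * E) ^ (-2 : ℝ)) ^ (1/2 : ℝ) := by gcongr; exact min_le_right _ _
        _ = _ := by rw [← Real.rpow_mul (by positivity)]; rw [show (-2:ℝ) * (1/2) = -1 by norm_num, Real.rpow_neg_one]
    calc E * δ ^ (1/2 : ℝ) ≤ E * (2 * E)⁻¹ := by gcongr
      _ = 1 / 2 := by field_simp
  set q := M0 + KK m * M0 + 2 ^ 15 * C * (δ / β) ^ (-(((m:ℝ) + 1) / (2 * 1))) * 1 with hq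
  have hq0 : 0 < q := by positivity
  refine ⟨2 * q, by positivity, fun t1 ht1 x1 => ?_⟩
  obtain ⟨Ml, hMl⟩ := H.c0 ht1
  set S : Set ℝ := {r | ∃ t ∈ Icc 0 t1, ∃ x, r = |ψ t x|} with hS
  have hbd : BddAbove S := ⟨Ml, by rintro _ ⟨t, ht, x, rfl⟩; exact hMl t ht x⟩
  have hle : ∀ t ∈ Icc 0 t1, ∀ x, |ψ t x| ≤ sSup S := fun t ht x => le_csSup hbd ⟨t, ht, x, rfl⟩
  have hmem : |ψ t1 x1| ∈ S := ⟨t1, ⟨ht1.1, le_rfl⟩, x1, rfl⟩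
  have h0S : 0 ≤ sSup S := (abs_nonneg _).trans (le_csSup hbd hmem)
  have key : sSup S ≤ q + sSup S / 2 := by
    refine csSup_le ⟨_, hmem⟩ ?_
    rintro _ ⟨t, ht, x, rfl⟩
    have ht' : t ∈ Ico0 T := ic_mid ht1 ht.1 ht.2
    have hq1 : 0 ≤ 2 ^ 15 * C * (δ / β) ^ (-(((m:ℝ) + 1) / (2 * 1))) * 1 := by positivity
    have hq2 : 0 ≤ KK m * M0 := by positivity
    rcases ht.1.eq_or_lt with rfl | h0
    · have := hM x; linarith
    obtain ⟨s, hs, hst, hsb, hcase⟩ := start ht' h0 hδ0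
    have hD := H.duh1 hs ht' hst (hsb.trans (min_le_left _ _)) x (K := KK m * (B * sSup S)) (γ := 1/2) (by norm_num) (fun r hr a ha ha1 _ o => ?_)
    · have hD2 : (((m:ℝ) + 1) * β ^ (1 - (1/2:ℝ)) / (1/2)) * (KK m * (B * sSup S)) * (t - s) ^ (1/2:ℝ) ≤ sSup S / 2 := by
        calc _ = E * (t - s) ^ (1/2:ℝ) * sSup S := by rw [hE]; ring
          _ ≤ E * δ ^ (1/2:ℝ) * sSup S := by
            have : 0 ≤ t - s := by linarith
            gcongr
          _ ≤ 1 / 2 * sSup S := by gcongr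
          _ = _ := by ring
      have hbase : |cv (Gk ((t - s) / β)) (ψ s) x| ≤ q := by
        rcases hcase with rfl | hc
        · linarith [k0_sup (div_pos (sub_pos.2 hst) hβ) x hM]
        · rw [hc]
          have := hLp (Gk (δ / β)) (ψ s) (δ / β) (2 ^ 15) 1 x (H.per hs) (H.cont hs).measurable (by positivity) ((div_le_one hβ).2 (min_le_left _ _)) (by norm_num) (k0' (by positivity)) (H.lp1 hs) one_pos.le
          linarith
      have := abs_sub_abs_le_abs_sub (ψ t x) (cv (Gk ((t - s) / β)) (ψ s) x)
      linarith
    · have hr' : r ∈ Ioo0 T := ic_mid' ht' (by linarith [hr.1, hs.1]) hr.2.le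
      have := k1_sup ha (ed o) x (f := gF V (ψ r) o) (M := B * sSup S) (fun z => by
        rw [gF, abs_mul]
        exact mul_le_mul (hB r (io_sub hr') o z) (hle r ⟨hr'.1.le, by linarith [hr.2, ht.2]⟩ z) (abs_nonneg _) hB0.le)
      rw [norm_ed] at this
      refine this.trans (le_of_eq ?_)
      rw [show (1/2:ℝ) - 1 = -(1/2) by norm_num]; ring
  have := le_csSup hbd hmem
  linarith
end

def Hd {m : ℕ} (θ A : ℝ) (f : Spc m → ℝ) : Prop := ∀ x y, |f x - f y| ≤ A * ‖x - y‖ ^ θ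
def Mx {m : ℕ} (κ A : ℝ) (f : Spc m → ℝ) : Prop := ∀ (o : Option (Fin m)) (h : ℝ) (x v : Spc m),
  |f (x + h • ed o) - f x - (f (x + v + h • ed o) - f (x + v))| ≤ A * |h| * ‖v‖ ^ κ

section
variable {m : ℕ} {V : Spc m → ℝ} {β p : ℝ} {T : ℝ≥0∞} {ψ : ℝ → Spc m → ℝ}

lemma interp3 {A P X Y θ : ℝ} (hA : 0 ≤ A) (h0 : 0 ≤ θ) (h1 : θ ≤ 1) (hX : 0 ≤ X) (hY : 0 ≤ Y) (hPp : 0 ≤ P)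
    (hP : A ≤ P * X) (hQ : A ≤ P * Y) : A ≤ P * (X ^ (1 - θ) * Y ^ θ) := by
  refine (interp hA h0 h1 hP hQ).trans (le_of_eq ?_)
  rw [Real.mul_rpow hPp hX, Real.mul_rpow hPp hY]
  have : P ^ (1 - θ) * P ^ θ = P := by
    rcases hPp.eq_or_lt with rfl | h
    · rcases h0.eq_or_lt with rfl | h0
      · simp
      · rw [Real.zero_rpow h0.ne', mul_zero]
    · rw [← Real.rpow_add h]; simp
  calc _ = (P ^ (1 - θ) * P ^ θ) * (X ^ (1 - θ) * Y ^ θ) := by ring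
    _ = _ := by rw [this]

lemma lip_hol {f : Spc m → ℝ} {L M θ : ℝ} (h0 : 0 ≤ θ) (h1 : θ ≤ 1) (hL0 : 0 ≤ L) (hL : ∀ x y, |f x - f y| ≤ L * ‖x - y‖)
    (hM : ∀ x, |f x| ≤ M) : Hd θ (2 * M + L) f := fun x y => by
  have hM0 : 0 ≤ M := (abs_nonneg _).trans (hM x)
  have := interp3 (abs_nonneg (f x - f y)) h0 h1 zero_le_one (norm_nonneg (x - y)) (P := 2 * M + L) (by positivity)
    (by have := abs_sub (f x) (f y); linarith [hM x, hM y])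
    ((hL x y).trans (by gcongr; linarith))
  simpa using this

lemma Per.tr {f : Spc m → ℝ} (hf : Per f) (v : Spc m) : Per (fun z => f (z + v)) := fun x k j => by
  have := hf (x + v) k j
  simp only at this ⊢
  rw [← this]; congr 1
  ext <;> simp <;> ring

lemma cv_tr (k f : Spc m → ℝ) (x v : Spc m) : cv k f (x + v) = cv k (fun z => f (z + v)) x := by
  unfold cv; congr 1; ext z; rw [show x + v - z = x - z + v by abel]

lemma cv_df {k f : Spc m → ℝ} (hk : Dec k) (hf : Per f) (hc : Continuous f) (x y : Spc m) :
    cv k f x - cv k f y = cv k (fun z => f z - f (z + (y - x))) x := by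
  rw [cv_sub hk (PI.ofCont hf hc) (PI.ofCont (hf.tr _) (by fun_prop)), ← cv_tr]; simp

lemma k1_lip {a M : ℝ} (ha : 0 < a) {f : Spc m → ℝ} (hf : PI f) (v x y : Spc m) (hM : ∀ z, |f z| ≤ M) :
    |cv (G1 a v) f x - cv (G1 a v) f y| ≤ KK m * ‖v‖ * ‖x - y‖ * a ^ (-1 : ℝ) * M := by
  have := mvt (PX (dec_G1 ha v) (dec_G2 ha v (x - y)) hf (x - y) y (deriv_G1 ha v (x - y))) (fun u => k2_sup ha v (x - y) _ hM) 1
  simpa using this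

lemma k0_lip {a M : ℝ} (ha : 0 < a) {f : Spc m → ℝ} (hf : PI f) (x y : Spc m) (hM : ∀ z, |f z| ≤ M) :
    |cv (Gk a) f x - cv (Gk a) f y| ≤ KK m * ‖x - y‖ * a ^ (-(1/2) : ℝ) * M := by
  have := mvt (PX (dec_Gk ha) (dec_G1 ha (x - y)) hf (x - y) y (deriv_Gk ha (x - y))) (fun u => k1_sup ha (x - y) _ hM) 1
  simpa using this

lemma k1_hol {a M θ : ℝ} (ha : 0 < a) (h0 : 0 ≤ θ) (h1 : θ ≤ 1) {f : Spc m → ℝ} (hf : PI f) (o : Option (Fin m)) (x y : Spc m) (hM : ∀ z, |f z| ≤ M) :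
    |cv (G1 a (ed o)) f x - cv (G1 a (ed o)) f y| ≤ 2 * KK m * M * a ^ (-(1/2) - θ / 2) * ‖x - y‖ ^ θ := by
  have hM0 : 0 ≤ M := (abs_nonneg _).trans (hM x)
  have hK := KK_pos m
  have e1 := k1_sup ha (ed o) x hM
  have e2 := k1_sup ha (ed o) y hM
  have e3 := k1_lip ha hf (ed o) x y hM
  rw [norm_ed] at e1 e2 e3
  have q : 0 ≤ KK m * ‖x - y‖ * a ^ (-1 : ℝ) * M := by positivity
  have := interp3 (abs_nonneg _) h0 h1 (X := a ^ (-(1/2) : ℝ)) (Y := a ^ (-1 : ℝ) * ‖x - y‖) (by positivity) (by positivity) (P := 2 * KK m * M) (by positivity)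
    ((abs_sub (cv (G1 a (ed o)) f x) (cv (G1 a (ed o)) f y)).trans (by linarith)) (by linarith)
  refine this.trans (le_of_eq ?_)
  rw [Real.mul_rpow (by positivity) (norm_nonneg _), ← Real.rpow_mul ha.le, ← Real.rpow_mul ha.le,
    show -(1/2) - θ / 2 = -(1/2) * (1 - θ) + -1 * θ by ring, Real.rpow_add ha]
  ring

lemma HS.duh2 (H : HS V β p T ψ) {s t : ℝ} (hs : s ∈ Ico0 T) (ht : t ∈ Ico0 T)
    (hst : s < t) (hb : t - s ≤ β) (x y : Spc m) {K γ : ℝ} (hγ : 0 < γ)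
    (hK : ∀ r ∈ Ioo0 T, r < t → ∀ a, 0 < a → a ≤ 1 → a = (t - r) / β → ∀ o, |cv (G1 a (ed o)) (gF V (ψ r) o) x - cv (G1 a (ed o)) (gF V (ψ r) o) y| ≤ K * a ^ (γ - 1)) :
    |ψ t x - ψ t y - (cv (Gk ((t - s) / β)) (ψ s) x - cv (Gk ((t - s) / β)) (ψ s) y)| ≤ ((m + 1) * β ^ (1 - γ) / γ) * K * (t - s) ^ γ := by
  have := H.duhX hs ht hst hb (ι := Fin 2) ![1, -1] ![x, y] hγ (K := K) (fun r hr a h1 h2 h3 o => by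
    have hr' : r ∈ Ioo0 T := ic_mid' ht (by linarith [hr.1, hs.1]) hr.2.le
    simpa [Fin.sum_univ_two, sub_eq_add_neg] using hK r hr' hr.2 a h1 h2 h3 o)
  simpa [Fin.sum_univ_two, sub_eq_add_neg] using this

lemma HS.duh4 (H : HS V β p T ψ) {s t : ℝ} (hs : s ∈ Ico0 T) (ht : t ∈ Ico0 T)
    (hst : s < t) (hb : t - s ≤ β) (x y x' y' : Spc m) {K γ : ℝ} (hγ : 0 < γ)
    (hK : ∀ r ∈ Ioo0 T, ∀ a, 0 < a → a ≤ 1 → ∀ o, |cv (G1 a (ed o)) (gF V (ψ r) o) x - cv (G1 a (ed o)) (gF V (ψ r) o) y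
      - (cv (G1 a (ed o)) (gF V (ψ r) o) x' - cv (G1 a (ed o)) (gF V (ψ r) o) y')| ≤ K * a ^ (γ - 1)) :
    |ψ t x - ψ t y - (ψ t x' - ψ t y') - (cv (Gk ((t - s) / β)) (ψ s) x - cv (Gk ((t - s) / β)) (ψ s) y
      - (cv (Gk ((t - s) / β)) (ψ s) x' - cv (Gk ((t - s) / β)) (ψ s) y'))| ≤ ((m + 1) * β ^ (1 - γ) / γ) * K * (t - s) ^ γ := by
  have e : ∀ F : Spc m → ℝ, ∑ i : Fin 4, (![1, -1, -1, 1] : Fin 4 → ℝ) i * F ((![x, y, x', y'] : Fin 4 → Spc m) i) = F x - F y - (F x' - F y') := by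
    intro F; simp [Fin.sum_univ_four]; ring
  have := H.duhX hs ht hst hb (ι := Fin 4) ![1, -1, -1, 1] ![x, y, x', y'] hγ (K := K) (fun r hr a h1 h2 h3 o => by
    have hr' : r ∈ Ioo0 T := ic_mid' ht (by linarith [hr.1, hs.1]) hr.2.le
    rw [e]
    exact hK r hr' a h1 h2 o)
  rw [e, e] at this
  exact this

lemma HS.gB (H : HS V β p T ψ) : ∃ M : ℝ, 0 < M ∧ ∀ t ∈ Ico0 T, ∀ o x, |gF V (ψ t) o x| ≤ M := by
  obtain ⟨B, hB0, hB⟩ := H.bB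
  obtain ⟨M, hM0, hM⟩ := H.c1
  refine ⟨B * M, by positivity, fun t ht o x => ?_⟩
  rw [gF, abs_mul]
  exact mul_le_mul (hB t ht o x) (hM t ht x) (abs_nonneg _) hB0.le

/-- uniform spatial Hölder bound -/
lemma HS.hol (H : HS V β p T ψ) {L : ℝ} (hL0 : 0 ≤ L) (hL : ∀ x y, |ψ 0 x - ψ 0 y| ≤ L * ‖x - y‖) :
    ∃ A : ℝ, 0 < A ∧ ∀ t ∈ Ico0 T, Hd (4/5) A (ψ t) := by
  have hβ := H.hβ
  have hKK := KK_pos m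
  obtain ⟨M, hM0, hM⟩ := H.c1
  obtain ⟨N, hN0, hN⟩ := H.gB
  set E := ((m + 1) * β ^ (1 - (1/10:ℝ)) / (1/10)) * (2 * KK m * N) * β ^ (1/10:ℝ) with hE
  have hE0 : 0 ≤ E := by positivity
  have q0 : 0 ≤ 2 * M + L := by positivity
  have q1 : 0 ≤ KK m * (2 * M + L) := by positivity
  have q2 : 0 ≤ 2 * (KK m * M) + KK m * M := by positivity
  refine ⟨1 + (2 * M + L) + E + KK m * (2 * M + L) + (2 * (KK m * M) + KK m * M), by positivity, fun t ht x y => ?_⟩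
  have hd0 : 0 ≤ ‖x - y‖ ^ (4/5:ℝ) := by positivity
  rcases ico_cases ht with rfl | hT
  · refine (lip_hol (θ := 4/5) (by norm_num) (by norm_num) hL0 hL (hM 0 ht) x y).trans (mul_le_mul_of_nonneg_right (by linarith) hd0)
  obtain ⟨s, hs, hst, hsb, hcase⟩ := start ht hT.1 hβ
  have hD := H.duh2 hs ht hst hsb x y (K := 2 * KK m * N * ‖x - y‖ ^ (4/5:ℝ)) (γ := 1/10) (by norm_num) (fun r hr _ a ha ha1 _ o => by
    have := k1_hol ha (θ := 4/5) (by norm_num) (by norm_num) (H.gPI hr o) o x y (hN r (io_sub hr) o)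
    refine this.trans (le_of_eq ?_)
    rw [show (-(1/2) - (4/5)/2 : ℝ) = 1/10 - 1 by norm_num]; ring)
  have hD2 : ((m + 1) * β ^ (1 - (1/10:ℝ)) / (1/10)) * (2 * KK m * N * ‖x - y‖ ^ (4/5:ℝ)) * (t - s) ^ (1/10:ℝ) ≤ E * ‖x - y‖ ^ (4/5:ℝ) := by
    have : 0 ≤ t - s := by linarith
    calc _ = ((m + 1) * β ^ (1 - (1/10:ℝ)) / (1/10)) * (2 * KK m * N) * (t - s) ^ (1/10:ℝ) * ‖x - y‖ ^ (4/5:ℝ) := by ring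
      _ ≤ _ := by rw [hE]; gcongr
  have hbase : |cv (Gk ((t - s) / β)) (ψ s) x - cv (Gk ((t - s) / β)) (ψ s) y| ≤ (KK m * (2 * M + L) + (2 * (KK m * M) + KK m * M)) * ‖x - y‖ ^ (4/5:ℝ) := by
    have ha : 0 < (t - s) / β := div_pos (sub_pos.2 hst) hβ
    rcases hcase with rfl | hc
    · rw [cv_df (dec_Gk ha) (H.per hs) (H.cont hs)]
      refine (k0_sup ha x (M := (2 * M + L) * ‖x - y‖ ^ (4/5:ℝ)) fun z => ?_).trans ?_
      · have := lip_hol (by norm_num) (by norm_num) hL0 hL (hM 0 hs) z (z + (y - x)) (θ := 4/5)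
        rwa [show z - (z + (y - x)) = x - y by abel] at this
      · rw [← mul_assoc]; gcongr; linarith
    · rw [hc, div_self hβ.ne']
      have := lip_hol (f := cv (Gk 1) (ψ s)) (L := KK m * M) (M := KK m * M) (θ := 4/5) (by norm_num) (by norm_num) (by positivity)
        (fun x y => by
          have := k0_lip one_pos (H.pi hs) x y (hM s hs)
          rw [Real.one_rpow] at this; linarith) (fun x => k0_sup one_pos x (hM s hs)) x y
      exact this.trans (mul_le_mul_of_nonneg_right (by linarith) hd0)
  have := abs_sub_abs_le_abs_sub (ψ t x - ψ t y) (cv (Gk ((t - s) / β)) (ψ s) x - cv (Gk ((t - s) / β)) (ψ s) y)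
  have : 0 ≤ (1 + (2 * M + L)) * ‖x - y‖ ^ (4/5:ℝ) := by positivity
  linarith
end

section
variable {m : ℕ} {V : Spc m → ℝ} {β p : ℝ} {T : ℝ≥0∞} {ψ : ℝ → Spc m → ℝ}

lemma Hd.mul {f g : Spc m → ℝ} {θ A B F G : ℝ} (hf : Hd θ A f) (hg : Hd θ B g) (hF : ∀ x, |f x| ≤ F) (hG : ∀ x, |g x| ≤ G) :
    Hd θ (A * G + F * B) (fun x => f x * g x) := fun x y => by
  have hF0 : 0 ≤ F := (abs_nonneg _).trans (hF x)
  have hG0 : 0 ≤ G := (abs_nonneg _).trans (hG x)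
  have h1 := hf x y
  have h2 := hg x y
  calc |f x * g x - f y * g y| = |(f x - f y) * g x + f y * (g x - g y)| := by ring_nf
    _ ≤ |f x - f y| * |g x| + |f y| * |g x - g y| := by rw [← abs_mul, ← abs_mul]; exact abs_add_le _ _
    _ ≤ (A * ‖x - y‖ ^ θ) * G + F * (B * ‖x - y‖ ^ θ) :=
      add_le_add (mul_le_mul h1 (hG x) (abs_nonneg _) ((abs_nonneg _).trans h1)) (mul_le_mul (hF y) h2 (abs_nonneg _) hF0)
    _ = _ := by ring

lemma Hd.div {f g : Spc m → ℝ} {θ A B F c : ℝ} (hc : 0 < c) (hB : 0 ≤ B) (hf : Hd θ A f) (hg : Hd θ B g) (hF : ∀ x, |f x| ≤ F) (hG : ∀ x, c ≤ g x) :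
    Hd θ (A / c + F * B / c ^ 2) (fun x => f x / g x) := fun x y => by
  have hF0 : 0 ≤ F := (abs_nonneg _).trans (hF x)
  have h1 := hf x y
  have h2 := hg x y
  have gx := hG x
  have gy := hG y
  have gx0 : 0 < g x := hc.trans_le gx
  have gy0 : 0 < g y := hc.trans_le gy
  have e : f x / g x - f y / g y = (f x - f y) / g x - f y * (g x - g y) / (g x * g y) := by field_simp; ring
  simp only [e]
  refine (abs_sub _ _).trans ?_
  rw [abs_div, abs_div, abs_mul, abs_of_pos gx0, abs_of_pos (mul_pos gx0 gy0)]
  have hd : 0 ≤ ‖x - y‖ ^ θ := by positivity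
  calc _ ≤ (A * ‖x - y‖ ^ θ) / c + (F * (B * ‖x - y‖ ^ θ)) / (c * c) := by
        gcongr
        · exact (abs_nonneg _).trans h1
        · exact hF y
    _ = _ := by ring

lemma Hd.margX {f : Spc m → ℝ} {θ A : ℝ} (h0 : 0 ≤ θ) (hA : 0 ≤ A) (hf : Hd θ A f) (hp : Per f) (hc : Continuous f) : Hd θ A (margX f) := fun x y => by
  unfold _root_.margX marg
  rw [← integral_sub (slice_int hp hc _) (slice_int hp hc _)]
  have := norm_integral_le_of_norm_le_const (μ := volume.restrict (cube1 m)) (f := fun z => f (x.1, z) - f (y.1, z)) (C := A * ‖x - y‖ ^ θ) (ae_of_all _ fun z => ?_)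
  · simpa using this
  · refine (hf _ _).trans ?_
    have : ‖((x.1, z) : Spc m) - (y.1, z)‖ ≤ ‖x - y‖ := by
      rw [Prod.mk_sub_mk, sub_self, Prod.norm_mk]
      simp only [norm_zero]
      exact max_le (norm_fst_le (x - y)) (norm_nonneg _)
    gcongr

lemma HS.gHol (H : HS V β p T ψ) {A : ℝ} (hA0 : 0 < A) (hA : ∀ t ∈ Ico0 T, Hd (4/5) A (ψ t)) :
    ∃ A' : ℝ, 0 < A' ∧ ∀ t ∈ Ico0 T, ∀ o, Hd (4/5) A' (gF V (ψ t) o) := by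
  obtain ⟨B, hB0, hB⟩ := H.VB
  obtain ⟨B', hB'0, hB'⟩ := H.bB
  obtain ⟨c, hc, hlow⟩ := H.low
  obtain ⟨M, hM0, hM⟩ := H.c1
  choose L hL0 hL using fun o : Option (Fin m) => (pdV_CP1 H.hV H.hVp (ed o)).lip
  have hVh : ∀ o, Hd (4/5) (2 * B + ∑ o, L o) (pd (ed o) V) := fun o => lip_hol (by norm_num) (by norm_num) (Finset.sum_nonneg fun o _ => hL0 o)
    (fun x y => (hL o x y).trans (by gcongr; exact Finset.single_le_sum (fun o _ => hL0 o) (Finset.mem_univ o))) (hB o)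
  set LV := 2 * B + ∑ o, L o with hLV
  have hLV0 : 0 ≤ LV := add_nonneg (by positivity) (Finset.sum_nonneg fun o _ => hL0 o)
  set Φ := (LV * M + B * A) / c + (B * M) * A / c ^ 2 with hΦ
  have hΦ0 : 0 ≤ Φ := by positivity
  refine ⟨(LV + Φ) * M + B' * A, by positivity, fun t ht o => ?_⟩
  have hcont : Continuous (pd (e1 m) V) := (pdV_CP1 H.hV H.hVp (e1 m)).cont
  have hper : Per (pd (e1 m) V) := (pdV_CP1 H.hV H.hVp (e1 m)).1
  have hper2 : Per (fun x => pd (e1 m) V x * ψ t x) := fun x k j => by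
    have h1 := hper x k j
    have h2 := H.per ht x k j
    simp only [h1, h2]
  have hφ : Hd (4/5) Φ (fun x : Spc m => phiF V (ψ t) x.1) := by
    have h1 : Hd (4/5) (LV * M + B * A) (fun x => pd (e1 m) V x * ψ t x) := (hVh none).mul (hA t ht) (hB none) (hM t ht)
    have h2 := h1.margX (by norm_num) (by positivity) hper2 (hcont.mul (H.cont ht))
    have h3 := (hA t ht).margX (by norm_num) hA0.le (H.per ht) (H.cont ht)
    refine Hd.div hc hA0.le h2 h3 (F := B * M) (fun x => ?_) (fun x => hlow t ht x.1)
    have := norm_integral_le_of_norm_le_const (μ := volume.restrict (cube1 m)) (f := fun z => pd (e1 m) V (x.1, z) * ψ t (x.1, z)) (C := B * M) (ae_of_all _ fun z => ?_)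
    · simpa using this
    · rw [norm_mul]; exact mul_le_mul (hB none _) (hM t ht _) (norm_nonneg _) hB0.le
  have hb : Hd (4/5) (LV + Φ) (bF V (ψ t) o) := fun x y => by
    unfold bF
    have h1 := hVh o x y
    have h2 : |(if o = none then phiF V (ψ t) x.1 else 0) - (if o = none then phiF V (ψ t) y.1 else 0)| ≤ Φ * ‖x - y‖ ^ (4/5:ℝ) := by
      split_ifs
      · exact hφ x y
      · simp; positivity
    calc _ = |(pd (ed o) V x - pd (ed o) V y) - ((if o = none then phiF V (ψ t) x.1 else 0) - (if o = none then phiF V (ψ t) y.1 else 0))| := by congr 1; ring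
      _ ≤ _ := (abs_sub _ _).trans (by linarith)
  exact hb.mul (hA t ht) (hB' t ht o) (hM t ht)

lemma k2_hol {a A θ : ℝ} (ha : 0 < a) (h0 : 0 ≤ θ) (h1 : θ ≤ 1) {f : Spc m → ℝ} (hf : PI f) (hA : Hd θ A f) (o o' : Option (Fin m)) (x : Spc m) :
    |cv (G2 a (ed o) (ed o')) f x| ≤ KK m * A * a ^ (-1 + θ / 2) := by
  have := cv_wt (dec_G2 ha (ed o) (ed o')) hf ha (int_G2 ha _ _) (k2 ha h0 h1 _ _) x (L := A) (fun z => by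
    have := hA (x - z) x
    rwa [show x - z - x = -z by abel, norm_neg] at this)
  rw [zero_mul, sub_zero] at this
  refine this.trans (le_of_eq ?_)
  rw [norm_ed, norm_ed]; unfold KK; ring

lemma k1_mix {a A θ κ : ℝ} (ha : 0 < a) (h0 : 0 ≤ κ) (hκ : κ ≤ θ) (hθ : 0 < θ) (h1 : θ ≤ 1) (hA0 : 0 ≤ A) {f : Spc m → ℝ} (hp : Per f) (hc : Continuous f) (hA : Hd θ A f)
    (o o' : Option (Fin m)) (h : ℝ) (x v : Spc m) :
    |cv (G1 a (ed o)) f (x + h • ed o') - cv (G1 a (ed o)) f x - (cv (G1 a (ed o)) f (x + v + h • ed o') - cv (G1 a (ed o)) f (x + v))|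
      ≤ 2 * KK m * A * |h| * ‖v‖ ^ κ * a ^ (-1 + (θ - κ) / 2) := by
  have hf := PI.ofCont hp hc
  have hK := KK_pos m
  have hb : ∀ u : ℝ, |cv (G2 a (ed o) (ed o')) f (x + u • ed o') - cv (G2 a (ed o) (ed o')) f (x + v + u • ed o')| ≤ 2 * KK m * A * (‖v‖ ^ κ * a ^ (-1 + (θ - κ) / 2)) := by
    intro u
    have e1 := k2_hol ha hθ.le h1 hf hA o o' (x + u • ed o')
    have e2 := k2_hol ha hθ.le h1 hf hA o o' (x + v + u • ed o')
    have e3 : |cv (G2 a (ed o) (ed o')) f (x + u • ed o') - cv (G2 a (ed o) (ed o')) f (x + v + u • ed o')| ≤ KK m * a ^ (-1:ℝ) * (A * ‖v‖ ^ θ) := by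
      rw [cv_df (dec_G2 ha _ _) hp hc]
      have := k2_sup ha (ed o) (ed o') (x + u • ed o') (f := fun z => f z - f (z + (x + v + u • ed o' - (x + u • ed o')))) (M := A * ‖v‖ ^ θ) (fun z => by
        have := hA z (z + v)
        rw [show z - (z + v) = -v by abel, norm_neg] at this
        rwa [show x + v + u • ed o' - (x + u • ed o') = v by abel])
      rwa [norm_ed, norm_ed, mul_one, mul_one] at this
    have q : 0 ≤ KK m * a ^ (-1:ℝ) * (A * ‖v‖ ^ θ) := by positivity
    have := interp3 (abs_nonneg _) (θ := κ / θ) (by positivity) ((div_le_one hθ).2 hκ) (X := a ^ (-1 + θ / 2)) (Y := a ^ (-1:ℝ) * ‖v‖ ^ θ) (by positivity) (by positivity)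
      (P := 2 * KK m * A) (by positivity) ((abs_sub _ _).trans (by linarith)) (e3.trans (by linarith))
    refine this.trans (le_of_eq ?_)
    rw [Real.mul_rpow (by positivity) (by positivity), ← Real.rpow_mul ha.le, ← Real.rpow_mul ha.le, ← Real.rpow_mul (norm_nonneg _),
      mul_div_cancel₀ _ hθ.ne', show -1 + (θ - κ) / 2 = (-1 + θ / 2) * (1 - κ / θ) + -1 * (κ / θ) by field_simp; ring, Real.rpow_add ha]
    ring
  have := mvt (fun u => (PX (dec_G1 ha (ed o)) (dec_G2 ha (ed o) (ed o')) hf (ed o') x (deriv_G1 ha _ _) u).sub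
    (PX (dec_G1 ha (ed o)) (dec_G2 ha (ed o) (ed o')) hf (ed o') (x + v) (deriv_G1 ha _ _) u)) hb h
  simp only [Pi.sub_apply, zero_smul, add_zero] at this
  calc _ = _ := by congr 1; ring
    _ ≤ _ := this
    _ = _ := by ring

lemma k0_mix {M κ : ℝ} (h0 : 0 ≤ κ) (h1 : κ ≤ 1) {f : Spc m → ℝ} (hf : PI f) (hM : ∀ z, |f z| ≤ M)
    (o' : Option (Fin m)) (h : ℝ) (x v : Spc m) :
    |cv (Gk 1) f (x + h • ed o') - cv (Gk 1) f x - (cv (Gk 1) f (x + v + h • ed o') - cv (Gk 1) f (x + v))|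
      ≤ 2 * KK m * M * |h| * ‖v‖ ^ κ := by
  have := mvt (L := 2 * KK m * M * ‖v‖ ^ κ) (fun u => (PX (dec_Gk one_pos) (dec_G1 one_pos (ed o')) hf (ed o') x (deriv_Gk one_pos _) u).sub
    (PX (dec_Gk one_pos) (dec_G1 one_pos (ed o')) hf (ed o') (x + v) (deriv_Gk one_pos _) u)) (fun u => by
      have := k1_hol one_pos h0 h1 hf o' (x + u • ed o') (x + v + u • ed o') hM
      rw [Real.one_rpow, mul_one, show x + u • ed o' - (x + v + u • ed o') = -v by abel, norm_neg] at this
      exact this) h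
  simp only [Pi.sub_apply, zero_smul, add_zero] at this
  calc _ = _ := by congr 1; ring
    _ ≤ _ := this
    _ = _ := by ring

def mxd (f : Spc m → ℝ) (w v z : Spc m) : ℝ := f (z + w) - f z - (f (z + v + w) - f (z + v))

lemma PI_mxd {f : Spc m → ℝ} (hp : Per f) (hc : Continuous f) (w v : Spc m) : PI (mxd f w v) := by
  refine PI.ofCont ?_ (by unfold mxd; fun_prop)
  intro x k j
  have a1 := hp.tr w x k j
  have a2 := hp x k j
  have a3 := (hp.tr w).tr v x k j
  have a4 := hp.tr v x k j
  simp only [mxd] at *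
  rw [a1, a2, a3, a4]

lemma cv_mxd {k f : Spc m → ℝ} (hk : Dec k) (hp : Per f) (hc : Continuous f) (w v x : Spc m) :
    mxd (cv k f) w v x = cv k (mxd f w v) x := by
  have i1 := PI.ofCont (hp.tr w) (by fun_prop)
  have i2 := PI.ofCont hp hc
  have i3 := PI.ofCont ((hp.tr w).tr v) (by fun_prop)
  have i4 := PI.ofCont (hp.tr v) (by fun_prop)
  unfold mxd
  rw [cv_sub hk (i1.sub i2) (i3.sub i4), cv_sub hk i1 i2, cv_sub hk i3 i4, ← cv_tr, ← cv_tr, add_assoc, cv_tr k f x (v + w)]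
  simp only [add_assoc]
end

section
variable {m : ℕ} {V : Spc m → ℝ} {β p : ℝ} {T : ℝ≥0∞} {ψ : ℝ → Spc m → ℝ}

lemma HS.gPC (H : HS V β p T ψ) {t : ℝ} (ht : t ∈ Ioo0 T) (o) : CP1 (gF V (ψ t) o) :=
  gF_CP1 H.hV H.hVp (W2_CP1 (H.w2 t ht)) (H.pos t ht) o

/-- mixed Duhamel remainder -/
lemma HS.mixD (H : HS V β p T ψ) {A κ : ℝ} (hA0 : 0 < A) (hA : ∀ t ∈ Ico0 T, ∀ o, Hd (4/5) A (gF V (ψ t) o)) (h0 : 0 < κ) (h1 : κ ≤ 3/5) :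
    ∃ E : ℝ, 0 < E ∧ ∀ s ∈ Ico0 T, ∀ t ∈ Ico0 T, s < t → t - s ≤ β → ∀ (o : Option (Fin m)) (h : ℝ) (x v : Spc m),
      |mxd (ψ t) (h • ed o) v x - mxd (cv (Gk ((t - s) / β)) (ψ s)) (h • ed o) v x| ≤ E * |h| * ‖v‖ ^ κ * (t - s) ^ ((4/5 - κ) / 2) := by
  have hβ := H.hβ
  have hKK := KK_pos m
  set γ := (4/5 - κ) / 2 with hγ
  have hγ0 : 0 < γ := by rw [hγ]; linarith
  refine ⟨((m + 1) * β ^ (1 - γ) / γ) * (2 * KK m * A), by positivity, fun s hs t ht hst hb o h x v => ?_⟩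
  have := H.duh4 hs ht hst hb (x + h • ed o) x (x + v + h • ed o) (x + v) hγ0 (K := 2 * KK m * A * |h| * ‖v‖ ^ κ) (fun r hr a ha ha1 o' => by
    have := k1_mix ha h0.le (by linarith) (by norm_num) (by norm_num) hA0.le (H.gPC hr o').1 (H.gPC hr o').cont (hA r (io_sub hr) o') o' o h x v
    refine this.trans (le_of_eq ?_)
    rw [hγ]; ring_nf)
  refine this.trans (le_of_eq ?_); ring

lemma HS.mix (H : HS V β p T ψ) {A A0 κ : ℝ} (hA0 : 0 < A) (hA : ∀ t ∈ Ico0 T, ∀ o, Hd (4/5) A (gF V (ψ t) o)) (h0 : 0 < κ) (h1 : κ ≤ 3/5)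
    (hA00 : 0 ≤ A0) (hm0 : Mx κ A0 (ψ 0)) : ∃ A' : ℝ, 0 < A' ∧ ∀ t ∈ Ico0 T, Mx κ A' (ψ t) := by
  have hβ := H.hβ
  have hKK := KK_pos m
  obtain ⟨M, hM0, hM⟩ := H.c1
  obtain ⟨E, hE0, hE⟩ := H.mixD hA0 hA h0 h1
  refine ⟨A0 + E * β ^ ((4/5 - κ) / 2) + KK m * A0 + 2 * KK m * M, by positivity, fun t ht o h x v => ?_⟩
  rcases ico_cases ht with rfl | hT
  · refine (hm0 o h x v).trans ?_
    have : 0 ≤ E * β ^ ((4/5 - κ) / 2) + KK m * A0 + 2 * KK m * M := by positivity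
    gcongr; linarith
  obtain ⟨s, hs, hst, hsb, hcase⟩ := start ht hT.1 hβ
  have hD := hE s hs t ht hst hsb o h x v
  have hD2 : E * |h| * ‖v‖ ^ κ * (t - s) ^ ((4/5 - κ) / 2) ≤ E * |h| * ‖v‖ ^ κ * β ^ ((4/5 - κ) / 2) := by
    have : 0 ≤ t - s := by linarith
    gcongr; linarith
  have hbase : |mxd (cv (Gk ((t - s) / β)) (ψ s)) (h • ed o) v x| ≤ KK m * (A0 * |h| * ‖v‖ ^ κ) + 2 * KK m * M * |h| * ‖v‖ ^ κ := by
    have ha : 0 < (t - s) / β := div_pos (sub_pos.2 hst) hβ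
    rcases hcase with rfl | hc
    · rw [cv_mxd (dec_Gk ha) (H.per hs) (H.cont hs)]
      have := k0_sup ha x (f := mxd (ψ 0) (h • ed o) v) (fun z => hm0 o h z v)
      have q : 0 ≤ 2 * KK m * M * |h| * ‖v‖ ^ κ := by positivity
      linarith
    · rw [hc, div_self hβ.ne']
      have := k0_mix h0.le (by linarith) (H.pi hs) (hM s hs) o h x v
      have q : 0 ≤ KK m * (A0 * |h| * ‖v‖ ^ κ) := by positivity
      unfold mxd
      linarith
  have := abs_sub_abs_le_abs_sub (mxd (ψ t) (h • ed o) v x) (mxd (cv (Gk ((t - s) / β)) (ψ s)) (h • ed o) v x)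
  have q : 0 ≤ A0 * |h| * ‖v‖ ^ κ := by positivity
  unfold mxd at *
  linarith

lemma HS.time (H : HS V β p T ψ) {A A' A'' ρ : ℝ} (hA0 : 0 < A) (hA : ∀ t ∈ Ico0 T, ∀ o, Hd (4/5) A (gF V (ψ t) o)) (h0 : 0 < ρ) (h1 : ρ ≤ 1/5)
    (hA'0 : 0 < A') (hA' : ∀ t ∈ Ico0 T, Mx (3 * ρ) A' (ψ t)) (hA''0 : 0 < A'') (hA'' : ∀ t ∈ Ico0 T, Hd (4/5) A'' (ψ t)) :
    ∃ C : ℝ, 0 < C ∧ ∀ s ∈ Ico0 T, ∀ t ∈ Ico0 T, s < t → t - s ≤ β →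
      Mx ρ (C * (t - s) ^ ρ) (fun x => ψ t x - ψ s x) ∧ ∀ x, |ψ t x - ψ s x| ≤ C * (t - s) ^ ρ := by
  have hβ := H.hβ
  have hKK := KK_pos m
  have hCH := CH_pos m
  obtain ⟨N, hN0, hN⟩ := H.gB
  obtain ⟨E, hE0, hE⟩ := H.mixD hA0 hA h0 (by linarith)
  set E1 := ((m + 1) * β ^ (1 - (1/2:ℝ)) / (1/2)) * (KK m * N) with hE1
  set C1 := E * β ^ ((4/5 - ρ) / 2 - ρ) + 2 ^ 15 * CH m * (2 * A') * β ^ (-ρ) with hC1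
  set C2 := E1 * β ^ (1/2 - ρ) + 2 ^ 15 * β ^ (-(2/5) : ℝ) * CH m * A'' * β ^ (2/5 - ρ) with hC2
  have hpow : ∀ τ e : ℝ, 0 < τ → τ ≤ β → ρ ≤ e → τ ^ e ≤ β ^ (e - ρ) * τ ^ ρ := by
    intro τ e hτ hτβ he
    calc τ ^ e = τ ^ (e - ρ) * τ ^ ρ := by rw [← Real.rpow_add hτ]; ring_nf
      _ ≤ _ := by
        have : 0 ≤ e - ρ := by linarith
        gcongr
  have hC10 : 0 < C1 := by positivity
  have hC20 : 0 < C2 := by positivity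
  refine ⟨C1 + C2, by positivity, fun s hs t ht hst hb => ?_⟩
  have hτ : 0 < t - s := sub_pos.2 hst
  have ha : 0 < (t - s) / β := div_pos hτ hβ
  constructor
  · intro o h x v
    have hD := hE s hs t ht hst hb o h x v
    have hD2 := hpow _ ((4/5 - ρ) / 2) hτ hb (by linarith)
    set w := h • (ed o : Spc m) with hw
    have hH : |mxd (cv (Gk ((t - s) / β)) (ψ s)) w v x - 1 * mxd (ψ s) w v x| ≤ 2 ^ 15 * ((t - s) / β) ^ ((2 * ρ) / 2) * CH m * (2 * A' * |h| * ‖v‖ ^ ρ) := by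
      rw [cv_mxd (dec_Gk ha) (H.per hs) (H.cont hs)]
      refine cv_wt (dec_Gk ha) (PI_mxd (H.per hs) (H.cont hs) _ _) (θ := 2 * ρ) ha (integral_Gk ha) (k0 ha (by linarith) (by linarith)) x (fun z => ?_)
      have m1 := hA' s hs o h (x - z) v
      have m2 := hA' s hs o h x v
      have m3 := hA' s hs o h (x - z) z
      have m4 := hA' s hs o h (x + v - z) z
      rw [← hw] at m1 m2 m3 m4
      have e1 : |mxd (ψ s) w v (x - z) - mxd (ψ s) w v x| ≤ (2 * A' * |h|) * ‖v‖ ^ (3 * ρ) := by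
        refine (abs_sub _ _).trans ?_
        unfold mxd; linarith
      have e2 : |mxd (ψ s) w v (x - z) - mxd (ψ s) w v x| ≤ (2 * A' * |h|) * ‖z‖ ^ (3 * ρ) := by
        have : mxd (ψ s) w v (x - z) - mxd (ψ s) w v x = mxd (ψ s) w z (x - z) - mxd (ψ s) w z (x + v - z) := by
          unfold mxd
          rw [show x - z + z = x by abel, show x + v - z + z = x + v by abel, show x - z + v = x + v - z by abel]
          ring
        rw [this]
        refine (abs_sub _ _).trans ?_
        unfold mxd; linarith
      have := interp3 (abs_nonneg _) (θ := 2/3) (by norm_num) (by norm_num) (by positivity) (by positivity) (by positivity) e1 e2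
      refine this.trans (le_of_eq ?_)
      rw [← Real.rpow_mul (norm_nonneg _), ← Real.rpow_mul (norm_nonneg _), show 3 * ρ * (1 - 2/3) = ρ by ring, show 3 * ρ * (2/3) = 2 * ρ by ring]
      ring
    rw [one_mul, show 2 * ρ / 2 = ρ by ring, Real.div_rpow hτ.le hβ.le] at hH
    have e : ψ t (x + w) - ψ s (x + w) - (ψ t x - ψ s x) - (ψ t (x + v + w) - ψ s (x + v + w) - (ψ t (x + v) - ψ s (x + v)))
      = (mxd (ψ t) w v x - mxd (cv (Gk ((t - s) / β)) (ψ s)) w v x) + (mxd (cv (Gk ((t - s) / β)) (ψ s)) w v x - mxd (ψ s) w v x) := by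
      unfold mxd; ring
    rw [e]
    refine (abs_add_le _ _).trans ((add_le_add hD hH).trans ?_)
    calc _ ≤ E * |h| * ‖v‖ ^ ρ * (β ^ ((4/5 - ρ) / 2 - ρ) * (t - s) ^ ρ) + 2 ^ 15 * ((t - s) ^ ρ / β ^ ρ) * CH m * (2 * A' * |h| * ‖v‖ ^ ρ) := by gcongr
      _ = C1 * (t - s) ^ ρ * |h| * ‖v‖ ^ ρ := by rw [hC1, Real.rpow_neg hβ.le]; ring
      _ ≤ _ := by gcongr; linarith
  · intro x
    have hD := H.duh1 hs ht hst hb x (K := KK m * N) (γ := 1/2) (by norm_num) (fun r hr a ha ha1 _ o => by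
      have hr' : r ∈ Ioo0 T := ic_mid' ht (by linarith [hr.1, hs.1]) hr.2.le
      have := k1_sup ha (ed o) x (hN r (io_sub hr') o)
      rw [norm_ed] at this
      refine this.trans (le_of_eq ?_)
      rw [show (1/2:ℝ) - 1 = -(1/2) by norm_num]; ring)
    have hH := cv_wt (dec_Gk ha) (H.pi hs) (θ := 4/5) ha (integral_Gk ha) (k0 ha (by norm_num) (by norm_num)) x (L := A'') (fun z => by
      have := hA'' s hs (x - z) x
      rwa [show x - z - x = -z by abel, norm_neg] at this)
    have p1 := hpow _ (1/2) hτ hb (by linarith)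
    have p2 := hpow _ (2/5) hτ hb (by linarith)
    rw [one_mul, show (4/5:ℝ) / 2 = 2/5 by norm_num, Real.div_rpow hτ.le hβ.le] at hH
    rw [← hE1] at hD
    have e : ψ t x - ψ s x = (ψ t x - cv (Gk ((t - s) / β)) (ψ s) x) + (cv (Gk ((t - s) / β)) (ψ s) x - ψ s x) := by ring
    rw [e]
    refine (abs_add_le _ _).trans ((add_le_add hD hH).trans ?_)
    calc _ ≤ E1 * (β ^ (1/2 - ρ) * (t - s) ^ ρ) + 2 ^ 15 * ((β ^ (2/5 - ρ) * (t - s) ^ ρ) / β ^ (2/5:ℝ)) * CH m * A'' := by gcongr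
      _ = C2 * (t - s) ^ ρ := by rw [hC2, Real.rpow_neg hβ.le]; ring
      _ ≤ _ := by gcongr; linarith

lemma pd_hd {f : Spc m → ℝ} (hd : Differentiable ℝ f) (w x : Spc m) (u : ℝ) : HasDerivAt (fun u : ℝ => f (x + u • w)) (pd w f (x + u • w)) u := by
  have h1 : HasDerivAt (fun u : ℝ => x + u • w) w u := by
    simpa using ((hasDerivAt_id u).smul_const w).const_add x
  exact (hd (x + u • w)).hasFDerivAt.comp_hasDerivAt u h1

lemma grd_le (L : Spc m →L[ℝ] ℝ) {A : ℝ} (hA : ∀ o, |L (ed o)| ≤ A) : ‖L‖ ≤ (m + 1) * A := by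
  have hA0 : 0 ≤ A := (abs_nonneg _).trans (hA none)
  refine L.opNorm_le_bound (by positivity) fun x => ?_
  have e : x = x.1 • (ed none : Spc m) + ∑ i, x.2 i • (ed (some i) : Spc m) := by
    ext j
    · simp [ed, e1, eC, Prod.fst_sum]
    · simp [ed, e1, eC, Prod.snd_sum, Finset.sum_apply, Pi.single_apply]
  have h2 : ∀ i, |x.2 i| ≤ ‖x‖ := fun i => (norm_le_pi_norm x.2 i).trans (norm_snd_le x)
  calc ‖L x‖ = |x.1 * L (ed none) + ∑ i, x.2 i * L (ed (some i))| := by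
        conv_lhs => rw [e]
        simp [map_sum]
    _ ≤ |x.1 * L (ed none)| + ∑ i, |x.2 i * L (ed (some i))| := (abs_add_le _ _).trans (add_le_add le_rfl (Finset.abs_sum_le_sum_abs _ _))
    _ ≤ ‖x‖ * A + ∑ i : Fin m, ‖x‖ * A := by
      refine add_le_add ?_ (Finset.sum_le_sum fun i _ => ?_)
      · rw [abs_mul]; exact mul_le_mul (norm_fst_le x) (hA _) (abs_nonneg _) (norm_nonneg _)
      · rw [abs_mul]; exact mul_le_mul (h2 i) (hA _) (abs_nonneg _) (norm_nonneg _)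
    _ = _ := by simp; ring

lemma Mx.pd {f : Spc m → ℝ} {A ρ : ℝ} (hd : Differentiable ℝ f) (h : Mx ρ A f) (o : Option (Fin m)) (x v : Spc m) :
    |pd (ed o) f x - pd (ed o) f (x + v)| ≤ A * ‖v‖ ^ ρ := by
  have h1 := pd_hd hd (ed o) x 0
  have h2 := pd_hd hd (ed o) (x + v) 0
  simp only [zero_smul, add_zero] at h1 h2
  have h3 := (h1.sub h2).tendsto_slope_zero
  refine le_of_tendsto h3.abs (eventually_nhdsWithin_of_forall fun u hu => ?_)
  have := h o u x v
  have hu' : 0 < |u| := abs_pos.2 hu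
  simp only [Pi.sub_apply, zero_add, zero_smul, add_zero, smul_eq_mul, abs_mul, abs_inv]
  rw [inv_mul_le_iff₀ hu']
  calc _ = _ := by congr 1; ring
    _ ≤ _ := this
    _ = _ := by ring

lemma Per.ed {f : Spc m → ℝ} (hf : Per f) (o : Option (Fin m)) (x : Spc m) : f (x + ed o) = f x := by
  cases o with
  | none =>
    have := hf x 1 0
    rw [← this]; congr 1; ext <;> simp [_root_.ed, e1]
  | some i =>
    have := hf x 0 (Pi.single i 1)
    rw [← this]; congr 1
    ext j
    · simp [_root_.ed, eC]
    · by_cases h : j = i <;> simp [_root_.ed, eC, Pi.single_apply, h]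

lemma fin_norm {f : Spc m → ℝ} {A ρ : ℝ} (hd : Differentiable ℝ f) (hf : Per f) (h0 : 0 < ρ) (hb : ∀ x, |f x| ≤ A) (h : Mx ρ A f) :
    C1rhoNorm ρ f ≤ ENNReal.ofReal ((2 * m + 3) * A) := by
  have hA0 : 0 ≤ A := (abs_nonneg _).trans (hb 0)
  have hg : ∀ x, ‖grd f x‖ ≤ (m + 1) * A := fun x => grd_le _ fun o => by
    show |pd (ed o) f x| ≤ A
    obtain ⟨u, hu, h2⟩ := exists_hasDerivAt_eq_zero (f := fun u : ℝ => f (x + u • ed o)) (f' := fun u => pd (ed o) f (x + u • ed o)) (a := 0) (b := 1) one_pos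
      (fun u _ => (pd_hd hd (ed o) x u).continuousAt.continuousWithinAt) (by simp [hf.ed]) (fun u _ => pd_hd hd (ed o) x u)
    have := h.pd hd o x (u • ed o)
    rw [h2, sub_zero, norm_smul, norm_ed, mul_one] at this
    refine this.trans (mul_le_of_le_one_right hA0 (Real.rpow_le_one (abs_nonneg _) ?_ h0.le))
    rw [Real.norm_eq_abs, abs_of_pos hu.1]; exact hu.2.le
  have hh : ∀ x y, ‖grd f x - grd f y‖ / ‖x - y‖ ^ ρ ≤ (m + 1) * A := fun x y => by
    refine div_le_of_le_mul₀ (by positivity) (by positivity) ?_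
    rw [mul_assoc]
    refine grd_le _ fun o => ?_
    have := h.pd hd o x (y - x)
    rw [add_sub_cancel, norm_sub_rev] at this
    exact this
  unfold C1rhoNorm
  rw [show (2 * (m:ℝ) + 3) * A = A + (m + 1) * A + (m + 1) * A by ring, ENNReal.ofReal_add (by positivity) (by positivity), ENNReal.ofReal_add (by positivity) (by positivity)]
  refine add_le_add (add_le_add ?_ ?_) ?_
  · exact iSup_le fun x => ENNReal.ofReal_le_ofReal (hb x)
  · exact iSup_le fun x => ENNReal.ofReal_le_ofReal (hg x)
  · exact iSup_le fun x => iSup_le fun y => ENNReal.ofReal_le_ofReal (hh x y)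

lemma Mx.mono {f : Spc m → ℝ} {A B ρ : ℝ} (h : Mx ρ A f) (hAB : A ≤ B) : Mx ρ B f := fun o u x v => (h o u x v).trans (by gcongr)
end

section
variable {m : ℕ} {V : Spc m → ℝ} {β p : ℝ} {T : ℝ≥0∞} {ψ : ℝ → Spc m → ℝ}

lemma Mx.neg {f g : Spc m → ℝ} {A ρ : ℝ} (h : Mx ρ A (fun x => f x - g x)) : Mx ρ A (fun x => g x - f x) := fun o u x v => by
  rw [← abs_neg]
  refine le_trans (le_of_eq ?_) (h o u x v)
  congr 1; ring

lemma HS.main (H : HS V β p T ψ) {L A0 A1 ρ : ℝ} (hd : Differentiable ℝ (ψ 0)) (hL0 : 0 ≤ L) (hL : ∀ x y, |ψ 0 x - ψ 0 y| ≤ L * ‖x - y‖)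
    (h0 : 0 < ρ) (h1 : ρ ≤ 1/5) (hA0 : 0 ≤ A0) (hm0 : Mx (3 * ρ) A0 (ψ 0)) (hA1 : 0 ≤ A1) (hm1 : Mx ρ A1 (ψ 0)) : HolderC1rho ρ T ψ := by
  obtain ⟨M, hM0, hM⟩ := H.c1
  obtain ⟨B, hB0, hB⟩ := H.hol hL0 hL
  obtain ⟨G, hG0, hG⟩ := H.gHol hB0 hB
  obtain ⟨D, hD0, hD⟩ := H.mix hG0 hG (κ := 3 * ρ) (by linarith) (by linarith) hA0 hm0
  obtain ⟨E, hE0, hE⟩ := H.mix hG0 hG (κ := ρ) (by linarith) (by linarith) hA1 hm1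
  obtain ⟨C, hC0, hC⟩ := H.time hG0 hG h0 h1 hD0 hD hB0 hB
  have dif : ∀ t ∈ Ico0 T, Differentiable ℝ (ψ t) := fun t ht => by
    rcases ico_cases ht with rfl | h
    · exact hd
    · exact (W2_CP1 (H.w2 t h)).diff
  have hβ := H.hβ
  refine ⟨fun t ht => ⟨dif t ht, ?_⟩, (2 * m + 3) * (C + 2 * (M + E) * β ^ (-ρ)), fun s hs t ht => ?_⟩
  · refine (fin_norm (A := max M E) (dif t ht) (H.per ht) h0 (fun x => (hM t ht x).trans (le_max_left _ _)) ((hE t ht).mono (le_max_right _ _))).trans_lt ENNReal.ofReal_lt_top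
  · set K := C + 2 * (M + E) * β ^ (-ρ) with hK
    have key : ∀ s ∈ Ico0 T, ∀ t ∈ Ico0 T, s < t → Mx ρ (K * |t - s| ^ ρ) (fun x => ψ t x - ψ s x) ∧ ∀ x, |ψ t x - ψ s x| ≤ K * |t - s| ^ ρ := by
      intro s hs t ht hst
      have hτ : 0 < t - s := sub_pos.2 hst
      rw [abs_of_pos hτ]
      rcases le_or_gt (t - s) β with hb | hb
      · obtain ⟨c1, c2⟩ := hC s hs t ht hst hb
        have : C * (t - s) ^ ρ ≤ K * (t - s) ^ ρ := by
          refine mul_le_mul_of_nonneg_right ?_ (by positivity)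
          rw [hK]; have : 0 < 2 * (M + E) * β ^ (-ρ) := by positivity
          linarith
        exact ⟨c1.mono this, fun x => (c2 x).trans this⟩
      · have e : 2 * (M + E) ≤ K * (t - s) ^ ρ := by
          calc 2 * (M + E) = 2 * (M + E) * β ^ (-ρ) * β ^ ρ := by rw [mul_assoc, ← Real.rpow_add hβ]; simp
            _ ≤ K * (t - s) ^ ρ := by
              have : 2 * (M + E) * β ^ (-ρ) ≤ K := by rw [hK]; linarith
              gcongr
        constructor
        · refine Mx.mono (A := 2 * E) (fun o u x v => ?_) (by linarith)
          have a := hE t ht o u x v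
          have b := hE s hs o u x v
          calc _ = |(ψ t (x + u • ed o) - ψ t x - (ψ t (x + v + u • ed o) - ψ t (x + v))) - (ψ s (x + u • ed o) - ψ s x - (ψ s (x + v + u • ed o) - ψ s (x + v)))| := by congr 1; ring
            _ ≤ _ := (abs_sub _ _).trans (by linarith)
        · intro x
          exact (abs_sub _ _).trans (by linarith [hM t ht x, hM s hs x])
    have hdd : Differentiable ℝ (fun x => ψ t x - ψ s x) := (dif t ht).sub (dif s hs)
    have hpp : Per (fun x => ψ t x - ψ s x) := fun x k j => by
      show ψ t _ - ψ s _ = _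
      rw [H.per ht x k j, H.per hs x k j]
    rw [mul_assoc]
    rcases lt_trichotomy s t with hst | rfl | hst
    · obtain ⟨a, b⟩ := key s hs t ht hst
      exact fin_norm hdd hpp h0 b a
    · refine fin_norm hdd hpp h0 (fun x => ?_) fun o u x v => ?_
      · simp [Real.zero_rpow h0.ne']
      · simp [Real.zero_rpow h0.ne']
    · obtain ⟨a, b⟩ := key t ht s hs hst
      rw [abs_sub_comm] at a
      refine fin_norm hdd hpp h0 (fun x => ?_) a.neg
      rw [abs_sub_comm, abs_sub_comm t s]; exact b x
end

section
variable {m : ℕ}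

lemma co_add (o : Option (Fin m)) (a b : Spc m) : co o (a + b) = co o a + co o b := by cases o <;> simp [co]
lemma co_sub (o : Option (Fin m)) (a b : Spc m) : co o (a - b) = co o a - co o b := by cases o <;> simp [co]
lemma co_smul (o : Option (Fin m)) (c : ℝ) (a : Spc m) : co o (c • a) = c * co o a := by cases o <;> simp [co]
lemma co_ed (o o' : Option (Fin m)) : co o (ed o' : Spc m) = if o = o' then 1 else 0 := by
  cases o <;> cases o' <;> simp [co, ed, e1, eC, Pi.single_apply]
lemma mem_cube_co {z : Spc m} : z ∈ cube m ↔ ∀ o, 0 ≤ co o z ∧ co o z < 1 := by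
  constructor
  · rintro ⟨h1, h2⟩ o
    cases o with
    | none => exact h1
    | some i => exact h2 i (mem_univ _)
  · intro h
    exact ⟨h none, fun i _ => h (some i)⟩
lemma mem_ccube_co {z : Spc m} : z ∈ ccube m ↔ ∀ o, 0 ≤ co o z ∧ co o z ≤ 1 := by
  constructor
  · rintro ⟨h1, h2⟩ o
    cases o with
    | none => exact ⟨h1.1, h2.1⟩
    | some i => exact ⟨h1.2 i, h2.2 i⟩
  · intro h
    exact ⟨⟨(h none).1, fun i => (h (some i)).1⟩, ⟨(h none).2, fun i => (h (some i)).2⟩⟩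
lemma norm_le_co {z : Spc m} {r : ℝ} (hr : 0 ≤ r) : ‖z‖ ≤ r ↔ ∀ o, |co o z| ≤ r := by
  constructor
  · intro h o
    cases o with
    | none => exact (norm_fst_le z).trans h
    | some i => exact ((norm_le_pi_norm z.2 i).trans (norm_snd_le z)).trans h
  · intro h
    exact norm_prod_le_iff.2 ⟨h none, (pi_norm_le_iff_of_nonneg hr).2 fun i => h (some i)⟩
lemma cont_co (o : Option (Fin m)) : Continuous (co o : Spc m → ℝ) := by
  cases o <;> (unfold co; fun_prop)

/-- sample points near x inside the cube -/
def sp (o : Option (Fin m)) (r : ℝ) (x : Spc m) (w : Spc m × ℝ) : Spc m :=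
  x + (r / 2) • (w.1 - x) + (r / 2 * (w.2 - co o x)) • ed o

lemma co_sp (o o' : Option (Fin m)) (r : ℝ) (x : Spc m) (w : Spc m × ℝ) :
    co o' (sp o r x w) = co o' x + r / 2 * (co o' w.1 - co o' x) + r / 2 * (w.2 - co o x) * (if o' = o then 1 else 0) := by
  simp only [sp, co_add, co_smul, co_sub, co_ed]

lemma sp_mem {o : Option (Fin m)} {r : ℝ} {x : Spc m} {w : Spc m × ℝ} (hr : 0 < r) (hr1 : r ≤ 1) (hx : x ∈ ccube m) (hw : w.1 ∈ cube m)
    (ht0 : 0 ≤ w.2) (ht1 : w.2 ≤ 1) : sp o r x w ∈ cube m := by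
  rw [mem_ccube_co] at hx
  rw [mem_cube_co] at hw ⊢
  intro o'
  rw [co_sp]
  obtain ⟨a, b⟩ := hx o'
  obtain ⟨c, d⟩ := hw o'
  split_ifs with h
  · subst h
    constructor
    · nlinarith [mul_nonneg (sub_nonneg.2 hr1) a, mul_nonneg hr.le c, mul_nonneg hr.le ht0]
    · nlinarith [mul_nonneg (sub_nonneg.2 hr1) (sub_nonneg.2 b), mul_pos hr (sub_pos.2 d), mul_nonneg hr.le (sub_nonneg.2 ht1)]
  · constructor
    · nlinarith [mul_nonneg (sub_nonneg.2 hr1) a, mul_nonneg hr.le c]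
    · nlinarith [mul_nonneg (sub_nonneg.2 hr1) (sub_nonneg.2 b), mul_pos hr (sub_pos.2 d), mul_nonneg hr.le (sub_nonneg.2 b)]

lemma sp_dist {o : Option (Fin m)} {r : ℝ} {x : Spc m} {w : Spc m × ℝ} (hr : 0 < r) (hx : x ∈ ccube m) (hw : w.1 ∈ cube m)
    (ht0 : 0 ≤ w.2) (ht1 : w.2 ≤ 1) : ‖sp o r x w - x‖ ≤ r := by
  have e : sp o r x w - x = (r / 2) • (w.1 - x) + (r / 2 * (w.2 - co o x)) • ed o := by unfold sp; abel
  rw [mem_ccube_co] at hx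
  rw [mem_cube_co] at hw
  rw [e]
  have h1 : ‖w.1 - x‖ ≤ 1 := (norm_le_co zero_le_one).2 fun o' => by
    rw [co_sub, abs_le]; constructor <;> linarith [(hx o').1, (hx o').2, (hw o').1, (hw o').2]
  have h2 : |w.2 - co o x| ≤ 1 := by
    rw [abs_le]; constructor <;> linarith [(hx o).1, (hx o).2]
  calc _ ≤ ‖(r / 2) • (w.1 - x)‖ + ‖(r / 2 * (w.2 - co o x)) • (ed o : Spc m)‖ := norm_add_le _ _
    _ = r / 2 * ‖w.1 - x‖ + r / 2 * |w.2 - co o x| := by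
      rw [norm_smul, norm_smul, norm_ed, mul_one, norm_mul, Real.norm_of_nonneg (by positivity : 0 ≤ r / 2), Real.norm_eq_abs]
    _ ≤ r / 2 * 1 + r / 2 * 1 := by gcongr
    _ = r := by ring

/-- sample space -/
def nu (m : ℕ) : Measure (Spc m × ℝ) := (μT m).prod (volume.restrict (Ioc (0:ℝ) 1))
instance prI : IsProbabilityMeasure (volume.restrict (Ioc (0:ℝ) 1)) := ⟨by simp⟩
instance prNu (m : ℕ) : IsProbabilityMeasure (nu m) := by unfold nu; infer_instance
lemma nu_ae (m : ℕ) : ∀ᵐ w ∂(nu m), w.1 ∈ cube m ∧ 0 ≤ w.2 ∧ w.2 ≤ 1 := by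
  have : nu m = (volume.prod volume).restrict (cube m ×ˢ Ioc (0:ℝ) 1) := by
    unfold nu μT; rw [Measure.prod_restrict]
  rw [this]
  filter_upwards [ae_restrict_mem ((meas_cube m).prod measurableSet_Ioc)] with w hw
  exact ⟨hw.1, hw.2.1.le, hw.2.2⟩

lemma meas_sp (o : Option (Fin m)) (r : ℝ) (x : Spc m) : Measurable (sp o r x) := by
  unfold sp; fun_prop

lemma fr (m : ℕ) : Module.finrank ℝ (Spc m) = m + 1 := by simp [add_comm]

lemma lint_hom (F : Spc m → ℝ≥0∞) (hF : Measurable F) {c : ℝ} (hc : 0 < c) (a : Spc m) :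
    ∫⁻ z : Spc m, F (a + c • z) = ENNReal.ofReal (c ^ (m + 1))⁻¹ * ∫⁻ z, F z := by
  have h := Measure.map_addHaar_smul (volume : Measure (Spc m)) hc.ne'
  rw [fr, abs_of_pos (by positivity)] at h
  have h2 : ∫⁻ z, F (a + z) ∂(Measure.map (fun z : Spc m => c • z) volume) = ∫⁻ z : Spc m, F (a + c • z) :=
    lintegral_map (hF.comp (measurable_const_add a)) (measurable_const_smul c)
  rw [← h2]
  erw [h]
  rw [lintegral_smul_measure, lintegral_add_left_eq_self]; rfl

lemma lint_sp (F : Spc m → ℝ≥0∞) (hF : Measurable F) {o : Option (Fin m)} {r : ℝ} {x : Spc m} (hr : 0 < r) (hr1 : r ≤ 1) (hx : x ∈ ccube m) :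
    ∫⁻ w, F (sp o r x w) ∂(nu m) ≤ ENNReal.ofReal ((r / 2) ^ (m + 1))⁻¹ * ∫⁻ z in cube m, F z := by
  unfold nu
  rw [lintegral_prod_symm' (fun w => F (sp o r x w)) (hF.comp (meas_sp o r x))]
  have key : ∀ t ∈ Ioc (0:ℝ) 1, ∫⁻ z, F (sp o r x (z, t)) ∂(μT m) ≤ ENNReal.ofReal ((r / 2) ^ (m + 1))⁻¹ * ∫⁻ z in cube m, F z := by
    intro t ht
    have e : ∀ z, sp o r x (z, t) = (x - (r / 2) • x + (r / 2 * (t - co o x)) • ed o) + (r / 2) • z := fun z => by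
      simp only [sp, smul_sub]; abel
    calc ∫⁻ z, F (sp o r x (z, t)) ∂(μT m) ≤ ∫⁻ z, (cube m).indicator F (sp o r x (z, t)) := by
          unfold μT
          rw [← lintegral_indicator (meas_cube m)]
          refine lintegral_mono fun z => ?_
          by_cases hz : z ∈ cube m
          · rw [indicator_of_mem hz, indicator_of_mem (sp_mem hr hr1 hx hz ht.1.le ht.2)]
          · rw [indicator_of_notMem hz]; exact zero_le
      _ = _ := by
        simp only [e]
        rw [lint_hom _ (hF.indicator (meas_cube m)) (by positivity), lintegral_indicator (meas_cube m)]
  calc _ ≤ ∫⁻ t in Ioc (0:ℝ) 1, ENNReal.ofReal ((r / 2) ^ (m + 1))⁻¹ * ∫⁻ z in cube m, F z := setLIntegral_mono' measurableSet_Ioc key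
    _ = _ := by simp
end

section
variable {m : ℕ}

/-- local average of a partial derivative -/
def av (f : Spc m → ℝ) (o : Option (Fin m)) (r : ℝ) (x : Spc m) : ℝ := ∫ w, pd (ed o) f (sp o r x w) ∂(nu m)

lemma meas_pd (f : Spc m → ℝ) (v : Spc m) : Measurable (pd v f) := measurable_fderiv_apply_const ℝ f v

lemma av_int {f : Spc m → ℝ} {o : Option (Fin m)} {r : ℝ} {x : Spc m} (hr : 0 < r) (hr1 : r ≤ 1) (hx : x ∈ ccube m)
    (hi : Integrable (pd (ed o) f) (μT m)) : Integrable (fun w => pd (ed o) f (sp o r x w)) (nu m) := by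
  refine ⟨((meas_pd f _).comp (meas_sp o r x)).aestronglyMeasurable, ?_⟩
  refine (lint_sp (fun z => ‖pd (ed o) f z‖ₑ) (meas_pd f _).enorm hr hr1 hx).trans_lt ?_
  exact ENNReal.mul_lt_top ENNReal.ofReal_lt_top hi.2

lemma sp_hd {f : Spc m → ℝ} (hd : Differentiable ℝ f) (o : Option (Fin m)) (r : ℝ) (x z : Spc m) (t : ℝ) :
    HasDerivAt (fun t => f (sp o r x (z, t))) (r / 2 * pd (ed o) f (sp o r x (z, t))) t := by
  have h1 : HasDerivAt (fun t : ℝ => sp o r x (z, t)) ((r / 2) • ed o) t := by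
    have := (((hasDerivAt_id t).sub_const (co o x)).const_mul (r / 2)).smul_const (ed o : Spc m)
    simp only [mul_one] at this
    exact this.const_add (x + (r / 2) • (z - x))
  have := (hd (sp o r x (z, t))).hasFDerivAt.comp_hasDerivAt t h1
  rw [map_smul] at this
  exact this

lemma av_eq {f : Spc m → ℝ} (hd : Differentiable ℝ f) {o : Option (Fin m)} {r : ℝ} {x : Spc m} (hr : 0 < r) (hr1 : r ≤ 1) (hx : x ∈ ccube m)
    (hi : Integrable (pd (ed o) f) (μT m)) : av f o r x = ∫ z, (f (sp o r x (z, 1)) - f (sp o r x (z, 0))) / (r / 2) ∂(μT m) := by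
  have h := av_int hr hr1 hx hi
  unfold av
  unfold nu at h ⊢
  rw [integral_prod _ h]
  refine integral_congr_ae ?_
  filter_upwards [h.prod_right_ae] with z hz
  have h2 : IntervalIntegrable (fun t => r / 2 * pd (ed o) f (sp o r x (z, t))) volume 0 1 := by
    rw [intervalIntegrable_iff_integrableOn_Ioc_of_le zero_le_one]
    exact hz.const_mul _
  have := intervalIntegral.integral_eq_sub_of_hasDerivAt (fun t _ => sp_hd hd o r x z t) h2
  rw [intervalIntegral.integral_of_le zero_le_one, integral_const_mul] at this
  rw [← this]
  field_simp

lemma av_lim {f : Spc m → ℝ} (hd : Differentiable ℝ f) {o : Option (Fin m)} {x : Spc m} (hx : x ∈ ccube m)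
    (hi : Integrable (pd (ed o) f) (μT m)) : Tendsto (fun r => av f o r x) (nhdsWithin 0 (Ioi 0)) (nhds (pd (ed o) f x)) := by
  rw [Metric.tendsto_nhds]
  intro ε hε
  have h := (hd x).hasFDerivAt.isLittleO.def (show 0 < ε / 8 by positivity)
  rw [Metric.eventually_nhds_iff] at h
  obtain ⟨δ, hδ, h⟩ := h
  have hδ1 : Ioo (0:ℝ) (min δ 1) ∈ nhdsWithin 0 (Ioi (0:ℝ)) := Ioo_mem_nhdsGT (lt_min hδ one_pos)
  filter_upwards [hδ1] with r hr
  have hr0 := hr.1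
  have hr1 : r < 1 := hr.2.trans_le (min_le_right _ _)
  have hrδ : r < δ := hr.2.trans_le (min_le_left _ _)
  rw [av_eq hd hr0 hr1.le hx hi]
  have e : pd (ed o) f x = ∫ z, pd (ed o) f x ∂(μT m) := by simp
  have key : ∀ z ∈ cube m, |(f (sp o r x (z, 1)) - f (sp o r x (z, 0))) / (r / 2) - pd (ed o) f x| ≤ ε / 2 := by
    intro z hz
    have b : ∀ t : ℝ, 0 ≤ t → t ≤ 1 → |f (sp o r x (z, t)) - f x - fderiv ℝ f x (sp o r x (z, t) - x)| ≤ ε / 8 * r := by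
      intro t h0 h1
      have h3 := sp_dist (o := o) (w := (z, t)) hr0 hx hz h0 h1
      have := h (y := sp o r x (z, t)) (by rw [dist_eq_norm]; linarith)
      exact this.trans (by gcongr)
    have b0 := b 0 le_rfl zero_le_one
    have b1 := b 1 zero_le_one le_rfl
    have e2 : fderiv ℝ f x (sp o r x (z, 1) - x) - fderiv ℝ f x (sp o r x (z, 0) - x) = r / 2 * pd (ed o) f x := by
      rw [← map_sub]
      have : sp o r x (z, 1) - x - (sp o r x (z, 0) - x) = (r / 2) • ed o := by
        simp only [sp]
        rw [mul_sub, mul_sub, sub_smul, sub_smul]; simp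
      rw [this, map_smul]; rfl
    rw [show (f (sp o r x (z, 1)) - f (sp o r x (z, 0))) / (r / 2) - pd (ed o) f x = ((f (sp o r x (z, 1)) - f x - fderiv ℝ f x (sp o r x (z, 1) - x)) - (f (sp o r x (z, 0)) - f x - fderiv ℝ f x (sp o r x (z, 0) - x))) / (r / 2) by
      have : pd (ed o) f x = (r / 2 * pd (ed o) f x) / (r / 2) := by field_simp
      rw [this, ← e2]; ring]
    rw [abs_div, abs_of_pos (by positivity : 0 < r / 2), div_le_iff₀ (by positivity)]
    refine (abs_sub _ _).trans ?_
    linarith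
  have ki : Continuous fun z : Spc m => (f (sp o r x (z, 1)) - f (sp o r x (z, 0))) / (r / 2) := by
    have := hd.continuous
    unfold sp; fun_prop
  have hb : ∀ᵐ z ∂(μT m), ‖(f (sp o r x (z, 1)) - f (sp o r x (z, 0))) / (r / 2) - pd (ed o) f x‖ ≤ ε / 2 := by
    filter_upwards [ae_restrict_mem (meas_cube m)] with z hz using key z hz
  have hI : Integrable (fun z => (f (sp o r x (z, 1)) - f (sp o r x (z, 0))) / (r / 2) - pd (ed o) f x) (μT m) :=
    Integrable.of_bound (ki.sub continuous_const).aestronglyMeasurable _ hb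
  have hI2 : Integrable (fun z => (f (sp o r x (z, 1)) - f (sp o r x (z, 0))) / (r / 2)) (μT m) := by
    have := hI.add (integrable_const (pd (ed o) f x))
    refine this.congr (Eventually.of_forall fun z => ?_)
    simp
  have e3 : (∫ z, (f (sp o r x (z, 1)) - f (sp o r x (z, 0))) / (r / 2) ∂(μT m)) - pd (ed o) f x = ∫ z, ((f (sp o r x (z, 1)) - f (sp o r x (z, 0))) / (r / 2) - pd (ed o) f x) ∂(μT m) := by
    rw [integral_sub hI2 (integrable_const _)]; simp
  rw [dist_eq_norm, e3]
  refine (norm_integral_le_of_norm_le_const hb).trans_lt ?_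
  simp; linarith
end

section
variable {m : ℕ}

/-- Gagliardo kernel -/
def gk (f : Spc m → ℝ) (s p : ℝ) (u w : Spc m) : ℝ≥0∞ :=
  ENNReal.ofReal (‖grd f u - grd f w‖ ^ p / ‖u - w‖ ^ ((m : ℝ) + 1 + s * p))

lemma meas_gk (f : Spc m → ℝ) (s p : ℝ) : Measurable (Function.uncurry (gk f s p)) := by
  have h : Measurable (grd f) := measurable_fderiv ℝ f
  have h1 : Measurable fun q : Spc m × Spc m => ‖grd f q.1 - grd f q.2‖ := ((h.comp measurable_fst).sub (h.comp measurable_snd)).norm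
  unfold gk Function.uncurry
  refine ENNReal.measurable_ofReal.comp ((h1.pow_const p).div ?_)
  exact (Measurable.pow_const (by fun_prop) _)

lemma jensen {Ω : Type*} [MeasurableSpace Ω] {μ : Measure Ω} [IsProbabilityMeasure μ] {p : ℝ} (hp : 1 ≤ p) {F : Ω → ℝ} (hF : Measurable F) :
    ∫⁻ w, ‖F w‖ₑ ∂μ ≤ (∫⁻ w, ‖F w‖ₑ ^ p ∂μ) ^ (1 / p) := by
  have h := eLpNorm_le_eLpNorm_of_exponent_le (p := 1) (q := ENNReal.ofReal p) (μ := μ) (by simpa using hp) hF.aestronglyMeasurable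
  rw [eLpNorm_one_eq_lintegral_enorm, eLpNorm_eq_lintegral_rpow_enorm_toReal (by simp; linarith) ENNReal.ofReal_ne_top, ENNReal.toReal_ofReal (by linarith)] at h
  exact h

lemma gk_le {f : Spc m → ℝ} {o : Option (Fin m)} {r r' s p : ℝ} {x y : Spc m} (hp : 1 ≤ p) (hs : 0 ≤ s) (hr : 0 < r) (hr' : 0 < r') (hrr : r' ≤ r)
    (hx : x ∈ ccube m) (hy : y ∈ ccube m) (hxy : ‖x - y‖ ≤ r) {w w' : Spc m × ℝ} (hw : w.1 ∈ cube m ∧ 0 ≤ w.2 ∧ w.2 ≤ 1) (hw' : w'.1 ∈ cube m ∧ 0 ≤ w'.2 ∧ w'.2 ≤ 1) :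
    ‖pd (ed o) f (sp o r x w) - pd (ed o) f (sp o r' y w')‖ₑ ^ p ≤ ENNReal.ofReal ((3 * r) ^ ((m : ℝ) + 1 + s * p)) * gk f s p (sp o r x w) (sp o r' y w') := by
  have d1 := sp_dist (o := o) hr hx hw.1 hw.2.1 hw.2.2
  have d2 := sp_dist (o := o) hr' hy hw'.1 hw'.2.1 hw'.2.2
  generalize sp o r x w = u at *
  generalize sp o r' y w' = v at *
  have hE0 : 0 < (m : ℝ) + 1 + s * p := by positivity
  unfold gk
  generalize (m : ℝ) + 1 + s * p = E at *
  have d3 : ‖u - v‖ ≤ 3 * r := by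
    calc ‖u - v‖ = ‖(u - x) + (x - y) - (v - y)‖ := by congr 1; abel
      _ ≤ ‖u - x‖ + ‖x - y‖ + ‖v - y‖ := (norm_sub_le _ _).trans (add_le_add_left (norm_add_le _ _) _)
      _ ≤ _ := by linarith
  have d4 : ‖pd (ed o) f u - pd (ed o) f v‖ ≤ ‖grd f u - grd f v‖ := by
    have := (grd f u - grd f v).le_opNorm (ed o)
    rw [norm_ed, mul_one] at this
    exact this
  rw [← ENNReal.ofReal_mul (by positivity), ← ofReal_norm, ENNReal.ofReal_rpow_of_nonneg (norm_nonneg _) (by linarith)]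
  refine ENNReal.ofReal_le_ofReal ?_
  rcases eq_or_ne u v with huv | huv
  · rw [huv, sub_self, norm_zero, Real.zero_rpow (by linarith)]; positivity
  · have : 0 < ‖u - v‖ := norm_pos_iff.2 (sub_ne_zero.2 huv)
    calc ‖pd (ed o) f u - pd (ed o) f v‖ ^ p ≤ ‖grd f u - grd f v‖ ^ p := by gcongr
      _ = ‖u - v‖ ^ E * (‖grd f u - grd f v‖ ^ p / ‖u - v‖ ^ E) := by
        have : ‖u - v‖ ^ E ≠ 0 := by positivity
        field_simp
      _ ≤ _ := by gcongr

lemma meas_spd (g : Spc m → ℝ) (mg : Measurable g) (o : Option (Fin m)) (r r' : ℝ) (x y : Spc m) :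
    Measurable fun q : (Spc m × ℝ) × (Spc m × ℝ) => g (sp o r x q.1) - g (sp o r' y q.2) :=
  ((mg.comp (meas_sp o r x)).comp measurable_fst).sub ((mg.comp (meas_sp o r' y)).comp measurable_snd)

lemma av_d1 {f : Spc m → ℝ} {o : Option (Fin m)} {r r' p : ℝ} {x y : Spc m} (hp : 1 ≤ p) (hr : 0 < r) (hr1 : r ≤ 1) (hr' : 0 < r') (hr'1 : r' ≤ 1)
    (hx : x ∈ ccube m) (hy : y ∈ ccube m) (hi : Integrable (pd (ed o) f) (μT m)) :
    ‖av f o r x - av f o r' y‖ₑ ≤ (∫⁻ w, ∫⁻ w', ‖pd (ed o) f (sp o r x w) - pd (ed o) f (sp o r' y w')‖ₑ ^ p ∂(nu m) ∂(nu m)) ^ (1 / p) := by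
  have i1 := av_int hr hr1 hx hi
  have i2 := av_int hr' hr'1 hy hi
  have mg := meas_pd f (ed o)
  have a1 : av f o r x = ∫ w, pd (ed o) f (sp o r x w) ∂(nu m) := rfl
  have a2 : av f o r' y = ∫ w, pd (ed o) f (sp o r' y w) ∂(nu m) := rfl
  generalize pd (ed o) f = g at *
  generalize av f o r x = A at *
  generalize av f o r' y = B at *
  have e : A - B = ∫ w, ∫ w', (g (sp o r x w) - g (sp o r' y w')) ∂(nu m) ∂(nu m) := by
    have : ∀ w, ∫ w', (g (sp o r x w) - g (sp o r' y w')) ∂(nu m) = g (sp o r x w) - B := fun w => by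
      rw [integral_sub (integrable_const _) i2, ← a2]; simp
    simp only [this]
    rw [integral_sub i1 (integrable_const _), ← a1]; simp
  have mF := meas_spd g mg o r r' x y
  have s1 : ‖A - B‖ₑ ≤ ∫⁻ q, ‖g (sp o r x q.1) - g (sp o r' y q.2)‖ₑ ∂((nu m).prod (nu m)) := by
    rw [e, lintegral_prod _ mF.enorm.aemeasurable]
    exact (enorm_integral_le_lintegral_enorm _).trans (lintegral_mono fun w => enorm_integral_le_lintegral_enorm _)
  refine s1.trans ((jensen hp mF).trans (ENNReal.rpow_le_rpow ?_ (by positivity)))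
  rw [lintegral_prod _ (mF.enorm.pow_const p).aemeasurable]

lemma av_diff {f : Spc m → ℝ} {o : Option (Fin m)} {r r' s p : ℝ} {x y : Spc m} (hp : 1 ≤ p) (hs : 0 ≤ s) (hr : 0 < r) (hr1 : r ≤ 1) (hr' : 0 < r') (hrr : r' ≤ r)
    (hx : x ∈ ccube m) (hy : y ∈ ccube m) (hxy : ‖x - y‖ ≤ r) (hi : Integrable (pd (ed o) f) (μT m)) :
    ‖av f o r x - av f o r' y‖ₑ ≤ (ENNReal.ofReal ((3 * r) ^ ((m : ℝ) + 1 + s * p)) * (ENNReal.ofReal ((r / 2) ^ (m + 1))⁻¹ * (ENNReal.ofReal ((r' / 2) ^ (m + 1))⁻¹ *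
      ∫⁻ u in cube m, ∫⁻ w in cube m, gk f s p u w))) ^ (1 / p) := by
  have hr'1 : r' ≤ 1 := hrr.trans hr1
  refine (av_d1 hp hr hr1 hr' hr'1 hx hy hi).trans (ENNReal.rpow_le_rpow ?_ (by positivity))
  have mk := meas_gk f s p
  have s2 := fun (w w' : Spc m × ℝ) hw hw' => gk_le (f := f) (o := o) hp hs hr hr' hrr hx hy hxy (w := w) (w' := w') hw hw'
  generalize ENNReal.ofReal ((3 * r) ^ ((m : ℝ) + 1 + s * p)) = Q at *
  generalize gk f s p = k at *
  have mk1 : ∀ u, Measurable (k u) := fun u => mk.comp (measurable_const.prodMk measurable_id)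
  have mk2 : Measurable fun u => ∫⁻ w in cube m, k u w := Measurable.lintegral_prod_right' (f := Function.uncurry k) mk
  have mm : Measurable fun w => ∫⁻ v in cube m, k (sp o r x w) v := mk2.comp (meas_sp o r x)
  have l1 := fun u => lint_sp (k u) (mk1 u) (o := o) hr' hr'1 hy
  have l2 := lint_sp (fun u => ∫⁻ v in cube m, k u v) mk2 (o := o) hr hr1 hx
  generalize ENNReal.ofReal ((r / 2) ^ (m + 1))⁻¹ = c at *
  generalize ENNReal.ofReal ((r' / 2) ^ (m + 1))⁻¹ = c' at *
  calc _ ≤ ∫⁻ w, ∫⁻ w', Q * k (sp o r x w) (sp o r' y w') ∂(nu m) ∂(nu m) := by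
        refine lintegral_mono_ae ?_
        filter_upwards [nu_ae m] with w hw
        refine lintegral_mono_ae ?_
        filter_upwards [nu_ae m] with w' hw' using s2 w w' hw hw'
    _ ≤ ∫⁻ w, Q * (c' * ∫⁻ v in cube m, k (sp o r x w) v) ∂(nu m) := by
        refine lintegral_mono fun w => ?_
        have : Measurable fun w' => k (sp o r x w) (sp o r' y w') := (mk1 _).comp (meas_sp o r' y)
        show ∫⁻ w', Q * k (sp o r x w) (sp o r' y w') ∂(nu m) ≤ _
        rw [lintegral_const_mul Q this]
        exact mul_le_mul_right (l1 _) _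
    _ = Q * (c' * ∫⁻ w, (∫⁻ v in cube m, k (sp o r x w) v) ∂(nu m)) := by
        rw [lintegral_const_mul _ (mm.const_mul _), lintegral_const_mul _ mm]
    _ ≤ Q * (c' * (c * ∫⁻ u in cube m, ∫⁻ v in cube m, k u v)) := mul_le_mul_right (mul_le_mul_right l2 _) _
    _ = _ := by rw [mul_left_comm c']

/-- Morrey step with real constants -/
lemma av_mor {f : Spc m → ℝ} {o : Option (Fin m)} {s p : ℝ} (hp : 1 ≤ p) (hs : 0 ≤ s) (hi : Integrable (pd (ed o) f) (μT m))
    (hJ : ∫⁻ u in cube m, ∫⁻ w in cube m, gk f s p u w < ⊤) :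
    ∃ K : ℝ, 0 ≤ K ∧ ∀ r r' : ℝ, ∀ x ∈ ccube m, ∀ y ∈ ccube m, 0 < r → r ≤ 1 → r / 2 ≤ r' → r' ≤ r → ‖x - y‖ ≤ r →
      |av f o r x - av f o r' y| ≤ K * r ^ (s - (m + 1) / p) := by
  set J := ∫⁻ u in cube m, ∫⁻ w in cube m, gk f s p u w with hJd
  set E := (m : ℝ) + 1 + s * p with hE
  have hp0 : 0 < p := by linarith
  refine ⟨(3 ^ E * 8 ^ (m + 1) * J.toReal) ^ (1 / p), by positivity, fun r r' x hx y hy hr hr1 h1 h2 hxy => ?_⟩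
  have hr'0 : 0 < r' := by linarith
  have h := av_diff hp hs hr hr1 (by linarith) h2 hx hy hxy hi
  rw [← hJd, ← ENNReal.ofReal_toReal hJ.ne, ← ENNReal.ofReal_mul (by positivity), ← ENNReal.ofReal_mul (by positivity), ← ENNReal.ofReal_mul (by positivity),
    ENNReal.ofReal_rpow_of_nonneg (by positivity) (by positivity), ← ofReal_norm, ENNReal.ofReal_le_ofReal_iff (by positivity)] at h
  refine h.trans ?_
  have c1 : ((r' / 2) ^ (m + 1))⁻¹ ≤ ((r / 4) ^ (m + 1))⁻¹ := by
    have : r / 4 ≤ r' / 2 := by linarith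
    gcongr
  calc _ ≤ ((3 * r) ^ E * (((r / 2) ^ (m + 1))⁻¹ * (((r / 4) ^ (m + 1))⁻¹ * J.toReal))) ^ (1 / p) := by gcongr
    _ = (3 ^ E * 8 ^ (m + 1) * J.toReal * r ^ (p * (s - (m + 1) / p))) ^ (1 / p) := by
      congr 1
      rw [Real.mul_rpow (by norm_num) hr.le, div_pow, div_pow]
      have e1 : r ^ E = r ^ (p * (s - (m + 1) / p)) * (r ^ (m + 1) * r ^ (m + 1)) := by
        rw [← Real.rpow_natCast, ← Real.rpow_add hr, ← Real.rpow_add hr]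
        congr 1; push_cast; field_simp; rw [hE]; ring
      rw [e1, show (8:ℝ) = 2 * 4 by norm_num, mul_pow]
      field_simp
    _ = _ := by
      rw [Real.mul_rpow (by positivity) (by positivity), ← Real.rpow_mul hr.le]
      congr 2; field_simp

lemma grad_cc {f : Spc m → ℝ} (hd : Differentiable ℝ f) {o : Option (Fin m)} {s p : ℝ} (hp : 1 ≤ p) (hs : 0 ≤ s) (hi : Integrable (pd (ed o) f) (μT m))
    (hJ : ∫⁻ u in cube m, ∫⁻ w in cube m, gk f s p u w < ⊤) (hα : 0 < s - (m + 1) / p) :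
    ∃ A : ℝ, 0 ≤ A ∧ ∀ x ∈ ccube m, ∀ y ∈ ccube m, |pd (ed o) f x - pd (ed o) f y| ≤ A * ‖x - y‖ ^ (s - (m + 1) / p) := by
  obtain ⟨K, hK0, hK⟩ := av_mor hp hs hi hJ
  set α := s - (m + 1) / p
  set q := (1/2 : ℝ) ^ α with hq
  have hq1 : q < 1 := Real.rpow_lt_one (by norm_num) (by norm_num) hα
  have hq0 : 0 < q := by positivity
  have lim : ∀ x ∈ ccube m, ∀ r : ℝ, 0 < r → r ≤ 1 → |av f o r x - pd (ed o) f x| ≤ K * r ^ α / (1 - q) := by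
    intro x hx r hr hr1
    have hpos : ∀ k : ℕ, 0 < r * (1/2:ℝ) ^ k := fun k => by positivity
    have hle : ∀ k : ℕ, r * (1/2:ℝ) ^ k ≤ 1 := fun k => by
      have : (1/2:ℝ) ^ k ≤ 1 := pow_le_one₀ (by norm_num) (by norm_num)
      nlinarith
    have ht : Tendsto (fun k : ℕ => av f o (r * (1/2) ^ k) x) atTop (nhds (pd (ed o) f x)) := by
      refine (av_lim hd hx hi).comp (tendsto_nhdsWithin_iff.2 ⟨?_, Eventually.of_forall hpos⟩)
      have := (tendsto_pow_atTop_nhds_zero_of_lt_one (r := (1/2:ℝ)) (by norm_num) (by norm_num)).const_mul r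
      simpa using this
    have := dist_le_of_le_geometric_of_tendsto₀ q (K * r ^ α) hq1 (f := fun k : ℕ => av f o (r * (1/2) ^ k) x) (fun k => by
      have h := hK (r * (1/2) ^ k) (r * (1/2) ^ (k + 1)) x hx x hx (hpos k) (hle k) (by rw [pow_succ]; linarith) (by rw [pow_succ]; linarith [hpos k]) (by rw [sub_self, norm_zero]; exact (hpos k).le)
      rw [Real.dist_eq]
      refine h.trans (le_of_eq ?_)
      rw [Real.mul_rpow hr.le (by positivity), hq, ← Real.rpow_natCast, ← Real.rpow_natCast, ← Real.rpow_mul (by norm_num), ← Real.rpow_mul (by norm_num), mul_comm α]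
      ring) ht
    simpa [Real.dist_eq] using this
  have h1q : 0 < 1 - q := by linarith
  refine ⟨2 * (K / (1 - q)) + K, by positivity, fun x hx y hy => ?_⟩
  rcases eq_or_ne x y with rfl | hne
  · simp; positivity
  have hr : 0 < ‖x - y‖ := norm_pos_iff.2 (sub_ne_zero.2 hne)
  have hr1 : ‖x - y‖ ≤ 1 := (norm_le_co zero_le_one).2 fun o' => by
    rw [mem_ccube_co] at hx hy
    rw [co_sub, abs_le]; constructor <;> linarith [(hx o').1, (hx o').2, (hy o').1, (hy o').2]
  have a1 := lim x hx _ hr hr1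
  have a2 := lim y hy _ hr hr1
  have a3 := hK _ _ x hx y hy hr hr1 (by linarith) le_rfl le_rfl
  set r := ‖x - y‖
  calc |pd (ed o) f x - pd (ed o) f y| = |(av f o r x - av f o r y) - (av f o r x - pd (ed o) f x) + (av f o r y - pd (ed o) f y)| := by congr 1; ring
    _ ≤ |av f o r x - av f o r y| + |av f o r x - pd (ed o) f x| + |av f o r y - pd (ed o) f y| := (abs_add_le _ _).trans (add_le_add_left (abs_sub _ _) _)
    _ ≤ K * r ^ α + K * r ^ α / (1 - q) + K * r ^ α / (1 - q) := by linarith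
    _ = _ := by ring
end

section
variable {m : ℕ}

lemma glue {φ : ℝ → ℝ} {A α : ℝ} (hA : 0 ≤ A) (hα : 0 < α) (h : ∀ k : ℤ, ∀ a b : ℝ, k ≤ a → a ≤ k + 1 → k ≤ b → b ≤ k + 1 → |φ a - φ b| ≤ A * |a - b| ^ α)
    {a b : ℝ} (hab : |a - b| ≤ 1) : |φ a - φ b| ≤ 2 * A * |a - b| ^ α := by
  wlog hle : a ≤ b generalizing a b
  · rw [abs_sub_comm, abs_sub_comm a b]
    exact this (by rwa [abs_sub_comm]) (not_le.1 hle).le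
  have hb : b ≤ a + 1 := by rw [abs_sub_comm, abs_of_nonneg (by linarith)] at hab; linarith
  have f1 := Int.floor_le a
  have f2 := Int.lt_floor_add_one a
  rw [mul_assoc, two_mul]
  have hp : 0 ≤ A * |a - b| ^ α := by positivity
  rcases le_or_gt b (⌊a⌋ + 1) with h1 | h1
  · have := h ⌊a⌋ a b f1 f2.le (f1.trans hle) h1
    linarith
  · have a1 := h ⌊a⌋ a (⌊a⌋ + 1) f1 f2.le (by linarith) le_rfl
    have a2 := h (⌊a⌋ + 1) (⌊a⌋ + 1) b (by push_cast; linarith) (by push_cast; linarith) (by push_cast; linarith) (by push_cast; linarith)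
    have b1 : |a - (⌊a⌋ + 1)| ^ α ≤ |a - b| ^ α := by
      refine Real.rpow_le_rpow (abs_nonneg _) ?_ hα.le
      rw [abs_sub_comm, abs_sub_comm a b, abs_of_nonneg (by linarith), abs_of_nonneg (by linarith)]; linarith
    have b2 : |(⌊a⌋ + 1) - b| ^ α ≤ |a - b| ^ α := by
      refine Real.rpow_le_rpow (abs_nonneg _) ?_ hα.le
      rw [abs_sub_comm, abs_sub_comm a b, abs_of_nonneg (by linarith), abs_of_nonneg (by linarith)]; linarith
    have c1 := mul_le_mul_of_nonneg_left b1 hA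
    have c2 := mul_le_mul_of_nonneg_left b2 hA
    calc |φ a - φ b| = |(φ a - φ (⌊a⌋ + 1)) + (φ (⌊a⌋ + 1) - φ b)| := by congr 1; ring
      _ ≤ _ := (abs_add_le _ _).trans (by linarith)

/-- lattice vector -/
def latv (κ : Option (Fin m) → ℤ) : Spc m := ((κ none : ℝ), fun i => (κ (some i) : ℝ))
lemma co_latv (κ : Option (Fin m) → ℤ) (o : Option (Fin m)) : co o (latv κ) = κ o := by cases o <;> simp [co, latv]
lemma Per.lat' {f : Spc m → ℝ} (hf : Per f) (κ : Option (Fin m) → ℤ) (x : Spc m) : f (x + latv κ) = f x := hf x (κ none) (fun i => κ (some i))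

lemma hol_dir {g : Spc m → ℝ} (hg : Per g) {A α : ℝ} (hA : 0 ≤ A) (hα : 0 < α) (h : ∀ x ∈ ccube m, ∀ y ∈ ccube m, |g x - g y| ≤ A * ‖x - y‖ ^ α)
    (o : Option (Fin m)) (x : Spc m) {t : ℝ} (ht : |t| ≤ 1) : |g x - g (x + t • ed o)| ≤ 2 * A * |t| ^ α := by
  have key := glue (φ := fun a => g (x + (a - co o x) • ed o)) hA hα (fun k a b ha ha1 hb hb1 => by
    set κ : Option (Fin m) → ℤ := fun o' => - (if o' = o then k else ⌊co o' x⌋) with hκ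
    have mem : ∀ a : ℝ, k ≤ a → a ≤ k + 1 → x + (a - co o x) • ed o + latv κ ∈ ccube m := fun a h1 h2 => by
      rw [mem_ccube_co]
      intro o'
      rw [co_add, co_add, co_smul, co_ed, co_latv]
      by_cases h : o' = o
      · subst h; simp only [hκ, if_true]; push_cast; constructor <;> linarith
      · simp only [hκ, if_neg h]; push_cast
        constructor <;> linarith [Int.floor_le (co o' x), Int.lt_floor_add_one (co o' x)]
    have := h _ (mem a ha ha1) _ (mem b hb hb1)
    rw [hg.lat', hg.lat'] at this
    refine this.trans (le_of_eq ?_)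
    rw [show x + (a - co o x) • ed o + latv κ - (x + (b - co o x) • ed o + latv κ) = (a - b) • (ed o : Spc m) by module, norm_smul, norm_ed, mul_one, Real.norm_eq_abs])
    (a := co o x) (b := co o x + t) (by simpa using ht)
  simpa using key

lemma ed_sum (v : Spc m) : v = ∑ o, co o v • (ed o : Spc m) := by
  rw [Fintype.sum_option]
  ext j
  · simp [ed, e1, eC, co, Prod.fst_sum]
  · simp [ed, e1, eC, co, Prod.snd_sum, Finset.sum_apply, Pi.single_apply]

lemma hol_ext {g : Spc m → ℝ} (hg : Per g) {A α : ℝ} (hA : 0 ≤ A) (hα : 0 < α) (h : ∀ x ∈ ccube m, ∀ y ∈ ccube m, |g x - g y| ≤ A * ‖x - y‖ ^ α) :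
    ∃ B : ℝ, 0 ≤ B ∧ ∀ x v, |g x - g (x + v)| ≤ B * ‖v‖ ^ α := by
  have h0 : (0 : Spc m) ∈ ccube m := mem_ccube_co.2 fun o => by cases o <;> simp [co]
  have bd : ∀ x, |g x| ≤ |g 0| + A := fun x => by
    obtain ⟨y, hy, e⟩ := hg.red x
    rw [← e]
    have hy' := cube_sub_ccube m hy
    have hn : ‖y - 0‖ ≤ 1 := (norm_le_co zero_le_one).2 fun o' => by
      rw [mem_ccube_co] at h0 hy'
      rw [co_sub, abs_le]; constructor <;> linarith [(h0 o').1, (h0 o').2, (hy' o').1, (hy' o').2, show co o' (0 : Spc m) = 0 by cases o' <;> simp [co]]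
    have := (h y hy' 0 h0).trans (mul_le_of_le_one_right hA (Real.rpow_le_one (norm_nonneg _) hn hα.le))
    calc |g y| = |g 0 + (g y - g 0)| := by congr 1; ring
      _ ≤ _ := (abs_add_le _ _).trans (by linarith)
  refine ⟨(m + 1) * (2 * A) + 2 * (|g 0| + A), by positivity, fun x v => ?_⟩
  rcases le_or_gt ‖v‖ 1 with hv | hv
  · have hc : ∀ o, |co o v| ≤ ‖v‖ := (norm_le_co (norm_nonneg _)).1 le_rfl
    have ind : ∀ S : Finset (Option (Fin m)), |g x - g (x + ∑ o ∈ S, co o v • ed o)| ≤ S.card * (2 * A * ‖v‖ ^ α) := by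
      intro S
      induction S using Finset.induction_on with
      | empty => simp
      | insert o S ho ih =>
        rw [Finset.sum_insert ho, Finset.card_insert_of_notMem ho]
        have a := hol_dir hg hA hα h o (x + ∑ o ∈ S, co o v • ed o) ((hc o).trans hv)
        have b : 2 * A * |co o v| ^ α ≤ 2 * A * ‖v‖ ^ α := by have := hc o; gcongr
        rw [show x + (co o v • ed o + ∑ o ∈ S, co o v • ed o) = x + ∑ o ∈ S, co o v • ed o + co o v • (ed o : Spc m) by abel]
        push_cast
        refine (abs_sub_le _ _ _).trans (add_le_add ih a |>.trans ?_)
        linarith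
    have := ind Finset.univ
    rw [← ed_sum] at this
    refine this.trans ?_
    have hp : 0 ≤ 2 * (|g 0| + A) * ‖v‖ ^ α := by positivity
    simp only [Finset.card_univ, Fintype.card_option, Fintype.card_fin]; push_cast
    linarith
  · have h1 : 1 ≤ ‖v‖ ^ α := Real.one_le_rpow hv.le hα.le
    calc |g x - g (x + v)| ≤ 2 * (|g 0| + A) := (abs_sub _ _).trans (by linarith [bd x, bd (x + v)])
      _ ≤ (m + 1) * (2 * A) + 2 * (|g 0| + A) := by have : 0 ≤ ((m:ℝ) + 1) * (2 * A) := by positivity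
                                                    linarith
      _ ≤ _ := le_mul_of_one_le_right (by positivity) h1

lemma init_mx {f : Spc m → ℝ} (hd : Differentiable ℝ f) (hf : Per f) {A α κ : ℝ} (hA : 0 ≤ A) (hκ : 0 < κ) (hκα : κ ≤ α)
    (h : ∀ o x v, |pd (ed o) f x - pd (ed o) f (x + v)| ≤ A * ‖v‖ ^ α) : Mx κ (2 * A) f ∧ ∀ x y, |f x - f y| ≤ (m + 1) * A * ‖x - y‖ := by
  have hg : ∀ o x, |pd (ed o) f x| ≤ A := fun o x => by
    obtain ⟨u, hu, h2⟩ := exists_hasDerivAt_eq_zero (f := fun u : ℝ => f (x + u • ed o)) (f' := fun u => pd (ed o) f (x + u • ed o)) (a := 0) (b := 1) one_pos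
      (fun u _ => (pd_hd hd (ed o) x u).continuousAt.continuousWithinAt) (by simp [hf.ed]) (fun u _ => pd_hd hd (ed o) x u)
    have := h o x (u • ed o)
    rw [h2, sub_zero, norm_smul, norm_ed, mul_one] at this
    refine this.trans (mul_le_of_le_one_right hA (Real.rpow_le_one (abs_nonneg _) ?_ (by linarith)))
    rw [Real.norm_eq_abs, abs_of_pos hu.1]; exact hu.2.le
  have hk : ∀ o x v, |pd (ed o) f x - pd (ed o) f (x + v)| ≤ 2 * A * ‖v‖ ^ κ := fun o x v => by
    rcases le_or_gt ‖v‖ 1 with hv | hv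
    · have : ‖v‖ ^ α ≤ ‖v‖ ^ κ := Real.rpow_le_rpow_of_exponent_ge' (norm_nonneg _) hv hκ.le hκα
      refine (h o x v).trans ((mul_le_mul_of_nonneg_left this hA).trans ?_)
      have : 0 ≤ A * ‖v‖ ^ κ := by positivity
      linarith
    · have h1 : 1 ≤ ‖v‖ ^ κ := Real.one_le_rpow hv.le hκ.le
      exact ((abs_sub _ _).trans (by linarith [hg o x, hg o (x + v)])).trans (le_mul_of_one_le_right (by positivity) h1)
  constructor
  · intro o u x v
    have hder : ∀ t ∈ (univ : Set ℝ), HasDerivWithinAt (fun t : ℝ => f (x + t • ed o) - f (x + v + t • ed o)) (pd (ed o) f (x + t • ed o) - pd (ed o) f (x + v + t • ed o)) univ t :=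
      fun t _ => ((pd_hd hd (ed o) x t).sub (pd_hd hd (ed o) (x + v) t)).hasDerivWithinAt
    have := convex_univ.norm_image_sub_le_of_norm_hasDerivWithin_le (C := 2 * A * ‖v‖ ^ κ) hder (fun t _ => by
      have := hk o (x + t • ed o) v
      rwa [show x + t • ed o + v = x + v + t • ed o by abel] at this) (mem_univ 0) (mem_univ u)
    simp only [zero_smul, add_zero, sub_zero, Real.norm_eq_abs] at this
    calc _ = _ := by congr 1; ring
      _ ≤ _ := this
      _ = _ := by ring
  · intro x y
    have := convex_univ.norm_image_sub_le_of_norm_fderiv_le (𝕜 := ℝ) (f := f) (C := (m + 1) * A) (fun z _ => hd z) (fun z _ => grd_le _ fun o => hg o z) (mem_univ y) (mem_univ x)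
    exact this
end

section
variable {m : ℕ}

lemma init_sob {f : Spc m → ℝ} {σ p : ℝ} (hp : 1 ≤ p) (h1 : 1 < σ) (h2 : σ < 2) (hα : 0 < σ - 1 - (m + 1) / p) (h : MemW σ p f) :
    ∃ A : ℝ, 0 ≤ A ∧ ∀ o x v, |pd (ed o) f x - pd (ed o) f (x + v)| ≤ A * ‖v‖ ^ (σ - 1 - (m + 1) / p) := by
  obtain ⟨hper, hmeas, hd, -, hN⟩ := h
  have hd := hd h1.le
  have hf : Per f := hper
  unfold WNorm at hN
  rw [if_neg (by linarith), if_neg (by linarith), if_pos h2, if_neg h1.ne'] at hN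
  have hG : gagl (σ - 1) p (grd f) < ⊤ := (le_add_self).trans_lt hN
  have hL : eLpNorm (fun x => ‖grd f x‖) (ENNReal.ofReal p) (μT m) < ⊤ := (le_add_self.trans le_self_add).trans_lt hN
  have hJ : ∫⁻ u in cube m, ∫⁻ w in cube m, gk f (σ - 1) p u w < ⊤ := by
    unfold gagl at hG
    exact (ENNReal.rpow_lt_top_iff_of_pos (by positivity)).1 hG
  have hi : ∀ o, Integrable (pd (ed o) f) (μT m) := fun o => by
    have hgm : MemLp (fun x => ‖grd f x‖) (ENNReal.ofReal p) (μT m) := ⟨(measurable_fderiv ℝ f).norm.aestronglyMeasurable, hL⟩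
    refine (hgm.integrable (by simpa using hp)).mono' (meas_pd f _).aestronglyMeasurable (Eventually.of_forall fun x => ?_)
    have := (grd f x).le_opNorm (ed o)
    rwa [norm_ed, mul_one] at this
  have : ∀ o, ∃ B : ℝ, 0 ≤ B ∧ ∀ x v, |pd (ed o) f x - pd (ed o) f (x + v)| ≤ B * ‖v‖ ^ (σ - 1 - (m + 1) / p) := fun o => by
    obtain ⟨A, hA, h⟩ := grad_cc hd hp (by linarith) (hi o) hJ hα
    exact hol_ext (hf.pd _) hA hα h
  choose B hB0 hB using this
  refine ⟨∑ o, B o, Finset.sum_nonneg fun o _ => hB0 o, fun o x v => (hB o x v).trans ?_⟩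
  exact mul_le_mul_of_nonneg_right (Finset.single_le_sum (fun o _ => hB0 o) (Finset.mem_univ o)) (by positivity)

lemma init_inf {f : Spc m → ℝ} {ρ : ℝ} (h : MemC1rho ρ f) :
    ∃ A : ℝ, 0 ≤ A ∧ ∀ o x v, |pd (ed o) f x - pd (ed o) f (x + v)| ≤ A * ‖v‖ ^ ρ := by
  have hN := h.2
  unfold C1rhoNorm at hN
  have h3 := lt_of_le_of_lt le_add_self hN
  set S := ⨆ (x : Spc m) (y : Spc m), ENNReal.ofReal (‖grd f x - grd f y‖ / ‖x - y‖ ^ ρ) with hS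
  refine ⟨S.toReal, ENNReal.toReal_nonneg, fun o x v => ?_⟩
  have a : |pd (ed o) f x - pd (ed o) f (x + v)| ≤ ‖grd f x - grd f (x + v)‖ := by
    have := (grd f x - grd f (x + v)).le_opNorm (ed o)
    rw [norm_ed, mul_one] at this
    exact this
  rcases eq_or_ne v 0 with rfl | hv
  · simp; positivity
  have b : ENNReal.ofReal (‖grd f x - grd f (x + v)‖ / ‖x - (x + v)‖ ^ ρ) ≤ S := by
    rw [hS]; exact le_iSup₂ (f := fun (x y : Spc m) => ENNReal.ofReal (‖grd f x - grd f y‖ / ‖x - y‖ ^ ρ)) x (x + v)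
  have c := (ENNReal.ofReal_le_iff_le_toReal h3.ne).1 b
  have hv' : 0 < ‖v‖ := norm_pos_iff.2 hv
  rw [show x - (x + v) = -v by abel, norm_neg, div_le_iff₀ (by positivity)] at c
  exact a.trans c

lemma final {V : Spc m → ℝ} {β p : ℝ} {T : ℝ≥0∞} {ψ : ℝ → Spc m → ℝ} (H : HS V β p T ψ) {A α ρ : ℝ} (hd : Differentiable ℝ (ψ 0)) (hA : 0 ≤ A)
    (h : ∀ o x v, |pd (ed o) (ψ 0) x - pd (ed o) (ψ 0) (x + v)| ≤ A * ‖v‖ ^ α) (h0 : 0 < ρ) (h1 : ρ ≤ 1/5) (h3 : 3 * ρ ≤ α) : HolderC1rho ρ T ψ := by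
  have a := init_mx hd H.per0 hA (κ := 3 * ρ) (by linarith) h3 h
  have b := init_mx hd H.per0 hA (κ := ρ) h0 (by linarith) h
  exact H.main hd (by positivity) a.2 h0 h1 (by positivity) a.1 (by positivity) b.1
end

/-- **Optimal Hölder regularity (Theorem `loc` (iii)).** Assume `[H₁]`, `[H₂]` and let `ψ` be
the maximal `L^p`-solution. If `ψ₀ ∈ 𝒟^{σ_opt,p}` with `σ_opt = (8 + 2n/p)/5`, then for every
`ρ ∈ (0, (1 − n/p)/5)`, `ψ ∈ C^ρ([0,T_max), C^{1+ρ}(𝕋ⁿ))`; if `ψ₀ ∈ 𝒟^{8/5,∞}`, then for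
every `ρ ∈ (0, 1/5)`, `ψ ∈ C^ρ([0,T_max), C^{1+ρ}(𝕋ⁿ))` (here `n = m + 1`). -/
theorem fokkerPlanck_C1rho_regularity
    (m : ℕ) (V : Spc m → ℝ) (β σ p : ℝ) (ψ0 : Spc m → ℝ)
    (Tmax : ℝ≥0∞) (ψ : ℝ → Spc m → ℝ)
    (hV : ContDiff ℝ 2 V) (hVper : IsPeriodic V) (hβ : 0 < β)
    (h1 : Hyp1 σ p ψ0) (h2 : Hyp2 m σ p)
    (hψ : IsMaximalLpSolution V β σ p ψ0 Tmax ψ) :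
    (MemD ((8 + 2 * ((m : ℝ) + 1) / p) / 5) p ψ0 →
      ∀ ρ : ℝ, 0 < ρ → ρ < (1 - ((m : ℝ) + 1) / p) / 5 → HolderC1rho ρ Tmax ψ) ∧
    ((MemWInf (8 / 5) ψ0 ∧ ∀ x1 : ℝ, 0 < marg ψ0 x1) →
      ∀ ρ : ℝ, 0 < ρ → ρ < 1 / 5 → HolderC1rho ρ Tmax ψ) := by
  obtain ⟨hS, -, -⟩ := hψ
  obtain ⟨⟨hW, hpos⟩, hnn, hmass⟩ := h1
  obtain ⟨hm, hp, hσ1, hσ2⟩ := h2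
  have e0 : ψ 0 = ψ0 := funext hS.init
  have hm0 : (0:ℝ) ≤ m := Nat.cast_nonneg m
  have hp0 : 0 < p := by linarith
  have hq0 : 0 < ((m : ℝ) + 1) / p := by positivity
  have hq1 : ((m : ℝ) + 1) / p < 1 := by rw [div_lt_one hp0]; exact hp
  have hd : Differentiable ℝ (ψ 0) := e0 ▸ hW.2.2.1 (by linarith)
  have H : HS V β p Tmax ψ :=
    { hV := hV
      hVp := hVper
      hβ := hβ
      hm := hm
      hp := hp
      per0 := e0 ▸ hW.1
      cont0 := hd.continuous
      pos0 := e0 ▸ hpos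
      nn0 := e0 ▸ hnn
      mass0 := e0 ▸ hmass
      w2 := hS.regW2
      pos := fun t ht => (hS.regD t ht).2
      contLp := fun t ht ε hε => by
        obtain ⟨δ, hδ, h⟩ := hS.contLp t ht ε hε
        refine ⟨δ, hδ, fun t' ht' hlt => ?_⟩
        have := h t' ht' hlt
        unfold WNorm at this
        rwa [if_pos le_rfl] at this
      eqn := hS.eqn }
  refine ⟨fun hD ρ h0 h3 => ?_, fun hD ρ h0 h3 => ?_⟩
  · have hD1 := hD.1
    rw [← e0] at hD1
    have e2 : 2 * ((m : ℝ) + 1) / p = 2 * (((m : ℝ) + 1) / p) := by ring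
    obtain ⟨A, hA, h⟩ := init_sob (by linarith) (by rw [e2]; linarith) (by rw [e2]; linarith) (by rw [e2]; linarith) hD1
    exact final H hd hA h h0 (by linarith) (by rw [e2]; linarith)
  · have hD1 := hD.1.2
    rw [← e0] at hD1
    obtain ⟨A, hA, h⟩ := init_inf hD1
    exact final H hd hA h h0 (by linarith) (by linarith)
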